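/- arXiv:1101.4792 — 4 statements merged into one kernel-verified Lean document; each statement's English description precedes it below -/
import Mathlib

section
/- Let $q$ be a prime power and $\ell$ a prime not dividing $q$, let $g \ge 1$ and $d \in \{0, \dots, 2g\}$. If $q \equiv 1 \bmod \ell$ then $\mathfrak{P}(q,\ell,g,d) = \mathfrak{P}_{\mathrm{Sp}}(\ell,g,d)$, and if $q \not\equiv 1 \bmod \ell$ then $\mathfrak{P}(q,\ell,g,d) = \mathfrak{P}_{\mathrm{GL}}(\ell,g,d)$. -/
open Matrix Finset Filter

/-- The standard symplectic form matrix `Ω = [[0, I_g], [-I_g, 0]]` over `ZMod ℓ`. -/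
def Om (ℓ g : ℕ) : Matrix (Fin g ⊕ Fin g) (Fin g ⊕ Fin g) (ZMod ℓ) :=
  Matrix.fromBlocks 0 1 (-1) 0

/-- Membership in the group `GSp_{2g}^{(d)}(F_ℓ)` of `d`-symplectic similitudes:
invertible matrices `M` with `Mᵀ Ω M = d Ω`. -/
def inGSp (ℓ g : ℕ) (d : ZMod ℓ) (M : Matrix (Fin g ⊕ Fin g) (Fin g ⊕ Fin g) (ZMod ℓ)) :
    Prop :=
  IsUnit M.det ∧ Mᵀ * Om ℓ g * M = d • Om ℓ g

/-- The dimension of the eigenspace of `M` for the eigenvalue `1`, i.e. `dim ker (M - I)`. -/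
noncomputable def fixdim {n : Type} [Fintype n] [DecidableEq n] {R : Type} [CommRing R]
    (M : Matrix n n R) : ℕ :=
  Module.finrank R (LinearMap.ker (M - 1).mulVecLin)

/-- `𝔓(q, ℓ, g, k)`: the proportion of matrices in `GSp_{2g}^{(d)}(F_ℓ)` whose
`1`-eigenspace is `k`-dimensional. -/
noncomputable def PGSp (ℓ g : ℕ) (d : ZMod ℓ) (k : ℕ) : ℝ :=
  (Nat.card {M : Matrix (Fin g ⊕ Fin g) (Fin g ⊕ Fin g) (ZMod ℓ) //
      inGSp ℓ g d M ∧ fixdim M = k} : ℝ) /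
  (Nat.card {M : Matrix (Fin g ⊕ Fin g) (Fin g ⊕ Fin g) (ZMod ℓ) // inGSp ℓ g d M} : ℝ)

/-- `𝔓_Sp(ℓ, g, k)`: the corresponding proportion for `Sp_{2g}(F_ℓ) = GSp_{2g}^{(1)}(F_ℓ)`. -/
noncomputable def PSp (ℓ g k : ℕ) : ℝ := PGSp ℓ g 1 k

/-- `𝔓_GL(ℓ, g, k)`: the proportion of matrices in `GL_g(F_ℓ)` whose `1`-eigenspace is
`k`-dimensional. -/
noncomputable def PGL (ℓ g k : ℕ) : ℝ :=
  (Nat.card {M : Matrix (Fin g) (Fin g) (ZMod ℓ) // IsUnit M.det ∧ fixdim M = k} : ℝ) /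
  (Nat.card {M : Matrix (Fin g) (Fin g) (ZMod ℓ) // IsUnit M.det} : ℝ)

theorem T_iso {K V : Type*} [Field K] [AddCommGroup V] [Module K V] (B : LinearMap.BilinForm K V)
    (hB : B.IsAlt) (u v : V) (h : B u v ≠ 0) :
    ∃ T : V →ₗ[K] V, (∀ a b, B (T a) (T b) = B a b) ∧ T u = v ∧
      ∀ y, B y u = 0 → B y v = 0 → T y = y := by
  refine ⟨LinearMap.id + (B u v)⁻¹ • (B.flip (v - u)).smulRight (v - u), ?_, ?_, ?_⟩
  · intro a b
    have h1 : B (v-u) b = - B b (v-u) := (LinearMap.BilinForm.IsAlt.neg_eq hB b (v-u)).symm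
    simp only [LinearMap.add_apply, LinearMap.id_apply, LinearMap.smul_apply,
      LinearMap.smulRight_apply, LinearMap.BilinForm.flip_apply, map_add, map_smul, smul_eq_mul, h1, hB (v-u)]
    ring
  · have := hB u
    simp [this, h, smul_smul]
  · intro y h1 h2
    simp [h1, h2]

theorem T_iso2 {K V : Type*} [Field K] [AddCommGroup V] [Module K V] [FiniteDimensional K V]
    (B : LinearMap.BilinForm K V)
    (hB : B.IsAlt) (hn : B.Nondegenerate) (W : Submodule K V) (u v : V) (hu : u ∉ W) (hv : v ∉ W)
    (hu' : ∀ y ∈ W, B y u = 0) (hv' : ∀ y ∈ W, B y v = 0) :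
    ∃ T : V →ₗ[K] V, (∀ a b, B (T a) (T b) = B a b) ∧ T u = v ∧
      ∀ y ∈ W, T y = y := by
  by_cases h : B u v = 0
  swap
  · obtain ⟨T, h1, h2, h3⟩ := T_iso B hB u v h
    exact ⟨T, h1, h2, fun y hy => h3 y (hu' y hy) (hv' y hy)⟩
  have key : ∀ u ∉ W, ∃ z, (∀ y ∈ W, B y z = 0) ∧ B u z ≠ 0 := by
    intro u hu
    by_contra! hc
    apply hu
    rw [← LinearMap.BilinForm.orthogonal_orthogonal hn hB.isRefl W]
    rw [LinearMap.BilinForm.mem_orthogonal_iff]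
    intro z hz
    rw [LinearMap.BilinForm.mem_orthogonal_iff] at hz
    exact hB.isRefl _ _ (hc z hz)
  obtain ⟨z, hz, h1, h2⟩ : ∃ z, (∀ y ∈ W, B y z = 0) ∧ B u z ≠ 0 ∧ B v z ≠ 0 := by
    obtain ⟨z, hz, h1⟩ := key u hu
    obtain ⟨z', hz', h2⟩ := key v hv
    by_cases h3 : B v z = 0
    · by_cases h4 : B u z' = 0
      · exact ⟨z + z', fun y hy => by simp [hz y hy, hz' y hy], by simp [h4, h1], by simp [h3, h2]⟩
      · exact ⟨z', hz', h4, h2⟩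
    · exact ⟨z, hz, h1, h3⟩
  obtain ⟨T, a1, a2, a3⟩ := T_iso B hB u z h1
  obtain ⟨T', b1, b2, b3⟩ := T_iso B hB z v (fun h => h2 (hB.isRefl _ _ h))
  refine ⟨T' ∘ₗ T, by simp [a1, b1], by simp [a2, b2], fun y hy => ?_⟩
  simp [a3 y (hu' y hy) (hz y hy), b3 y (hz y hy) (hv' y hy)]

theorem witt {K V : Type*} [Field K] [AddCommGroup V] [Module K V] [FiniteDimensional K V]
    (B : LinearMap.BilinForm K V)
    (hB : B.IsAlt) (hn : B.Nondegenerate) (k : ℕ) : ∀ (x y : Fin k → V)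
    (_ : LinearIndependent K x) (_ : LinearIndependent K y) (_ : ∀ i j, B (x i) (x j) = 0)
    (_ : ∀ i j, B (y i) (y j) = 0), ∃ S : V →ₗ[K] V, (∀ a b, B (S a) (S b) = B a b) ∧
      Function.Injective S ∧ ∀ i, S (x i) = y i := by
  have inj : ∀ S : V →ₗ[K] V, (∀ a b, B (S a) (S b) = B a b) → Function.Injective S := by
    intro S hS
    rw [injective_iff_map_eq_zero]
    intro a ha
    apply hn.1
    intro b
    rw [← hS, ha]; simp
  induction k with
  | zero => 
    intro x y _ _ _ _
    exact ⟨LinearMap.id, by simp, fun _ _ h => h, fun i => i.elim0⟩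
  | succ k ih => 
    intro x y hx hy hx' hy'
    rw [linearIndependent_finSucc'] at hx hy
    obtain ⟨S, h1, h2, h3⟩ := ih (Fin.init x) (Fin.init y) hx.1 hy.1 (fun i j => hx' _ _)
      (fun i j => hy' _ _)
    have g1 : S (x (Fin.last k)) ∉ Submodule.span K (Set.range (Fin.init y)) := by
      intro hc
      apply hx.2
      have : Fin.init y = S ∘ Fin.init x := by ext i; simp [h3]
      rw [this, Set.range_comp, ← Submodule.map_span] at hc
      obtain ⟨w, hw, e⟩ := hc
      rwa [← h2 e]
    have g2 : ∀ w ∈ Submodule.span K (Set.range (Fin.init y)), B w (S (x (Fin.last k))) = 0 := by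
      intro w hw
      have : Submodule.span K (Set.range (Fin.init y)) ≤
          LinearMap.ker (B.flip (S (x (Fin.last k)))) := by
        rw [Submodule.span_le]
        rintro _ ⟨i, rfl⟩
        simp only [← h3, SetLike.mem_coe, LinearMap.mem_ker, LinearMap.BilinForm.flip_apply, h1]
        exact hx' _ _
      simpa using this hw
    have g3 : ∀ w ∈ Submodule.span K (Set.range (Fin.init y)), B w (y (Fin.last k)) = 0 := by
      intro w hw
      have : Submodule.span K (Set.range (Fin.init y)) ≤ LinearMap.ker (B.flip (y (Fin.last k))) := by
        rw [Submodule.span_le]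
        rintro _ ⟨i, rfl⟩
        simp only [SetLike.mem_coe, LinearMap.mem_ker, LinearMap.BilinForm.flip_apply]
        exact hy' _ _
      simpa using this hw
    obtain ⟨T, a1, a2, a3⟩ := T_iso2 B hB hn (Submodule.span K (Set.range (Fin.init y)))
      (S (x (Fin.last k))) (y (Fin.last k)) g1 hy.2 g2 g3
    refine ⟨T ∘ₗ S, by simp [a1, h1], inj _ (by simp [a1, h1]), fun i => ?_⟩
    induction i using Fin.lastCases with
    | last => simp [a2]
    | cast i =>
      have := h3 i
      simp only [Fin.init] at this
      simp only [LinearMap.comp_apply, this]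
      exact a3 _ (Submodule.subset_span ⟨i, rfl⟩)

theorem iso_dim {K V : Type*} [Field K] [AddCommGroup V] [Module K V] [FiniteDimensional K V]
    (B : LinearMap.BilinForm K V)
    (hn : B.Nondegenerate) (k : ℕ) (x : Fin k → V)
    (hx : LinearIndependent K x) (hx' : ∀ i j, B (x i) (x j) = 0) :
    2 * k ≤ Module.finrank K V := by
  have h1 := finrank_span_eq_card hx
  have h2 : Submodule.span K (Set.range x) ≤ B.orthogonal (Submodule.span K (Set.range x)) := by
    rw [Submodule.span_le]
    rintro _ ⟨i, rfl⟩
    simp only [SetLike.mem_coe, LinearMap.BilinForm.mem_orthogonal_iff]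
    intro w hw
    have : Submodule.span K (Set.range x) ≤ LinearMap.ker (B.flip (x i)) := by
        rw [Submodule.span_le]
        rintro _ ⟨j, rfl⟩
        simpa using hx' _ _
    simpa using this hw
  have h3 := Submodule.finrank_mono h2
  have h4 := LinearMap.BilinForm.finrank_orthogonal hn (Submodule.span K (Set.range x))
  have h5 := Submodule.finrank_le (Submodule.span K (Set.range x))
  simp at h1
  omega

theorem gl_trans {K V : Type*} [Field K] [AddCommGroup V] [Module K V] [FiniteDimensional K V]
    (k : ℕ) (x y : Fin k → V)
    (hx : LinearIndependent K x) (hy : LinearIndependent K y) :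
    ∃ S : V →ₗ[K] V, Function.Injective S ∧ ∀ i, S (x i) = y i := by
  obtain ⟨T, hT⟩ := Submodule.exists_linearEquiv_restrict_eq
    ((Module.Basis.span hx).equiv (Module.Basis.span hy) (Equiv.refl _))
  refine ⟨T.toLinearMap, T.injective, fun i => ?_⟩
  have := hT (Module.Basis.span hx i)
  rw [Module.Basis.equiv_apply] at this
  simpa [Module.Basis.span_apply] using this.symm

/-- number of `k`-frames in a `d`-dimensional space -/
noncomputable def frameNum (F : Type) [Field F] (k d : ℕ) : ℕ :=
  Nat.card {s : Fin k → (Fin d → F) // LinearIndependent F s}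

theorem frameNum_zero (F : Type) [Field F] (k d : ℕ) (h : d < k) : frameNum F k d = 0 := by
  have : IsEmpty {s : Fin k → (Fin d → F) // LinearIndependent F s} := by
    constructor
    rintro ⟨s, hs⟩
    have := hs.fintype_card_le_finrank
    simp at this
    omega
  exact Nat.card_of_isEmpty

theorem frameNum_self (F : Type) [Field F] [Finite F] (k : ℕ) : frameNum F k k ≠ 0 := by
  have : Nonempty {s : Fin k → (Fin k → F) // LinearIndependent F s} :=
    ⟨⟨_, (Pi.basisFun F (Fin k)).linearIndependent⟩⟩
  exact Nat.card_ne_zero.2 ⟨this, inferInstance⟩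

theorem frameNum_eq {F V : Type} [Field F] [AddCommGroup V] [Module F V] [FiniteDimensional F V]
    (k : ℕ) : Nat.card {s : Fin k → V // LinearIndependent F s} =
      frameNum F k (Module.finrank F V) := by
  let e : V ≃ₗ[F] (Fin (Module.finrank F V) → F) := (Module.finBasis F V).equivFun
  refine Nat.card_congr ((Equiv.arrowCongr (Equiv.refl _) e.toEquiv).subtypeEquiv fun s => ?_)
  exact (LinearMap.linearIndependent_iff_of_injOn e.toLinearMap e.injective.injOn).symm

theorem frameNum_fix {F n : Type} [Field F] [Fintype n] [DecidableEq n] (M : Matrix n n F)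
    (k : ℕ) : Nat.card {s : Fin k → (n → F) // LinearIndependent F s ∧ ∀ i, M *ᵥ s i = s i} =
      frameNum F k (fixdim M) := by
  rw [fixdim, ← frameNum_eq]
  have hk : ∀ v, v ∈ LinearMap.ker (M - 1).mulVecLin ↔ M *ᵥ v = v := by
    intro v
    simp [sub_eq_zero]
  refine Nat.card_congr 
    { toFun := fun s => ⟨fun i => ⟨s.1 i, (hk _).2 (s.2.2 i)⟩, ?_⟩
      invFun := fun s => ⟨fun i => s.1 i, ?_, fun i => (hk _).1 (s.1 i).2⟩
      left_inv := fun s => rfl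
      right_inv := fun s => rfl }
  · exact LinearIndependent.of_comp (LinearMap.ker (M - 1).mulVecLin).subtype s.2.1
  · exact s.2.map' (LinearMap.ker (M - 1).mulVecLin).subtype (Submodule.ker_subtype _)

theorem pairs_card {F n : Type} [Field F] [Finite F] [Fintype n] [DecidableEq n]
    (A : Matrix n n F → Prop) (k : ℕ) (e : Fin k → n → F)
    (h1 : ∀ M, A M → LinearIndependent F (fun i => M *ᵥ e i))
    (h2 : ∀ x : Fin k → n → F, LinearIndependent F x → ((∃ M, A M ∧ ∀ i, M *ᵥ x i = x i) ∨
      ∃ N, A N ∧ ∀ i, N *ᵥ e i = x i) → ∃ S S', S * S' = 1 ∧ S' * S = 1 ∧ (∀ i, S *ᵥ e i = x i) ∧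
        ∀ M, A M ↔ A (M * S)) :
    Nat.card (Σ M : {M // A M}, {s : Fin k → (n → F) // LinearIndependent F s ∧ 
      ∀ i, M.1 *ᵥ s i = s i}) = Nat.card {M // A M} := by
  have h2' : ∀ x : Fin k → n → F, ∃ S S' : Matrix n n F, (LinearIndependent F x → 
    ((∃ M, A M ∧ ∀ i, M *ᵥ x i = x i) ∨
      ∃ N, A N ∧ ∀ i, N *ᵥ e i = x i) → S * S' = 1 ∧ S' * S = 1 ∧ (∀ i, S *ᵥ e i = x i) ∧
        ∀ M, A M ↔ A (M * S)) := by
    intro x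
    by_cases h : LinearIndependent F x ∧ ((∃ M, A M ∧ ∀ i, M *ᵥ x i = x i) ∨
      ∃ N, A N ∧ ∀ i, N *ᵥ e i = x i)
    · obtain ⟨S, S', h3⟩ := h2 x h.1 h.2
      exact ⟨S, S', fun _ _ => h3⟩
    · exact ⟨0, 0, fun a b => (h ⟨a, b⟩).elim⟩
  choose S S' hS using h2'
  apply Nat.card_congr
  refine Equiv.ofBijective (fun p => ⟨p.1.1 * S p.2.1,
    ((hS p.2.1 p.2.2.1 (Or.inl ⟨_, p.1.2, p.2.2.2⟩)).2.2.2 _).1 p.1.2⟩) ⟨?_, ?_⟩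
  · rintro ⟨⟨M, hM⟩, ⟨x, hx, hx'⟩⟩ ⟨⟨N, hN⟩, ⟨y, hy, hy'⟩⟩ h
    simp only [Subtype.mk.injEq] at h
    obtain ⟨a1, a2, a3, a4⟩ := hS x hx (Or.inl ⟨_, hM, hx'⟩)
    obtain ⟨b1, b2, b3, b4⟩ := hS y hy (Or.inl ⟨_, hN, hy'⟩)
    have hxy : x = y := by
      ext1 i
      rw [← hx' i, ← hy' i, ← a3 i, ← b3 i, Matrix.mulVec_mulVec, Matrix.mulVec_mulVec, h]
    subst hxy
    have : M = N := by
      have := congrArg (· * S' x) h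
      simpa [Matrix.mul_assoc, a1] using this
    subst this
    rfl
  · rintro ⟨N, hN⟩
    obtain ⟨a1, a2, a3, a4⟩ := hS (fun i => N *ᵥ e i) (h1 N hN) (Or.inr ⟨N, hN, fun i => rfl⟩)
    refine ⟨⟨⟨N * S' (fun i => N *ᵥ e i), ?_⟩, ⟨fun i => N *ᵥ e i, h1 N hN, ?_⟩⟩, ?_⟩
    · rw [a4, Matrix.mul_assoc, a2, Matrix.mul_one]; exact hN
    · intro i
      have h3 := a3 i
      generalize S' (fun i => N *ᵥ e i) = Q at *
      generalize S (fun i => N *ᵥ e i) = R at *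
      beta_reduce at h3 ⊢
      conv_lhs => rw [← h3]
      rw [Matrix.mulVec_mulVec, Matrix.mul_assoc, a2, Matrix.mul_one]
    · simp only [Matrix.mul_assoc, a2, Matrix.mul_one]

theorem moment {F n : Type} [Field F] [Finite F] [Fintype n] [DecidableEq n]
    (A : Matrix n n F → Prop) (k N : ℕ) (hN : Fintype.card n ≤ N) :
    Nat.card (Σ M : {M // A M}, {s : Fin k → (n → F) // LinearIndependent F s ∧ 
      ∀ i, M.1 *ᵥ s i = s i}) =
    ∑ d ∈ Finset.range (N + 1), Nat.card {M // A M ∧ fixdim M = d} * frameNum F k d := by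
  classical
  have := Fintype.ofFinite F
  rw [Nat.card_sigma]
  simp_rw [frameNum_fix]
  have hm : ∀ M ∈ (Finset.univ : Finset {M // A M}), fixdim M.1 ∈ Finset.range (N+1) := by
    intro M _
    have := Submodule.finrank_le (LinearMap.ker (M.1 - 1).mulVecLin)
    simp at this
    simp [fixdim]
    omega
  rw [← Finset.sum_fiberwise_of_maps_to hm]
  refine Finset.sum_congr rfl fun d _ => ?_
  rw [Finset.sum_congr rfl (g := fun _ => frameNum F k d) (by 
    intro M hM; simp at hM; rw [hM]), Finset.sum_const, smul_eq_mul]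
  congr 1
  rw [← Nat.card_congr (Equiv.subtypeSubtypeEquivSubtypeInter A (fun M => fixdim M = d)),
    Nat.card_eq_fintype_card, Fintype.card_subtype]

theorem unique_dist (F : Type) [Field F] [Finite F] (N : ℕ) (a b : ℕ → ℝ)
    (h : ∀ k ≤ N, ∑ d ∈ Finset.range (N + 1), a d * frameNum F k d = 
      ∑ d ∈ Finset.range (N + 1), b d * frameNum F k d) (d : ℕ) (hd : d ≤ N) : a d = b d := by
  induction hm : N - d using Nat.strong_induction_on generalizing d with
  | _ m ih =>
    have h1 : ∀ c : ℕ → ℝ, ∑ j ∈ Finset.range (N + 1), c j * frameNum F d j = 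
        c d * frameNum F d d + ∑ j ∈ Finset.Ioc d N, c j * frameNum F d j := by
      intro c
      rw [← Finset.sum_insert (f := fun j => c j * (frameNum F d j : ℝ)) (by simp)]
      symm
      apply Finset.sum_subset
      · intro j hj
        simp only [Finset.mem_insert, Finset.mem_Ioc, Finset.mem_range] at *
        omega
      · intro j hj hj'
        simp only [Finset.mem_insert, Finset.mem_Ioc, Finset.mem_range] at *
        rw [frameNum_zero F d j (by omega)]
        simp
    have h2 := h d hd
    rw [h1, h1, Finset.sum_congr rfl (g := fun j => b j * (frameNum F d j : ℝ))] at h2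
    · have : (frameNum F d d : ℝ) ≠ 0 := by exact_mod_cast frameNum_self F d
      exact mul_right_cancel₀ this (add_right_cancel h2)
    · intro j hj
      rw [Finset.mem_Ioc] at hj
      rw [ih (N - j) (by omega) j hj.2 rfl]

theorem prop_moment {F n : Type} [Field F] [Finite F] [Fintype n] [DecidableEq n]
    (A : Matrix n n F → Prop) (g N : ℕ) (hN : Fintype.card n ≤ N) (hA : ∃ M, A M)
    (h1 : ∀ k ≤ g, Nat.card (Σ M : {M // A M}, {s : Fin k → (n → F) // LinearIndependent F s ∧
      ∀ i, M.1 *ᵥ s i = s i}) = Nat.card {M // A M})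
    (h2 : ∀ k, g < k → ∀ M, A M → ∀ s : Fin k → (n → F), LinearIndependent F s →
      (∀ i, M *ᵥ s i = s i) → False) (k : ℕ) :
    ∑ d ∈ Finset.range (N + 1), ((Nat.card {M // A M ∧ fixdim M = d} : ℝ) /
      (Nat.card {M // A M} : ℝ)) * frameNum F k d = if k ≤ g then 1 else 0 := by
  have h0 : (Nat.card {M // A M} : ℝ) ≠ 0 := by
    have : Nonempty {M // A M} := ⟨⟨hA.choose, hA.choose_spec⟩⟩
    exact_mod_cast Nat.card_ne_zero.2 ⟨this, inferInstance⟩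
  have h3 := moment A k N hN
  have h4 : ∑ d ∈ Finset.range (N + 1), ((Nat.card {M // A M ∧ fixdim M = d} : ℝ) /
      (Nat.card {M // A M} : ℝ)) * frameNum F k d =
      ((∑ d ∈ Finset.range (N + 1), Nat.card {M // A M ∧ fixdim M = d} * frameNum F k d : ℕ) : ℝ)
        / (Nat.card {M // A M} : ℝ) := by
    push_cast
    rw [Finset.sum_div]
    refine Finset.sum_congr rfl fun d _ => by ring
  rw [h4, ← h3]
  split_ifs with hk
  · rw [h1 k hk, div_self h0]
  · have : IsEmpty (Σ M : {M // A M}, {s : Fin k → (n → F) // LinearIndependent F s ∧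
      ∀ i, M.1 *ᵥ s i = s i}) :=
      ⟨fun p => h2 k (by omega) p.1.1 p.1.2 p.2.1 p.2.2.1 p.2.2.2⟩
    simp

theorem li_mulVec {F n : Type} [Field F] [Fintype n] [DecidableEq n] {k : ℕ}
    (e : Fin k → n → F) (he : LinearIndependent F e) (M : Matrix n n F) (hM : IsUnit M.det) :
    LinearIndependent F (fun i => M *ᵥ e i) := by
  have : Function.Injective M.mulVec :=
    Matrix.mulVec_injective_iff_isUnit.2 ((Matrix.isUnit_iff_isUnit_det M).2 hM)
  exact he.map' M.mulVecLin (LinearMap.ker_eq_bot.2 this)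

theorem mat_of_inj {F n : Type} [Field F] [Fintype n] [DecidableEq n]
    (S : (n → F) →ₗ[F] (n → F)) (hS : Function.Injective S) :
    IsUnit (LinearMap.toMatrix' S).det := by
  rw [← Matrix.isUnit_iff_isUnit_det, ← Matrix.mulVec_injective_iff_isUnit]
  intro a b h
  apply hS
  simpa [LinearMap.toMatrix'_mulVec] using h

theorem gl_moment {F : Type} [Field F] [Finite F] (g N : ℕ) (hN : g ≤ N) (k : ℕ) :
    ∑ d ∈ Finset.range (N + 1), ((Nat.card {M : Matrix (Fin g) (Fin g) F //
      IsUnit M.det ∧ fixdim M = d} : ℝ) /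
      (Nat.card {M : Matrix (Fin g) (Fin g) F // IsUnit M.det} : ℝ)) * frameNum F k d =
      if k ≤ g then 1 else 0 := by
  refine prop_moment (fun M : Matrix (Fin g) (Fin g) F => IsUnit M.det) g N (by simpa) ⟨1, by simp⟩
    ?_ ?_ k
  · intro k hk
    have he : LinearIndependent F (fun i : Fin k => Pi.basisFun F (Fin g) (Fin.castLE hk i)) :=
      (Pi.basisFun F (Fin g)).linearIndependent.comp _ (Fin.castLE_injective hk)
    refine pairs_card _ k _ (fun M hM => li_mulVec _ he M hM) ?_
    intro x hx _
    obtain ⟨S, h1, h2⟩ := gl_trans k _ x he hx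
    have hu := mat_of_inj S h1
    refine ⟨LinearMap.toMatrix' S, (LinearMap.toMatrix' S)⁻¹, Matrix.mul_nonsing_inv _ hu,
      Matrix.nonsing_inv_mul _ hu, fun i => ?_, fun M => ?_⟩
    · rw [LinearMap.toMatrix'_mulVec]; exact h2 i
    · rw [Matrix.det_mul]
      exact ⟨fun h => h.mul hu, fun h => isUnit_of_mul_isUnit_left h⟩
  · intro k hk M _ s hs _
    have := hs.fintype_card_le_finrank
    simp at this
    omega

theorem Om_det (ℓ g : ℕ) : Om ℓ g * Om ℓ g = -1 := by
  rw [Om, Matrix.fromBlocks_multiply]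
  simp [← Matrix.fromBlocks_one, Matrix.fromBlocks_neg]

theorem Om_alt (ℓ g : ℕ) [Fact ℓ.Prime] : (Matrix.toBilin' (Om ℓ g)).IsAlt := by
  intro v
  rw [Matrix.toBilin'_apply']
  obtain ⟨a, b, rfl⟩ : ∃ a b, v = Sum.elim a b := ⟨v ∘ Sum.inl, v ∘ Sum.inr, by simp⟩
  rw [Om, Matrix.fromBlocks_mulVec]
  simp [dotProduct, Matrix.neg_mulVec, mul_comm]

theorem Om_nondeg (ℓ g : ℕ) [Fact ℓ.Prime] : (Matrix.toBilin' (Om ℓ g)).Nondegenerate := by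
  apply Matrix.Nondegenerate.toBilin'
  apply Matrix.nondegenerate_of_det_ne_zero
  have := congrArg Matrix.det (Om_det ℓ g)
  intro h
  rw [Matrix.det_mul, h, Matrix.det_neg] at this
  simp at this

theorem gsp_form (ℓ g : ℕ) [Fact ℓ.Prime] (c : ZMod ℓ) 
    (M : Matrix (Fin g ⊕ Fin g) (Fin g ⊕ Fin g) (ZMod ℓ)) :
    Mᵀ * Om ℓ g * M = c • Om ℓ g ↔ ∀ v w, Matrix.toBilin' (Om ℓ g) (M *ᵥ v) (M *ᵥ w) =
      c * Matrix.toBilin' (Om ℓ g) v w := by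
  have h : ∀ v w, Matrix.toBilin' (Om ℓ g) (M *ᵥ v) (M *ᵥ w) =
      Matrix.toBilin' (Mᵀ * Om ℓ g * M) v w := by
    intro v w
    simp only [Matrix.toBilin'_apply']
    rw [← Matrix.vecMul_transpose, ← Matrix.dotProduct_mulVec, Matrix.mulVec_mulVec,
      Matrix.mulVec_mulVec, Matrix.mul_assoc]
  simp_rw [h]
  constructor
  · intro h v w
    rw [h]; simp
  · intro h
    apply Matrix.toBilin'.injective
    refine LinearMap.ext fun v => LinearMap.ext fun w => ?_
    rw [h]; simp

theorem gsp_mul (ℓ g : ℕ) (c : ZMod ℓ) 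
    (M S : Matrix (Fin g ⊕ Fin g) (Fin g ⊕ Fin g) (ZMod ℓ)) (hM : inGSp ℓ g c M)
    (hS : IsUnit S.det) (hS' : Sᵀ * Om ℓ g * S = Om ℓ g) : inGSp ℓ g c (M * S) := by
  refine ⟨by rw [Matrix.det_mul]; exact hM.1.mul hS, ?_⟩
  calc (M * S)ᵀ * Om ℓ g * (M * S) = Sᵀ * (Mᵀ * Om ℓ g * M) * S := by
        rw [Matrix.transpose_mul]; simp only [Matrix.mul_assoc]
    _ = c • Om ℓ g := by rw [hM.2]; simp [hS']

theorem gsp_ne (ℓ g : ℕ) [Fact ℓ.Prime] (c : ZMod ℓ) (hc : c ≠ 0) : ∃ M, inGSp ℓ g c M := by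
  refine ⟨Matrix.fromBlocks 1 0 0 (c • 1), ?_, ?_⟩
  · rw [Matrix.det_fromBlocks_zero₂₁]
    simp [hc]
  · rw [Om, Matrix.fromBlocks_transpose, Matrix.fromBlocks_multiply, Matrix.fromBlocks_multiply,
      Matrix.fromBlocks_smul]
    simp

theorem gsp_moment (ℓ g : ℕ) [Fact ℓ.Prime] (c : ZMod ℓ) (hc : c ≠ 0) (hc1 : c ≠ 1) (k : ℕ) :
    ∑ d ∈ Finset.range (2 * g + 1), PGSp ℓ g c d * frameNum (ZMod ℓ) k d =
      if k ≤ g then 1 else 0 := by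
  have iso : ∀ k, ∀ M, inGSp ℓ g c M → ∀ x : Fin k → _, (∀ i, M *ᵥ x i = x i) →
      ∀ i j, Matrix.toBilin' (Om ℓ g) (x i) (x j) = 0 := by
    intro k M hM x hx i j
    have := (gsp_form ℓ g c M).1 hM.2 (x i) (x j)
    rw [hx, hx] at this
    have h2 : (1 - c) * Matrix.toBilin' (Om ℓ g) (x i) (x j) = 0 := by
      rw [sub_mul, ← this]; ring
    rcases mul_eq_zero.1 h2 with h | h
    · exact (hc1 (sub_eq_zero.1 h).symm).elim
    · exact h
  refine prop_moment (inGSp ℓ g c) g (2 * g) (by simp; omega) (gsp_ne ℓ g c hc) ?_ ?_ k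
  · intro k hk
    have he : LinearIndependent (ZMod ℓ) (fun i : Fin k =>
        Pi.basisFun (ZMod ℓ) (Fin g ⊕ Fin g) (Sum.inl (Fin.castLE hk i))) :=
      (Pi.basisFun (ZMod ℓ) (Fin g ⊕ Fin g)).linearIndependent.comp _ 
        (Sum.inl_injective.comp (Fin.castLE_injective hk))
    have he' : ∀ i j : Fin k, Matrix.toBilin' (Om ℓ g)
        (Pi.basisFun (ZMod ℓ) (Fin g ⊕ Fin g) (Sum.inl (Fin.castLE hk i)))
        (Pi.basisFun (ZMod ℓ) (Fin g ⊕ Fin g) (Sum.inl (Fin.castLE hk j))) = 0 := by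
      intro i j
      simp [Om]
    refine pairs_card _ k _ (fun M hM => li_mulVec _ he M hM.1) ?_
    intro x hx hx'
    have hx'' : ∀ i j, Matrix.toBilin' (Om ℓ g) (x i) (x j) = 0 := by
      rcases hx' with ⟨M, hM, h⟩ | ⟨N, hN, h⟩
      · exact iso k M hM x h
      · intro i j
        rw [← h, ← h, (gsp_form ℓ g c N).1 hN.2, he', mul_zero]
    obtain ⟨S, h1, h2, h3⟩ := witt _ (Om_alt ℓ g) (Om_nondeg ℓ g) k _ x he hx he' hx''
    have hu := mat_of_inj S h2
    have hS : (LinearMap.toMatrix' S)ᵀ * Om ℓ g * LinearMap.toMatrix' S = Om ℓ g := by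
      have := (gsp_form ℓ g 1 (LinearMap.toMatrix' S)).2 (by
        intro v w
        rw [LinearMap.toMatrix'_mulVec, LinearMap.toMatrix'_mulVec, h1, one_mul])
      rwa [one_smul] at this
    have h3' : ∀ i, LinearMap.toMatrix' S *ᵥ
        (Pi.basisFun (ZMod ℓ) (Fin g ⊕ Fin g) (Sum.inl (Fin.castLE hk i))) = x i := by
      intro i
      rw [LinearMap.toMatrix'_mulVec]; exact h3 i
    generalize LinearMap.toMatrix' S = R at *
    refine ⟨R, R⁻¹, Matrix.mul_nonsing_inv _ hu, Matrix.nonsing_inv_mul _ hu, h3', fun M => ?_⟩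
    refine ⟨fun h => gsp_mul ℓ g c M R h hu hS, fun h => ?_⟩
    have := gsp_mul ℓ g c (M * R) R⁻¹ h (Matrix.isUnit_nonsing_inv_det _ hu) (by
      have e1 : R⁻¹ᵀ * Rᵀ = 1 := by
        rw [← Matrix.transpose_mul, Matrix.mul_nonsing_inv _ hu, Matrix.transpose_one]
      calc R⁻¹ᵀ * Om ℓ g * R⁻¹ = R⁻¹ᵀ * (Rᵀ * Om ℓ g * R) * R⁻¹ := by rw [hS]
        _ = (R⁻¹ᵀ * Rᵀ) * Om ℓ g * (R * R⁻¹) := by simp only [Matrix.mul_assoc]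
        _ = Om ℓ g := by rw [e1, Matrix.mul_nonsing_inv _ hu]; simp)
    rwa [Matrix.mul_assoc, Matrix.mul_nonsing_inv _ hu, Matrix.mul_one] at this
  · intro k hk M hM s hs hs'
    have := iso_dim _ (Om_nondeg ℓ g) k s hs (iso k M hM s hs')
    simp at this
    omega

theorem stmt2 (q ℓ : ℕ) (hq : IsPrimePow q) (hℓ : ℓ.Prime) (hnd : ¬ ℓ ∣ q)
    (g : ℕ) (hg : 1 ≤ g) (d : ℕ) (hd : d ≤ 2 * g) :
    ((q : ZMod ℓ) = 1 → PGSp ℓ g (q : ZMod ℓ) d = PSp ℓ g d) ∧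
    ((q : ZMod ℓ) ≠ 1 → PGSp ℓ g (q : ZMod ℓ) d = PGL ℓ g d) := by
  have : Fact ℓ.Prime := ⟨hℓ⟩
  refine ⟨fun h => by rw [h, PSp], fun h => ?_⟩
  have hc : (q : ZMod ℓ) ≠ 0 := by rwa [Ne, ZMod.natCast_eq_zero_iff]
  refine unique_dist (ZMod ℓ) (2 * g) (PGSp ℓ g (q : ZMod ℓ)) (PGL ℓ g) (fun k _ => ?_) d hd
  rw [gsp_moment ℓ g _ hc h k]
  exact (gl_moment (F := ZMod ℓ) g (2 * g) (by omega) k).symm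
end

section
/- Let $q$ be a prime power and $\ell$ a prime not dividing $q$. If $\ell \mid q - 1$, then $\lim_{g \to \infty} \mathfrak{Q}(q,\ell,g) = 1 - \prod_{j=1}^\infty (1 + \ell^{-j})^{-1}$, and if $\ell \nmid q - 1$, then $\lim_{g \to \infty} \mathfrak{Q}(q,\ell,g) = 1 - \prod_{j=1}^\infty (1 - \ell^{-j})$. Moreover, the convergence is alternating: defining $\mathcal{E}(q,\ell,g)$ as the limiting value minus $\mathfrak{Q}(q,\ell,g)$, one has $\lim_{g \to \infty} \mathcal{E}(q,\ell,g) = 0$ and $(-1)^g \mathcal{E}(q,\ell,g) > 0$ for every $g \ge 0$. -/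
open Matrix Finset Filter

/-- `𝔔(q, ℓ, g)`: the proportion of matrices of `GSp_{2g}^{(d)}(F_ℓ)` having `1`
as an eigenvalue, i.e. with `det (M - I) = 0`. -/
noncomputable def QGSp (ℓ g : ℕ) (d : ZMod ℓ) : ℝ :=
  (Nat.card {M : Matrix (Fin g ⊕ Fin g) (Fin g ⊕ Fin g) (ZMod ℓ) //
      inGSp ℓ g d M ∧ (M - 1).det = 0} : ℝ) /
  (Nat.card {M : Matrix (Fin g ⊕ Fin g) (Fin g ⊕ Fin g) (ZMod ℓ) // inGSp ℓ g d M} : ℝ)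

set_option linter.unusedSectionVars false

section LinAlg

variable {F : Type*} [Field F] {V : Type*} [AddCommGroup V] [Module F V] [FiniteDimensional F V]

/-- The corank of a square matrix. -/
noncomputable def corank {k : ℕ} (A : Matrix (Fin k) (Fin k) F) : ℕ :=
  Module.finrank F (LinearMap.ker A.mulVecLin)

/-- Alternating matrices. -/
def IsAltM {k : ℕ} (A : Matrix (Fin k) (Fin k) F) : Prop :=
  (∀ i, A i i = 0) ∧ ∀ i j, A j i = - A i j

/-- Border an alternating matrix by a vector. -/
def bord {k : ℕ} (A : Matrix (Fin k) (Fin k) F) (b : Fin k → F) :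
    Matrix (Fin (k + 1)) (Fin (k + 1)) F :=
  Matrix.of (Fin.cons (Fin.cons 0 (fun j => - b j)) (fun i => Fin.cons (b i) (A i)))

/-- The Gram matrix of a tuple. -/
def gramM (B : LinearMap.BilinForm F V) {k : ℕ} (v : Fin k → V) : Matrix (Fin k) (Fin k) F :=
  Matrix.of fun i j => B (v i) (v j)

/-- Pairing with a tuple. -/
def pairM (B : LinearMap.BilinForm F V) {k : ℕ} (v : Fin k → V) : V →ₗ[F] (Fin k → F) :=
  LinearMap.pi (fun i => B (v i))

theorem pairM_surj (B : LinearMap.BilinForm F V) (hn : B.Nondegenerate) (hB : B.IsAlt)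
    {k : ℕ} (v : Fin k → V) (hv : LinearIndependent F v) (b : Fin k → F) :
    ∃ x, pairM B v x = b := by
  obtain ⟨φ, hφ⟩ := LinearMap.exists_extend ((Module.Basis.span hv).constr F (fun i => - b i))
  refine ⟨(B.toDual hn).symm φ, ?_⟩
  ext i
  have h1 : B ((B.toDual hn).symm φ) (v i) = φ (v i) :=
    LinearMap.BilinForm.apply_toDual_symm_apply ..
  have h2 : φ (v i) = - b i := by
    have := congrArg (fun f => f (Module.Basis.span hv i)) hφ
    simp only [LinearMap.comp_apply, Submodule.subtype_apply, Module.Basis.constr_basis] at this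
    rwa [Module.Basis.span_apply] at this
  have h3 := LinearMap.BilinForm.IsAlt.neg_eq hB (v i) ((B.toDual hn).symm φ)
  simp only [pairM, LinearMap.pi_apply]
  rw [← neg_inj, h3, h1, h2]

theorem pairM_lc (B : LinearMap.BilinForm F V) {k : ℕ} (v : Fin k → V) (c : Fin k → F) :
    pairM B v (Fintype.linearCombination F v c) = gramM B v *ᵥ c := by
  ext i
  simp [pairM, gramM, Fintype.linearCombination_apply, Matrix.mulVec, dotProduct, mul_comm]

theorem finrank_ker_pairM (B : LinearMap.BilinForm F V) (hn : B.Nondegenerate) (hB : B.IsAlt)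
    {k : ℕ} (v : Fin k → V) (hv : LinearIndependent F v) :
    k + Module.finrank F (LinearMap.ker (pairM B v)) = Module.finrank F V := by
  have h := (pairM B v).finrank_range_add_finrank_ker
  rw [LinearMap.range_eq_top.2 (pairM_surj B hn hB v hv)] at h
  simpa using h

theorem lc_inj {k : ℕ} (v : Fin k → V) (hv : LinearIndependent F v) :
    Function.Injective (Fintype.linearCombination F v) := by
  rw [injective_iff_map_eq_zero]
  intro c hc
  ext i
  exact Fintype.linearIndependent_iff.1 hv c (by simpa [Fintype.linearCombination_apply] using hc) i

theorem finrank_rad (B : LinearMap.BilinForm F V)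
    {k : ℕ} (v : Fin k → V) (hv : LinearIndependent F v) :
    Module.finrank F ↥(LinearMap.ker (pairM B v) ⊓ Submodule.span F (Set.range v)) =
      corank (gramM B v) := by
  have hinj : Function.Injective (Fintype.linearCombination F v) :=
    lc_inj v hv
  have : LinearMap.ker (gramM B v).mulVecLin =
      (LinearMap.ker (pairM B v)).comap (Fintype.linearCombination F v) := by
    ext c
    simp [pairM_lc]
  rw [corank, this, ← Fintype.range_linearCombination, inf_comm, ← Submodule.map_comap_eq,
    ]
  exact (LinearEquiv.finrank_eq (Submodule.equivMapOfInjective _ hinj _)).symm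

theorem corank_le (B : LinearMap.BilinForm F V) (hn : B.Nondegenerate) (hB : B.IsAlt)
    {k : ℕ} (v : Fin k → V) (hv : LinearIndependent F v) :
    k + corank (gramM B v) ≤ Module.finrank F V := by
  rw [← finrank_rad B v hv, ← finrank_ker_pairM B hn hB v hv]
  have := Submodule.finrank_mono
    (inf_le_left : LinearMap.ker (pairM B v) ⊓ Submodule.span F (Set.range v) ≤ _)
  omega

theorem exists_ext_iff (B : LinearMap.BilinForm F V) (hn : B.Nondegenerate) (hB : B.IsAlt)
    {k : ℕ} (v : Fin k → V) (hv : LinearIndependent F v) (b : Fin k → F) :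
    (∃ x, x ∉ Submodule.span F (Set.range v) ∧ pairM B v x = b) ↔
      (k + corank (gramM B v) < Module.finrank F V ∨
        b ∉ LinearMap.range (gramM B v).mulVecLin) := by
  have e1 := finrank_rad B v hv
  have e2 := finrank_ker_pairM B hn hB v hv
  constructor
  · rintro ⟨x, hx, hxb⟩
    by_contra! h
    obtain ⟨h1, c, hc⟩ := h
    have hle : LinearMap.ker (pairM B v) ⊓ Submodule.span F (Set.range v)
        = LinearMap.ker (pairM B v) := by
      apply Submodule.eq_of_le_of_finrank_le inf_le_left
      omega
    have hm : x - Fintype.linearCombination F v c ∈ LinearMap.ker (pairM B v) := by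
      simp only [LinearMap.mem_ker, map_sub, pairM_lc, hxb]
      rw [← hc]; simp
    rw [← hle] at hm
    apply hx
    have h3 : Fintype.linearCombination F v c ∈ Submodule.span F (Set.range v) := by
      rw [← Fintype.range_linearCombination]; exact ⟨c, rfl⟩
    have := Submodule.add_mem _ hm.2 h3
    simpa using this
  · rintro (h | h)
    · obtain ⟨x, hx⟩ := pairM_surj B hn hB v hv b
      have : ∃ p ∈ LinearMap.ker (pairM B v), p ∉ Submodule.span F (Set.range v) := by
        by_contra! hh
        have : LinearMap.ker (pairM B v) ⊓ Submodule.span F (Set.range v)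
            = LinearMap.ker (pairM B v) := inf_eq_left.2 hh
        rw [this] at e1
        omega
      obtain ⟨p, hp, hp'⟩ := this
      by_cases hxs : x ∈ Submodule.span F (Set.range v)
      · refine ⟨x + p, ?_, ?_⟩
        · intro hxp
          exact hp' ((Submodule.add_mem_iff_right _ hxs).1 hxp)
        · rw [map_add, hx, LinearMap.mem_ker.1 hp, add_zero]
      · exact ⟨x, hxs, hx⟩
    · obtain ⟨x, hx⟩ := pairM_surj B hn hB v hv b
      refine ⟨x, fun hxs => h ?_, hx⟩
      rw [← Fintype.range_linearCombination] at hxs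
      obtain ⟨c, rfl⟩ := hxs
      exact ⟨c, by rw [← hx, pairM_lc]; rfl⟩

theorem gramM_cons (B : LinearMap.BilinForm F V) (hB : B.IsAlt) {k : ℕ} (v : Fin k → V) (x : V) :
    gramM B (Fin.cons x v : Fin (k + 1) → V) = bord (gramM B v) (pairM B v x) := by
  ext i j
  refine Fin.cases ?_ (fun i => ?_) i <;> refine Fin.cases ?_ (fun j => ?_) j
  · simpa [gramM, bord] using hB x
  · simpa [gramM, bord, pairM] using (LinearMap.BilinForm.IsAlt.neg_eq hB (v j) x).symm
  · simp [gramM, bord, pairM]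
  · simp [gramM, bord]

theorem bord_inj {k : ℕ} {A A' : Matrix (Fin k) (Fin k) F} {b b' : Fin k → F}
    (h : bord A b = bord A' b') : A = A' ∧ b = b' := by
  constructor
  · ext i j
    have := congrFun (congrFun h i.succ) j.succ
    simpa [bord] using this
  · ext i
    have := congrFun (congrFun h i.succ) 0
    simpa [bord] using this

theorem isAltM_bord {k : ℕ} {A : Matrix (Fin k) (Fin k) F} {b : Fin k → F} :
    IsAltM (bord A b) ↔ IsAltM A := by
  constructor
  · rintro ⟨h1, h2⟩
    exact ⟨fun i => by simpa [bord] using h1 i.succ,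
      fun i j => by simpa [bord] using h2 i.succ j.succ⟩
  · rintro ⟨h1, h2⟩
    constructor
    · intro i
      refine Fin.cases ?_ (fun i => ?_) i
      · simp [bord]
      · simpa [bord] using h1 i
    · intro i j
      refine Fin.cases ?_ (fun i => ?_) i <;> refine Fin.cases ?_ (fun j => ?_) j
      · simp [bord]
      · simp [bord]
      · simp [bord]
      · simpa [bord] using h2 i j

theorem exists_bord {k : ℕ} (A : Matrix (Fin (k + 1)) (Fin (k + 1)) F) (hA : IsAltM A) :
    ∃ A' b, A = bord A' b := by
  refine ⟨Matrix.of fun i j => A i.succ j.succ, fun i => A i.succ 0, ?_⟩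
  ext i j
  refine Fin.cases ?_ (fun i => ?_) i <;> refine Fin.cases ?_ (fun j => ?_) j
  · simpa [bord] using hA.1 0
  · simpa [bord] using hA.2 j.succ 0
  · simp [bord]
  · simp [bord]

theorem isAltM_gramM (B : LinearMap.BilinForm F V) (hB : B.IsAlt) {k : ℕ} (v : Fin k → V) :
    IsAltM (gramM B v) :=
  ⟨fun i => by simpa [gramM] using hB (v i),
   fun i j => by simpa [gramM] using (LinearMap.BilinForm.IsAlt.neg_eq hB (v i) (v j)).symm⟩

/-- Gram matrices of independent tuples. -/
def IsReal (B : LinearMap.BilinForm F V) {k : ℕ} (A : Matrix (Fin k) (Fin k) F) : Prop :=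
  ∃ v : Fin k → V, LinearIndependent F v ∧ gramM B v = A

theorem isReal_bord (B : LinearMap.BilinForm F V) (hn : B.Nondegenerate) (hB : B.IsAlt)
    {k : ℕ} (A : Matrix (Fin k) (Fin k) F) (b : Fin k → F) :
    IsReal B (bord A b) ↔ IsReal B A ∧
      (k + corank A < Module.finrank F V ∨ b ∉ LinearMap.range A.mulVecLin) := by
  constructor
  · rintro ⟨v, hv, hg⟩
    obtain ⟨x, v, rfl⟩ : ∃ x v', v = Fin.cons x v' := ⟨v 0, Fin.tail v, by simp⟩
    rw [gramM_cons B hB] at hg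
    obtain ⟨rfl, rfl⟩ := bord_inj hg
    obtain ⟨hv, hx⟩ := linearIndependent_finCons.1 hv
    exact ⟨⟨v, hv, rfl⟩, (exists_ext_iff B hn hB v hv _).1 ⟨x, hx, rfl⟩⟩
  · rintro ⟨⟨v, hv, rfl⟩, h⟩
    obtain ⟨x, hx, rfl⟩ := (exists_ext_iff B hn hB v hv _).2 h
    exact ⟨Fin.cons x v, linearIndependent_finCons.2 ⟨hv, hx⟩, gramM_cons B hB v x⟩

/-- Witt's theorem for alternating forms. -/
theorem witt_s8 (B : LinearMap.BilinForm F V) (hn : B.Nondegenerate) (hB : B.IsAlt) (m : ℕ) :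
    ∀ {k : ℕ} (v w : Fin k → V), LinearIndependent F v → LinearIndependent F w →
      gramM B v = gramM B w → k + m = Module.finrank F V →
      ∃ N : V ≃ₗ[F] V, (∀ x y, B (N x) (N y) = B x y) ∧ ∀ i, N (v i) = w i := by
  induction m with
  | zero =>
    intro k v w hv hw hg hk
    have hcard : Fintype.card (Fin k) = Module.finrank F V := by simpa using hk
    rcases Nat.eq_zero_or_pos k with rfl | hpos
    · have : Subsingleton V := Module.finrank_zero_iff.1 hk.symm
      exact ⟨LinearEquiv.refl F V, fun x y => rfl, fun i => i.elim0⟩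
    have : Nonempty (Fin k) := ⟨⟨0, hpos⟩⟩
    let bv := basisOfLinearIndependentOfCardEqFinrank hv hcard
    let bw := basisOfLinearIndependentOfCardEqFinrank hw hcard
    have hbv : ∀ i, bv i = v i := fun i => by simp [bv]
    have hbw : ∀ i, bw i = w i := fun i => by simp [bw]
    let N : V ≃ₗ[F] V := bv.equiv bw (Equiv.refl _)
    have hN : ∀ i, N (bv i) = bw i := fun i => by simp [N]
    refine ⟨N, ?_, fun i => by rw [← hbv, hN, hbw]⟩
    have : B.compl₁₂ N.toLinearMap N.toLinearMap = B := by
      apply LinearMap.BilinForm.ext_basis bv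
      intro i j
      simp only [LinearMap.compl₁₂_apply, LinearEquiv.coe_coe, hN]
      rw [hbv, hbv, hbw, hbw]
      exact (congrFun (congrFun hg i) j).symm
    intro x y
    exact congrArg (fun (f : LinearMap.BilinForm F V) => f x y) this
  | succ m ih =>
    intro k v w hv hw hg hk
    have : ∃ x, x ∉ Submodule.span F (Set.range v) := by
      by_contra! h
      have : Submodule.span F (Set.range v) = ⊤ := by
        rw [eq_top_iff]; exact fun x _ => h x
      have h2 := finrank_span_eq_card hv
      rw [this, finrank_top, Fintype.card_fin] at h2
      omega
    obtain ⟨x, hx⟩ := this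
    have h := (exists_ext_iff B hn hB v hv _).1 ⟨x, hx, rfl⟩
    rw [hg] at h
    obtain ⟨y, hy, hyx⟩ := (exists_ext_iff B hn hB w hw _).2 h
    obtain ⟨N, h1, h2⟩ := ih (Fin.cons x v) (Fin.cons y w) (linearIndependent_finCons.2 ⟨hv, hx⟩)
      (linearIndependent_finCons.2 ⟨hw, hy⟩) (by rw [gramM_cons B hB, gramM_cons B hB, hyx, hg])
      (by omega)
    exact ⟨N, h1, fun i => by simpa using h2 i.succ⟩

theorem simil_injective (B : LinearMap.BilinForm F V) (hn : B.Nondegenerate) {d : F}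
    (hd : d ≠ 0) (M : V →ₗ[F] V) (hM : ∀ x y, B (M x) (M y) = d * B x y) :
    Function.Injective M := by
  rw [injective_iff_map_eq_zero]
  intro x hx
  apply hn.1
  intro y
  have := hM x y
  rw [hx] at this
  simpa [hd] using this.symm

end LinAlg

section Corank

variable {F : Type*} [Field F]

theorem bord_mulVec {k : ℕ} (A : Matrix (Fin k) (Fin k) F) (b x : Fin k → F) (t : F) :
    bord A b *ᵥ (Fin.cons t x : Fin (k + 1) → F) = Fin.cons (- (b ⬝ᵥ x)) (t • b + A *ᵥ x) := by
  ext i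
  refine Fin.cases ?_ (fun i => ?_) i
  · simp [bord, Matrix.mulVec, dotProduct, Fin.sum_univ_succ]
  · simp [bord, Matrix.mulVec, dotProduct, Fin.sum_univ_succ, mul_comm]

theorem bord_mulVec_eq_zero {k : ℕ} (A : Matrix (Fin k) (Fin k) F) (b x : Fin k → F) (t : F) :
    bord A b *ᵥ (Fin.cons t x : Fin (k + 1) → F) = 0 ↔ b ⬝ᵥ x = 0 ∧ t • b + A *ᵥ x = 0 := by
  rw [bord_mulVec]
  constructor
  · intro h
    refine ⟨?_, ?_⟩
    · simpa using congrFun h 0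
    · ext i
      simpa using congrFun h i.succ
  · rintro ⟨h1, h2⟩
    rw [h1, h2]
    ext i
    refine Fin.cases ?_ (fun i => ?_) i <;> simp

theorem IsAltM.transpose {k : ℕ} {A : Matrix (Fin k) (Fin k) F} (hA : IsAltM A) : Aᵀ = - A := by
  ext i j
  simpa using hA.2 i j

theorem IsAltM.quad {k : ℕ} {A : Matrix (Fin k) (Fin k) F} (hA : IsAltM A) (y : Fin k → F) :
    (A *ᵥ y) ⬝ᵥ y = 0 := by
  simp only [Matrix.mulVec, dotProduct, Finset.sum_mul]
  rw [← Finset.sum_product']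
  refine Finset.sum_involution (fun p _ => (p.2, p.1)) ?_ ?_ ?_ ?_
  · rintro ⟨i, j⟩ _
    simp only
    rw [hA.2 i j]; ring
  · rintro ⟨i, j⟩ _ h h'
    simp only [Prod.mk.injEq] at h'
    apply h
    simp only
    rw [h'.1, hA.1]; simp
  · simp
  · simp

theorem IsAltM.dot {k : ℕ} {A : Matrix (Fin k) (Fin k) F} (hA : IsAltM A) (x y : Fin k → F) :
    (A *ᵥ y) ⬝ᵥ x = - (y ⬝ᵥ A *ᵥ x) := by
  rw [Matrix.dotProduct_mulVec, ← Matrix.mulVec_transpose, hA.transpose, Matrix.neg_mulVec,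
    neg_dotProduct, neg_neg]

theorem corank_bord_mem {k : ℕ} {A : Matrix (Fin k) (Fin k) F} (hA : IsAltM A) {b : Fin k → F}
    (hb : b ∈ LinearMap.range A.mulVecLin) : corank (bord A b) = corank A + 1 := by
  obtain ⟨y, rfl⟩ := hb
  simp only [Matrix.mulVecLin_apply]
  let L : (LinearMap.ker A.mulVecLin × F) →ₗ[F] (Fin (k + 1) → F) :=
    { toFun := fun p => Fin.cons p.2 (p.1.1 - p.2 • y)
      map_add' := by
        intro p q
        ext i
        refine Fin.cases ?_ (fun i => ?_) i
        · simp
        · simp; ring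
      map_smul' := by
        intro c p
        ext i
        refine Fin.cases ?_ (fun i => ?_) i
        · simp
        · simp; ring }
  have hL : ∀ p, L p = Fin.cons p.2 (p.1.1 - p.2 • y) := fun p => rfl
  have hinj : Function.Injective L := by
    rw [injective_iff_map_eq_zero]
    rintro ⟨⟨x, hx⟩, t⟩ h
    rw [hL] at h
    have h0 : t = 0 := by simpa using congrFun h 0
    subst h0
    have h1 : x = 0 := by
      ext i
      simpa using congrFun h i.succ
    subst h1
    rfl
  have hr : LinearMap.range L = LinearMap.ker (bord A (A *ᵥ y)).mulVecLin := by
    ext z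
    obtain ⟨t, x, rfl⟩ : ∃ t x, z = Fin.cons t x := ⟨z 0, Fin.tail z, by simp⟩
    rw [LinearMap.mem_ker, Matrix.mulVecLin_apply, bord_mulVec_eq_zero]
    constructor
    · rintro ⟨⟨⟨x', hx'⟩, t'⟩, h⟩
      rw [hL] at h
      obtain ⟨h1, h2⟩ := Fin.cons_inj.1 h
      simp only at h1 h2
      subst h1 h2
      have hx'' : A *ᵥ x' = 0 := hx'
      have : t' • A *ᵥ y + A *ᵥ (x' - t' • y) = 0 := by
        rw [Matrix.mulVec_sub, Matrix.mulVec_smul, hx'']; simp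
      refine ⟨?_, this⟩
      rw [dotProduct_sub, dotProduct_smul, hA.quad, hA.dot, hx'']
      simp
    · rintro ⟨h1, h2⟩
      refine ⟨⟨⟨x + t • y, ?_⟩, t⟩, ?_⟩
      · rw [LinearMap.mem_ker, Matrix.mulVecLin_apply, Matrix.mulVec_add, Matrix.mulVec_smul,
          add_comm, h2]
      · rw [hL]; simp
  rw [corank, ← hr, LinearMap.finrank_range_of_inj hinj, Module.finrank_prod, Module.finrank_self,
    corank]

theorem corank_bord_notMem {k : ℕ} {A : Matrix (Fin k) (Fin k) F} (hA : IsAltM A) {b : Fin k → F}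
    (hb : b ∉ LinearMap.range A.mulVecLin) : corank (bord A b) + 1 = corank A := by
  let φ : Module.Dual F (Fin k → F) := dotProductBilin F F b
  have hφ : ∀ x, φ x = b ⬝ᵥ x := fun x => rfl
  have hne : φ.domRestrict (LinearMap.ker A.mulVecLin) ≠ 0 := by
    intro h0
    have : φ ∈ (LinearMap.ker A.mulVecLin).dualAnnihilator := by
      rw [Submodule.mem_dualAnnihilator]
      intro w hw
      exact congrArg (fun f => f ⟨w, hw⟩) h0
    rw [← LinearMap.range_dualMap_eq_dualAnnihilator_ker] at this
    obtain ⟨ψ, hψ⟩ := this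
    apply hb
    let y : Fin k → F := fun i => ψ (Pi.single i 1)
    have hy : ∀ x, ψ x = y ⬝ᵥ x := by
      intro x
      conv_lhs => rw [pi_eq_sum_univ' x]
      simp [y, dotProduct, mul_comm]
    refine ⟨- y, ?_⟩
    rw [Matrix.mulVecLin_apply]
    have : ∀ x, (A *ᵥ (-y)) ⬝ᵥ x = b ⬝ᵥ x := by
      intro x
      rw [hA.dot, neg_dotProduct, neg_neg, ← hy, ← hφ, ← hψ]
      rfl
    exact dotProduct_eq _ _ this
  have h1 := Module.Dual.finrank_ker_add_one_of_ne_zero hne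
  rw [LinearMap.ker_domRestrict] at h1
  rw [corank, corank, ← h1]
  congr 1
  let J : LinearMap.ker (φ.domRestrict (LinearMap.ker A.mulVecLin)) →ₗ[F] (Fin (k + 1) → F) :=
    { toFun := fun p => Fin.cons 0 p.1.1
      map_add' := by
        intro p q
        ext i
        refine Fin.cases ?_ (fun i => ?_) i <;> simp
      map_smul' := by
        intro c p
        ext i
        refine Fin.cases ?_ (fun i => ?_) i <;> simp }
  have hJ : ∀ p, J p = Fin.cons 0 p.1.1 := fun p => rfl
  have hinj : Function.Injective J := by
    rintro ⟨⟨x, hx⟩, hx1⟩ ⟨⟨y, hy⟩, hy1⟩ h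
    rw [hJ, hJ] at h
    have : x = y := (Fin.cons_inj.1 h).2
    subst this
    rfl
  have hr : LinearMap.range J = LinearMap.ker (bord A b).mulVecLin := by
    ext z
    obtain ⟨t, x, rfl⟩ : ∃ t x, z = Fin.cons t x := ⟨z 0, Fin.tail z, by simp⟩
    rw [LinearMap.mem_ker, Matrix.mulVecLin_apply, bord_mulVec_eq_zero]
    constructor
    · rintro ⟨⟨⟨x', hx'⟩, h'⟩, h⟩
      rw [hJ] at h
      obtain ⟨h1, h2⟩ := Fin.cons_inj.1 h
      simp only at h1 h2
      subst h1 h2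
      refine ⟨h', ?_⟩
      rw [zero_smul, zero_add]
      exact hx'
    · rintro ⟨h1, h2⟩
      have ht : t = 0 := by
        by_contra ht
        apply hb
        refine ⟨- t⁻¹ • x, ?_⟩
        rw [Matrix.mulVecLin_apply, Matrix.mulVec_smul, eq_neg_of_add_eq_zero_right h2]
        simp [smul_smul, ht]
      subst ht
      rw [zero_smul, zero_add] at h2
      exact ⟨⟨⟨x, h2⟩, h1⟩, rfl⟩
  rw [← hr, LinearMap.finrank_range_of_inj hinj, LinearMap.ker_domRestrict]

theorem corank_parity {k : ℕ} (A : Matrix (Fin k) (Fin k) F) (hA : IsAltM A) :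
    Even (k + corank A) ∧ corank A ≤ k := by
  induction k with
  | zero =>
    have : corank A = 0 := by
      rw [corank]
      exact Module.finrank_zero_of_subsingleton
    simp [this]
  | succ k ih =>
    obtain ⟨A, b, rfl⟩ := exists_bord A hA
    rw [isAltM_bord] at hA
    have := ih A hA
    by_cases hb : b ∈ LinearMap.range A.mulVecLin
    · rw [corank_bord_mem hA hb]
      grind
    · have h2 := corank_bord_notMem hA hb
      grind

theorem corank_zero_matrix {k : ℕ} : corank (0 : Matrix (Fin k) (Fin k) F) = k := by
  rw [corank, Matrix.mulVecLin_zero, LinearMap.ker_zero, finrank_top]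
  simp

theorem isReal_iff {V : Type*} [AddCommGroup V] [Module F V] [FiniteDimensional F V]
    (B : LinearMap.BilinForm F V) (hn : B.Nondegenerate) (hB : B.IsAlt)
    {k : ℕ} (A : Matrix (Fin k) (Fin k) F) :
    IsReal B A ↔ IsAltM A ∧ k + corank A ≤ Module.finrank F V := by
  constructor
  · rintro ⟨v, hv, rfl⟩
    exact ⟨isAltM_gramM B hB v, corank_le B hn hB v hv⟩
  induction k with
  | zero =>
    rintro -
    exact ⟨Fin.elim0, linearIndependent_empty_type, by ext i; exact i.elim0⟩
  | succ k ih =>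
    rintro ⟨hA, hk⟩
    obtain ⟨A, b, rfl⟩ := exists_bord A hA
    rw [isAltM_bord] at hA
    rw [isReal_bord B hn hB]
    by_cases hb : b ∈ LinearMap.range A.mulVecLin
    · rw [corank_bord_mem hA hb] at hk
      exact ⟨ih A ⟨hA, by omega⟩, Or.inl (by omega)⟩
    · have h2 := corank_bord_notMem hA hb
      exact ⟨ih A ⟨hA, by omega⟩, Or.inr hb⟩

end Corank

section CountAlt

open Classical in
/-- The number of alternating `k × k` matrices of corank `s`. -/
noncomputable def altN (F : Type*) [Field F] [Fintype F] (k s : ℕ) : ℕ :=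
  #{A : Matrix (Fin k) (Fin k) F | IsAltM A ∧ corank A = s}

/-- `∏_{i=1}^k (q^i - 1)`. -/
noncomputable def phiN (q : ℝ) (k : ℕ) : ℝ := ∏ i ∈ range k, (q ^ (i + 1) - 1)

/-- `∏_{i=1}^r q^{2(i-1)}/(q^{2i} - 1)`. -/
noncomputable def rhoN (q : ℝ) (r : ℕ) : ℝ := ∏ i ∈ range r, (q ^ (2 * i) / (q ^ (2 * i + 2) - 1))

variable {F : Type*} [Field F] [Fintype F]

theorem card_range_corank {k : ℕ} (A : Matrix (Fin k) (Fin k) F) :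
    (Nat.card (LinearMap.range A.mulVecLin) : ℝ) =
      (Fintype.card F : ℝ) ^ k / (Fintype.card F : ℝ) ^ (corank A) := by
  have h := A.mulVecLin.finrank_range_add_finrank_ker
  rw [Module.natCard_eq_pow_finrank (K := F), Nat.card_eq_fintype_card]
  have hq : (Fintype.card F : ℝ) ≠ 0 := by simp
  rw [eq_div_iff (pow_ne_zero _ hq), Nat.cast_pow, corank, ← pow_add, h]
  simp

open Classical in
theorem sum_alt_succ (h : ℕ → ℝ) (k : ℕ) :
    ∑ A : Matrix (Fin (k + 1)) (Fin (k + 1)) F with IsAltM A, h (corank A) =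
    ∑ A : Matrix (Fin k) (Fin k) F with IsAltM A,
      ((Fintype.card F : ℝ) ^ k / (Fintype.card F : ℝ) ^ (corank A) * h (corank A + 1) +
       ((Fintype.card F : ℝ) ^ k - (Fintype.card F : ℝ) ^ k / (Fintype.card F : ℝ) ^ (corank A)) *
        h (corank A - 1)) := by
  have e1 : ∑ A : Matrix (Fin (k + 1)) (Fin (k + 1)) F with IsAltM A, h (corank A) =
      ∑ A : Matrix (Fin k) (Fin k) F with IsAltM A, ∑ b : Fin k → F, h (corank (bord A b)) := by
    rw [← Finset.sum_product']
    symm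
    refine Finset.sum_bij (fun p _ => bord p.1 p.2) ?_ ?_ ?_ ?_
    · rintro ⟨A, b⟩ hA
      simpa [isAltM_bord] using hA
    · rintro ⟨A, b⟩ hA ⟨A', b'⟩ hA' hh
      obtain ⟨h1, h2⟩ := bord_inj hh
      simp only at h1 h2
      rw [h1, h2]
    · intro A hA
      have hA : IsAltM A := by simpa using hA
      obtain ⟨A', b, rfl⟩ := exists_bord A hA
      refine ⟨⟨A', b⟩, ?_, rfl⟩
      simpa [isAltM_bord] using hA
    · intros; rfl
  rw [e1]
  apply Finset.sum_congr rfl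
  intro A hA
  have hA : IsAltM A := by simpa using hA
  rw [← Finset.sum_filter_add_sum_filter_not Finset.univ
    (fun b => b ∈ LinearMap.range A.mulVecLin)]
  have c1 : ((#{b : Fin k → F | b ∈ LinearMap.range A.mulVecLin} : ℕ) : ℝ) =
      (Fintype.card F : ℝ) ^ k / (Fintype.card F : ℝ) ^ (corank A) := by
    rw [← card_range_corank, ← Fintype.card_subtype, Nat.card_eq_fintype_card]
  have c2 : ((#{b : Fin k → F | ¬ b ∈ LinearMap.range A.mulVecLin} : ℕ) : ℝ) =
      (Fintype.card F : ℝ) ^ k - (Fintype.card F : ℝ) ^ k / (Fintype.card F : ℝ) ^ (corank A) := by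
    rw [eq_sub_iff_add_eq, ← c1, add_comm]
    have := Finset.card_filter_add_card_filter_not (s := (Finset.univ : Finset (Fin k → F)))
      (fun b => b ∈ LinearMap.range A.mulVecLin)
    rw [← Nat.cast_add, this]
    simp
  congr 1
  · rw [← c1, ← nsmul_eq_mul]
    apply Finset.sum_eq_card_nsmul
    intro b hb
    rw [corank_bord_mem hA (by simpa using hb)]
  · rw [← c2, ← nsmul_eq_mul]
    apply Finset.sum_eq_card_nsmul
    intro b hb
    rw [← corank_bord_notMem hA (by simpa using hb)]
    simp

open Classical in
theorem altN_eq_sum (k s : ℕ) : (altN F k s : ℝ) =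
    ∑ A : Matrix (Fin k) (Fin k) F with IsAltM A, if corank A = s then (1 : ℝ) else 0 := by
  rw [altN, ← Finset.filter_filter, Finset.card_filter, Nat.cast_sum]
  simp

theorem altN_succ_zero (k : ℕ) : (altN F (k + 1) 0 : ℝ) =
    ((Fintype.card F : ℝ) ^ k - (Fintype.card F : ℝ) ^ k / (Fintype.card F : ℝ) ^ 1) *
      altN F k 1 := by
  classical
  rw [altN_eq_sum, sum_alt_succ (fun c => if c = 0 then (1 : ℝ) else 0), altN_eq_sum,
    Finset.mul_sum]
  apply Finset.sum_congr rfl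
  intro A _
  rcases h : corank A with _ | _ | c <;> simp

theorem altN_succ_succ (k s : ℕ) : (altN F (k + 1) (s + 1) : ℝ) =
    (Fintype.card F : ℝ) ^ k / (Fintype.card F : ℝ) ^ s * altN F k s +
    ((Fintype.card F : ℝ) ^ k - (Fintype.card F : ℝ) ^ k / (Fintype.card F : ℝ) ^ (s + 2)) *
      altN F k (s + 2) := by
  classical
  rw [altN_eq_sum, sum_alt_succ (fun c => if c = s + 1 then (1 : ℝ) else 0), altN_eq_sum,
    altN_eq_sum, Finset.mul_sum, Finset.mul_sum, ← Finset.sum_add_distrib]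
  apply Finset.sum_congr rfl
  intro A _
  congr 1
  · by_cases h : corank A = s <;> simp [h]
  · rcases h : corank A with _ | c
    · simp
    · by_cases h : c = s + 1 <;> simp [h]

theorem altN_eq_zero (k s : ℕ) (h : ¬ Even (k + s) ∨ k < s) : altN F k s = 0 := by
  classical
  rw [altN, Finset.card_eq_zero, Finset.filter_eq_empty_iff]
  rintro A _ ⟨hA, rfl⟩
  have := corank_parity A hA
  rcases h with h | h
  · exact h this.1
  · omega

theorem phiN_succ (q : ℝ) (k : ℕ) : phiN q (k + 1) = phiN q k * (q ^ (k + 1) - 1) :=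
  Finset.prod_range_succ ..

theorem rhoN_succ (q : ℝ) (k : ℕ) :
    rhoN q (k + 1) = rhoN q k * (q ^ (2 * k) / (q ^ (2 * k + 2) - 1)) :=
  Finset.prod_range_succ ..

theorem pow_sub_one_pos {q : ℝ} (hq : 1 < q) (k : ℕ) : 0 < q ^ (k + 1) - 1 := by
  have := one_lt_pow₀ hq (Nat.succ_ne_zero k)
  simpa using this

theorem phiN_pos {q : ℝ} (hq : 1 < q) (k : ℕ) : 0 < phiN q k :=
  Finset.prod_pos fun _ _ => pow_sub_one_pos hq _

theorem altN_closed (k : ℕ) : ∀ r s : ℕ, 2 * r + s = k → (altN F k s : ℝ) =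
    phiN (Fintype.card F) k * (rhoN (Fintype.card F) r / phiN (Fintype.card F) s) := by
  induction k with
  | zero =>
    intro r s h
    obtain ⟨rfl, rfl⟩ : r = 0 ∧ s = 0 := by omega
    have : altN F 0 0 = 1 := by
      classical
      rw [altN, Finset.card_eq_one]
      refine ⟨0, ?_⟩
      ext A
      have hA : A = 0 := Subsingleton.elim _ _
      have h2 : IsAltM A := ⟨fun i => i.elim0, fun i => i.elim0⟩
      have h3 := (corank_parity A h2).2
      simp only [hA, Finset.mem_filter, Finset.mem_univ, true_and, Finset.mem_singleton,
        iff_true]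
      rw [← hA]
      exact ⟨h2, by omega⟩
    simp [this, phiN, rhoN]
  | succ k ih =>
    intro r s h
    have hq : (1 : ℝ) < Fintype.card F := by exact_mod_cast Fintype.one_lt_card
    set q : ℝ := (Fintype.card F : ℝ) with hqdef
    have hq0 : q ≠ 0 := by positivity
    rcases s with _ | s
    · obtain ⟨r, rfl⟩ : ∃ r', r = r' + 1 := ⟨r - 1, by omega⟩
      rw [altN_succ_zero, ih r 1 (by omega), phiN_succ, rhoN_succ, ← hqdef]
      obtain rfl : k = 2 * r + 1 := by omega
      have h1 := (pow_sub_one_pos hq 0).ne'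
      have h2 := (pow_sub_one_pos hq (2 * r + 1)).ne'
      simp only [phiN, Finset.prod_range_succ, Finset.prod_range_zero] at *
      field_simp
      ring
    · rw [altN_succ_succ, ih r s (by omega), ← hqdef, phiN_succ, phiN_succ]
      have h1 := (pow_sub_one_pos hq s).ne'
      have h0 := (phiN_pos hq s).ne'
      obtain rfl : k = 2 * r + s := by omega
      rcases r with _ | r
      · rw [altN_eq_zero _ _ (Or.inr (by omega))]
        field_simp
        ring
      · rw [ih r (s + 2) (by omega), phiN_succ, phiN_succ, rhoN_succ]
        have h2 := (pow_sub_one_pos hq (s + 1)).ne'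
        have h3 := (pow_sub_one_pos hq (2 * r + 1)).ne'
        field_simp
        ring

end CountAlt

section Moebius

theorem moebius_partial {q : ℝ} (hq : 1 < q) (n m : ℕ) :
    ∑ k ∈ range (m + 1), (-1 : ℝ) ^ k / phiN q k * ∏ i ∈ range k, (q ^ n - q ^ i) =
      (-1 : ℝ) ^ m / phiN q m * ∏ i ∈ range m, (q ^ n - q ^ (i + 1)) := by
  induction m with
  | zero => simp
  | succ m ih =>
    rw [Finset.sum_range_succ, ih, phiN_succ, Finset.prod_range_succ' _ m,
      Finset.prod_range_succ _ m]
    have h1 := (pow_sub_one_pos hq m).ne'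
    have h0 := (phiN_pos hq m).ne'
    field_simp
    ring

theorem moebius_sum {q : ℝ} (hq : 1 < q) (n m : ℕ) (hnm : n ≤ m) :
    ∑ k ∈ range (m + 1), (-1 : ℝ) ^ k / phiN q k * ∏ i ∈ range k, (q ^ n - q ^ i) =
      if n = 0 then 1 else 0 := by
  split_ifs with h
  · subst h
    rw [Finset.sum_range_succ', Finset.sum_eq_zero]
    · simp [phiN]
    · intro k _
      rw [Finset.prod_range_succ']
      simp
  · rw [moebius_partial hq, Finset.prod_eq_zero (i := n - 1)]
    · simp
    · simp; omega
    · rw [Nat.sub_add_cancel (by omega), sub_self]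

variable {F : Type*} [Field F] [Fintype F] {V : Type*} [AddCommGroup V] [Module F V]
  [Fintype V] [Fintype (V →ₗ[F] V)]

theorem card_LI_real (W : Type*) [AddCommGroup W] [Module F W] [Finite W] (k : ℕ) :
    (Nat.card {s : Fin k → W // LinearIndependent F s} : ℝ) =
      ∏ i ∈ range k, ((Fintype.card F : ℝ) ^ Module.finrank F W - (Fintype.card F : ℝ) ^ i) := by
  by_cases hk : k ≤ Module.finrank F W
  · rw [card_linearIndependent hk, Nat.cast_prod, Finset.prod_range]
    apply Finset.prod_congr rfl
    intro i _
    rw [Nat.cast_sub]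
    · simp
    · exact Nat.pow_le_pow_right Fintype.card_pos (by omega)
  · have : IsEmpty {s : Fin k → W // LinearIndependent F s} := by
      constructor
      rintro ⟨s, hs⟩
      have := hs.fintype_card_le_finrank
      simp at this
      omega
    rw [Nat.card_of_isEmpty, Finset.prod_eq_zero (i := Module.finrank F W)]
    · simp
    · simp; omega
    · simp

open Classical in
theorem moebius_fix (M : V →ₗ[F] V) :
    ∑ k ∈ range (Module.finrank F V + 1), (-1 : ℝ) ^ k / phiN (Fintype.card F) k *
      (#{v : Fin k → V | LinearIndependent F v ∧ ∀ i, M (v i) = v i} : ℝ) =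
    if ∀ x, M x = x → x = 0 then 1 else 0 := by
  have hq : (1 : ℝ) < Fintype.card F := by exact_mod_cast Fintype.one_lt_card
  let W : Submodule F V := LinearMap.ker (M - 1)
  have hW : ∀ x, x ∈ W ↔ M x = x := by
    intro x
    simp [W, LinearMap.mem_ker, sub_eq_zero]
  have hc : ∀ k, (#{v : Fin k → V | LinearIndependent F v ∧ ∀ i, M (v i) = v i} : ℝ) =
      ∏ i ∈ range k, ((Fintype.card F : ℝ) ^ Module.finrank F W - (Fintype.card F : ℝ) ^ i) := by
    intro k
    rw [← card_LI_real, ← Fintype.card_subtype, ← Nat.card_eq_fintype_card]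
    congr 1
    refine Nat.card_congr
      { toFun := fun v => ⟨fun i => ⟨v.1 i, (hW _).2 (v.2.2 i)⟩, ?_⟩
        invFun := fun w => ⟨fun i => (w.1 i).1, ?_, fun i => (hW _).1 (w.1 i).2⟩
        left_inv := fun v => rfl
        right_inv := fun w => rfl }
    · exact LinearIndependent.of_comp W.subtype v.2.1
    · exact w.2.map' W.subtype (Submodule.ker_subtype W)
  simp_rw [hc]
  rw [moebius_sum hq _ _ (Submodule.finrank_le W)]
  congr 1
  rw [Submodule.finrank_eq_zero, Submodule.eq_bot_iff]
  simp [hW]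

open Classical in
theorem sum_fix_gram (B : LinearMap.BilinForm F V) (hn : B.Nondegenerate) (hB : B.IsAlt) {d : F}
    (hd : d ≠ 0) {k : ℕ} (A : Matrix (Fin k) (Fin k) F) :
    ∑ v : Fin k → V with (LinearIndependent F v ∧ gramM B v = A),
      #{M : V →ₗ[F] V | (∀ x y, B (M x) (M y) = d * B x y) ∧ ∀ i, M (v i) = v i} =
    if IsReal B A ∧ d • A = A then
      #{M : V →ₗ[F] V | ∀ x y, B (M x) (M y) = d * B x y} else 0 := by
  set T : Finset (Fin k → V) := {v : Fin k → V | LinearIndependent F v ∧ gramM B v = A} with hT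
  have memT : ∀ v, v ∈ T ↔ LinearIndependent F v ∧ gramM B v = A := by simp [hT]
  set G : Finset (V →ₗ[F] V) := {M : V →ₗ[F] V | ∀ x y, B (M x) (M y) = d * B x y} with hG
  have memG : ∀ M, M ∈ G ↔ ∀ x y, B (M x) (M y) = d * B x y := by simp [hG]
  have hgr : ∀ M ∈ G, ∀ v : Fin k → V, gramM B (fun i => M (v i)) = d • gramM B v := by
    intro M hM v
    ext i j
    simp [gramM, (memG M).1 hM]
  split_ifs with h
  · obtain ⟨⟨v0, hv0, hv0'⟩, hdA⟩ := h
    let c : (Fin k → V) → (Fin k → V) → ℕ := fun v w => #{M ∈ G | (fun i => M (v i)) = w}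
    have hc : ∀ v, #{M : V →ₗ[F] V | (∀ x y, B (M x) (M y) = d * B x y) ∧ ∀ i, M (v i) = v i}
        = c v v := by
      intro v
      simp only [c]
      congr 1
      ext M
      simp [memG, funext_iff]
    simp_rw [hc]
    have h1 : ∀ v ∈ T, ∑ w ∈ T, c v w = #G := by
      intro v hv
      symm
      apply Finset.card_eq_sum_card_fiberwise
      intro M hM
      have hM : M ∈ G := hM
      have hv' := (memT v).1 hv
      refine (memT _).2 ⟨?_, ?_⟩
      · exact hv'.1.map' M (LinearMap.ker_eq_bot.2 (simil_injective B hn hd M ((memG M).1 hM)))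
      · rw [hgr M hM, hv'.2, hdA]
    have h2 : ∀ v ∈ T, ∀ w ∈ T, c v w = c v v := by
      intro v hv w hw
      have hv' := (memT v).1 hv
      have hw' := (memT w).1 hw
      have hle := hv'.1.fintype_card_le_finrank
      rw [Fintype.card_fin] at hle
      obtain ⟨N, hN, hNv⟩ := witt_s8 B hn hB (Module.finrank F V - k) w v hw'.1 hv'.1
        (by rw [hv'.2, hw'.2]) (by omega)
      refine Finset.card_bij' (fun M _ => N.toLinearMap ∘ₗ M) (fun M _ => N.symm.toLinearMap ∘ₗ M)
        ?_ ?_ ?_ ?_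
      · intro M hM
        rw [Finset.mem_filter, memG] at hM ⊢
        refine ⟨fun x y => ?_, ?_⟩
        · simp [hN, hM.1]
        · ext i
          have := congrFun hM.2 i
          simp [this, hNv]
      · intro M hM
        rw [Finset.mem_filter, memG] at hM ⊢
        refine ⟨fun x y => ?_, ?_⟩
        · have := hN (N.symm (M x)) (N.symm (M y))
          simp only [LinearEquiv.apply_symm_apply] at this
          simp [← this, hM.1]
        · ext i
          have := congrFun hM.2 i
          simp only [LinearMap.comp_apply, LinearEquiv.coe_coe]
          rw [this, ← hNv]
          simp
      · intro M _
        ext x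
        simp
      · intro M _
        ext x
        simp
    have hTpos : 0 < #T := Finset.card_pos.2 ⟨v0, (memT _).2 ⟨hv0, hv0'⟩⟩
    apply Nat.eq_of_mul_eq_mul_left hTpos
    rw [Finset.mul_sum, ← smul_eq_mul, ← Finset.sum_const]
    apply Finset.sum_congr rfl
    intro v hv
    rw [← h1 v hv, Finset.sum_congr rfl (h2 v hv), Finset.sum_const, smul_eq_mul]
  · apply Finset.sum_eq_zero
    intro v hv
    have hv' := (memT v).1 hv
    rw [Finset.card_eq_zero, Finset.filter_eq_empty_iff]
    rintro M - ⟨hM1, hM2⟩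
    apply h
    refine ⟨⟨v, hv'⟩, ?_⟩
    rw [← hv'.2, ← hgr M ((memG M).2 hM1)]
    congr 1
    ext i
    exact hM2 i

open Classical in
theorem theoremA (B : LinearMap.BilinForm F V) (hn : B.Nondegenerate) (hB : B.IsAlt) {d : F}
    (hd : d ≠ 0) :
    (#{M : V →ₗ[F] V | (∀ x y, B (M x) (M y) = d * B x y) ∧ ∀ x, M x = x → x = 0} : ℝ) =
    (∑ k ∈ range (Module.finrank F V + 1), (-1 : ℝ) ^ k / phiN (Fintype.card F) k *
      (#{A : Matrix (Fin k) (Fin k) F | IsReal B A ∧ d • A = A} : ℝ)) *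
    (#{M : V →ₗ[F] V | ∀ x y, B (M x) (M y) = d * B x y} : ℝ) := by
  rw [← Finset.filter_filter, Finset.card_filter, Nat.cast_sum]
  simp_rw [Nat.cast_ite, Nat.cast_one, Nat.cast_zero, ← moebius_fix]
  rw [Finset.sum_comm, Finset.sum_mul]
  apply Finset.sum_congr rfl
  intro k _
  rw [← Finset.mul_sum, mul_assoc]
  congr 1
  rw [← Nat.cast_sum, ← Nat.cast_mul]
  congr 1
  calc _ = ∑ M : V →ₗ[F] V with (∀ x y, B (M x) (M y) = d * B x y),
        ∑ v : Fin k → V with LinearIndependent F v, if ∀ i, M (v i) = v i then 1 else 0 := by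
        apply Finset.sum_congr rfl
        intro M _
        rw [← Finset.filter_filter, Finset.card_filter]
    _ = ∑ v : Fin k → V with LinearIndependent F v,
          #{M : V →ₗ[F] V | (∀ x y, B (M x) (M y) = d * B x y) ∧ ∀ i, M (v i) = v i} := by
        rw [Finset.sum_comm]
        apply Finset.sum_congr rfl
        intro v _
        rw [← Finset.filter_filter, Finset.card_filter]
    _ = ∑ A : Matrix (Fin k) (Fin k) F,
        ∑ v : Fin k → V with (LinearIndependent F v ∧ gramM B v = A),
          #{M : V →ₗ[F] V | (∀ x y, B (M x) (M y) = d * B x y) ∧ ∀ i, M (v i) = v i} := by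
        rw [← Finset.sum_fiberwise _ (fun v => gramM B v)]
        simp_rw [Finset.filter_filter]
    _ = _ := by
        simp_rw [sum_fix_gram B hn hB hd]
        rw [← Finset.sum_filter, Finset.sum_const, smul_eq_mul]

theorem theoremA_card (B : LinearMap.BilinForm F V) (hn : B.Nondegenerate) (hB : B.IsAlt) {d : F}
    (hd : d ≠ 0) :
    (Nat.card {M : V →ₗ[F] V //
      (∀ x y, B (M x) (M y) = d * B x y) ∧ ∀ x, M x = x → x = 0} : ℝ) =
    (∑ k ∈ range (Module.finrank F V + 1), (-1 : ℝ) ^ k / phiN (Fintype.card F) k *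
      (Nat.card {A : Matrix (Fin k) (Fin k) F // IsReal B A ∧ d • A = A} : ℝ)) *
    (Nat.card {M : V →ₗ[F] V // ∀ x y, B (M x) (M y) = d * B x y} : ℝ) := by
  classical
  simp only [Nat.card_eq_fintype_card, Fintype.card_subtype]
  convert theoremA B hn hB hd

end Moebius

section Symp

variable (ℓ g : ℕ) [Fact ℓ.Prime]

/-- The standard symplectic bilinear form. -/
noncomputable def OmB : LinearMap.BilinForm (ZMod ℓ) (Fin g ⊕ Fin g → ZMod ℓ) :=
  Matrix.toBilin' (Om ℓ g)

theorem OmB_apply (x y : Fin g ⊕ Fin g → ZMod ℓ) : OmB ℓ g x y = x ⬝ᵥ Om ℓ g *ᵥ y := by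
  rw [OmB, Matrix.toBilin'_apply']

theorem OmB_alt : (OmB ℓ g).IsAlt := by
  intro x
  rw [OmB_apply, Om, Matrix.fromBlocks_mulVec]
  simp only [dotProduct, Fintype.sum_sum_type]
  simp only [Sum.elim_inl, Sum.elim_inr, Matrix.zero_mulVec, Matrix.one_mulVec, Matrix.neg_mulVec,
    Pi.add_apply, Pi.zero_apply, Pi.neg_apply, Function.comp_apply, zero_add, add_zero]
  rw [← Finset.sum_add_distrib]
  apply Finset.sum_eq_zero
  intro i _
  ring

theorem Om_det_ne_zero : (Om ℓ g).det ≠ 0 := by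
  have h : Om ℓ g * (- Om ℓ g) = 1 := by
    rw [Om, Matrix.fromBlocks_neg, Matrix.fromBlocks_multiply]
    simp
  have := congrArg Matrix.det h
  rw [Matrix.det_mul, Matrix.det_one] at this
  intro h0
  rw [h0, zero_mul] at this
  exact zero_ne_one this

theorem OmB_nondeg : (OmB ℓ g).Nondegenerate :=
  LinearMap.BilinForm.nondegenerate_toBilin'_of_det_ne_zero' _ (Om_det_ne_zero ℓ g)

theorem inGSp_iff {d : ZMod ℓ} (hd : d ≠ 0)
    (M : Matrix (Fin g ⊕ Fin g) (Fin g ⊕ Fin g) (ZMod ℓ)) :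
    inGSp ℓ g d M ↔ ∀ x y, OmB ℓ g (Matrix.toLin' M x) (Matrix.toLin' M y) = d * OmB ℓ g x y := by
  have key : Mᵀ * Om ℓ g * M = d • Om ℓ g ↔
      ∀ x y, OmB ℓ g (Matrix.toLin' M x) (Matrix.toLin' M y) = d * OmB ℓ g x y := by
    rw [← (Matrix.toBilin' (R₁ := ZMod ℓ) (n := Fin g ⊕ Fin g)).injective.eq_iff,
      LinearMap.ext_iff₂]
    simp only [Matrix.toBilin'_apply', OmB_apply, Matrix.toLin'_apply, Matrix.smul_mulVec,
      dotProduct_smul, smul_eq_mul]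
    have : ∀ x y, x ⬝ᵥ (Mᵀ * Om ℓ g * M) *ᵥ y = M *ᵥ x ⬝ᵥ Om ℓ g *ᵥ M *ᵥ y := by
      intro x y
      rw [← Matrix.mulVec_mulVec, ← Matrix.mulVec_mulVec, Matrix.dotProduct_mulVec x,
        Matrix.vecMul_transpose]
    simp only [this]
  rw [inGSp, key]
  refine ⟨fun h => h.2, fun h => ⟨?_, h⟩⟩
  have hi := simil_injective (OmB ℓ g) (OmB_nondeg ℓ g) hd _ h
  rw [← Matrix.isUnit_iff_isUnit_det, ← Matrix.mulVec_injective_iff_isUnit]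
  exact hi

theorem det_sub_one_iff (M : Matrix (Fin g ⊕ Fin g) (Fin g ⊕ Fin g) (ZMod ℓ)) :
    (M - 1).det ≠ 0 ↔ ∀ x, Matrix.toLin' M x = x → x = 0 := by
  rw [← isUnit_iff_ne_zero, ← Matrix.isUnit_iff_isUnit_det, ← Matrix.mulVec_injective_iff_isUnit]
  have : (M - 1).mulVec = (M - 1).mulVecLin := rfl
  rw [this, injective_iff_map_eq_zero]
  simp [sub_eq_zero, Matrix.sub_mulVec]

theorem QGSp_eq {d : ZMod ℓ} (hd : d ≠ 0) : QGSp ℓ g d =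
    1 - ∑ k ∈ range (2 * g + 1), (-1 : ℝ) ^ k / phiN ℓ k *
      (Nat.card {A : Matrix (Fin k) (Fin k) (ZMod ℓ) //
        IsReal (OmB ℓ g) A ∧ d • A = A} : ℝ) := by
  classical
  letI : Fintype ((Fin g ⊕ Fin g → ZMod ℓ) →ₗ[ZMod ℓ] (Fin g ⊕ Fin g → ZMod ℓ)) :=
    Fintype.ofEquiv _ (Matrix.toLin' (R := ZMod ℓ) (m := Fin g ⊕ Fin g)
      (n := Fin g ⊕ Fin g)).toEquiv
  have hA := theoremA_card (OmB ℓ g) (OmB_nondeg ℓ g) (OmB_alt ℓ g) hd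
  have hfr : Module.finrank (ZMod ℓ) (Fin g ⊕ Fin g → ZMod ℓ) = 2 * g := by simp; ring
  rw [hfr, ZMod.card] at hA
  have e1 : Nat.card {M : (Fin g ⊕ Fin g → ZMod ℓ) →ₗ[ZMod ℓ] (Fin g ⊕ Fin g → ZMod ℓ) //
      ∀ x y, OmB ℓ g (M x) (M y) = d * OmB ℓ g x y} =
      Nat.card {M : Matrix (Fin g ⊕ Fin g) (Fin g ⊕ Fin g) (ZMod ℓ) // inGSp ℓ g d M} :=
    (Nat.card_congr (Matrix.toLin'.toEquiv.subtypeEquiv (fun M => inGSp_iff ℓ g hd M))).symm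
  have e2 : Nat.card {M : (Fin g ⊕ Fin g → ZMod ℓ) →ₗ[ZMod ℓ] (Fin g ⊕ Fin g → ZMod ℓ) //
      (∀ x y, OmB ℓ g (M x) (M y) = d * OmB ℓ g x y) ∧ ∀ x, M x = x → x = 0} =
      Nat.card {M : Matrix (Fin g ⊕ Fin g) (Fin g ⊕ Fin g) (ZMod ℓ) //
        inGSp ℓ g d M ∧ (M - 1).det ≠ 0} :=
    (Nat.card_congr (Matrix.toLin'.toEquiv.subtypeEquiv
      (fun M => by rw [inGSp_iff ℓ g hd M, det_sub_one_iff]; rfl))).symm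
  rw [e1, e2] at hA
  have e3 : Nat.card {M : Matrix (Fin g ⊕ Fin g) (Fin g ⊕ Fin g) (ZMod ℓ) // inGSp ℓ g d M} =
      Nat.card {M : Matrix (Fin g ⊕ Fin g) (Fin g ⊕ Fin g) (ZMod ℓ) //
        inGSp ℓ g d M ∧ (M - 1).det = 0} +
      Nat.card {M : Matrix (Fin g ⊕ Fin g) (Fin g ⊕ Fin g) (ZMod ℓ) //
        inGSp ℓ g d M ∧ (M - 1).det ≠ 0} := by
    simp only [Nat.card_eq_fintype_card, Fintype.card_subtype]
    rw [← Finset.filter_filter, ← Finset.filter_filter, Finset.card_filter_add_card_filter_not]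
  have hpos : 0 < Nat.card
      {M : Matrix (Fin g ⊕ Fin g) (Fin g ⊕ Fin g) (ZMod ℓ) // inGSp ℓ g d M} := by
    have : Nonempty {M : Matrix (Fin g ⊕ Fin g) (Fin g ⊕ Fin g) (ZMod ℓ) // inGSp ℓ g d M} := by
      refine ⟨⟨Matrix.fromBlocks 1 0 0 (d • 1), ?_, ?_⟩⟩
      · rw [Matrix.det_fromBlocks_zero₂₁]
        simp [hd]
      · rw [Om, Matrix.fromBlocks_transpose, Matrix.fromBlocks_multiply,
          Matrix.fromBlocks_multiply, Matrix.fromBlocks_smul]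
        simp
    exact Nat.card_pos
  rw [QGSp, div_eq_iff (by positivity), sub_mul, one_mul, ← hA, e3]
  push_cast
  ring

theorem card_real_ne {d : ZMod ℓ} (h1 : d ≠ 1) (k : ℕ) :
    Nat.card {A : Matrix (Fin k) (Fin k) (ZMod ℓ) // IsReal (OmB ℓ g) A ∧ d • A = A} =
      if k ≤ g then 1 else 0 := by
  classical
  rw [Nat.card_eq_fintype_card, Fintype.card_subtype]
  have hfr : Module.finrank (ZMod ℓ) (Fin g ⊕ Fin g → ZMod ℓ) = 2 * g := by simp; ring
  have h0 : ∀ A : Matrix (Fin k) (Fin k) (ZMod ℓ), d • A = A ↔ A = 0 := by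
    intro A
    constructor
    · intro h
      have : (d - 1) • A = 0 := by rw [sub_smul, h, one_smul, sub_self]
      rcases smul_eq_zero.1 this with h | h
      · exact absurd (sub_eq_zero.1 h) h1
      · exact h
    · rintro rfl; simp
  have halt : IsAltM (0 : Matrix (Fin k) (Fin k) (ZMod ℓ)) := ⟨by simp, by simp⟩
  split_ifs with h
  · rw [Finset.card_eq_one]
    refine ⟨0, ?_⟩
    ext A
    simp only [h0, isReal_iff (OmB ℓ g) (OmB_nondeg ℓ g) (OmB_alt ℓ g), Finset.mem_filter,
      Finset.mem_univ, true_and, Finset.mem_singleton]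
    refine ⟨fun h => h.2, ?_⟩
    rintro rfl
    refine ⟨⟨halt, ?_⟩, rfl⟩
    rw [corank_zero_matrix, hfr]; omega
  · rw [Finset.card_eq_zero, Finset.filter_eq_empty_iff]
    rintro A - ⟨hA, hA0⟩
    rw [h0] at hA0
    subst hA0
    rw [isReal_iff (OmB ℓ g) (OmB_nondeg ℓ g) (OmB_alt ℓ g), corank_zero_matrix, hfr] at hA
    omega

theorem card_real_one (k : ℕ) :
    Nat.card {A : Matrix (Fin k) (Fin k) (ZMod ℓ) //
      IsReal (OmB ℓ g) A ∧ (1 : ZMod ℓ) • A = A} =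
      ∑ s ∈ range (2 * g + 1), if k + s ≤ 2 * g then altN (ZMod ℓ) k s else 0 := by
  classical
  rw [Nat.card_eq_fintype_card, Fintype.card_subtype]
  have hfr : Module.finrank (ZMod ℓ) (Fin g ⊕ Fin g → ZMod ℓ) = 2 * g := by simp; ring
  simp only [isReal_iff (OmB ℓ g) (OmB_nondeg ℓ g) (OmB_alt ℓ g), one_smul, and_true, hfr]
  rw [Finset.card_eq_sum_card_fiberwise (f := corank) (t := range (2 * g + 1))]
  · apply Finset.sum_congr rfl
    intro s _
    rw [Finset.filter_filter]
    split_ifs with h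
    · rw [altN]
      congr 1
      ext A
      simp only [Finset.mem_filter, Finset.mem_univ, true_and]
      constructor
      · rintro ⟨⟨h1, h2⟩, h3⟩; exact ⟨h1, h3⟩
      · rintro ⟨h1, rfl⟩; exact ⟨⟨h1, h⟩, rfl⟩
    · rw [Finset.card_eq_zero, Finset.filter_eq_empty_iff]
      rintro A - ⟨⟨h1, h2⟩, rfl⟩
      exact h h2
  · intro A hA
    simp at hA ⊢
    omega

theorem QGSp_ne {d : ZMod ℓ} (hd : d ≠ 0) (h1 : d ≠ 1) : QGSp ℓ g d =
    1 - ∑ k ∈ range (g + 1), (-1 : ℝ) ^ k * (1 / phiN ℓ k) := by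
  rw [QGSp_eq ℓ g hd]
  simp_rw [card_real_ne ℓ g h1]
  congr 1
  symm
  apply Finset.sum_subset_zero_on_sdiff
  · intro x; simp; omega
  · intro x hx
    simp at hx
    rw [if_neg (by omega)]; simp
  · intro x hx
    simp at hx
    rw [if_pos (by omega)]; simp; rfl

theorem QGSp_one_aux : QGSp ℓ g 1 =
    1 - ∑ m ∈ range (g + 1), ∑ p ∈ antidiagonal m,
      ((-1 : ℝ) ^ p.1 / phiN ℓ p.1) * rhoN ℓ p.2 := by
  have hℓ : (1 : ℝ) < ℓ := by exact_mod_cast (Fact.out : ℓ.Prime).one_lt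
  rw [QGSp_eq ℓ g one_ne_zero]
  simp_rw [card_real_one ℓ g]
  congr 1
  simp_rw [Nat.cast_sum, Finset.mul_sum]
  rw [← Finset.sum_product', Finset.sum_sigma']
  symm
  apply Finset.sum_of_injOn (fun x : (Σ _ : ℕ, ℕ × ℕ) => (2 * x.2.2 + x.2.1, x.2.1))
  · rintro ⟨m, s, r⟩ hx ⟨m', s', r'⟩ hx' h
    simp at hx hx' h
    obtain ⟨hx, rfl⟩ := hx
    obtain ⟨hx', rfl⟩ := hx'
    obtain ⟨h1, rfl⟩ := h
    have : r = r' := by omega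
    subst this
    rfl
  · rintro ⟨m, s, r⟩ hx
    simp at hx ⊢
    omega
  · rintro ⟨k, s⟩ hx hx'
    split_ifs with h
    · rw [altN_eq_zero k s]
      · simp
      · by_contra! hh
        obtain ⟨⟨c, hc⟩, hh2⟩ := hh
        apply hx'
        refine ⟨⟨s + (c - s), s, c - s⟩, ?_, ?_⟩
        · simp
          omega
        · simp
          omega
    · simp
  · rintro ⟨m, s, r⟩ hx
    simp at hx
    simp only
    rw [if_pos (by omega), altN_closed (2 * r + s) r s rfl, ZMod.card]
    have h1 := (phiN_pos hℓ (2 * r + s)).ne'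
    have h2 := (phiN_pos hℓ s).ne'
    rw [pow_add, pow_mul]
    field_simp
    simp

end Symp

section CM

open PowerSeries in
theorem conv_rec {q : ℝ} (hq : 1 < q) (m : ℕ) :
    q ^ (2 * (m + 1)) * ∑ p ∈ antidiagonal (m + 1), ((-1 : ℝ) ^ p.1 / phiN q p.1) * rhoN q p.2 =
    (∑ p ∈ antidiagonal (m + 1), ((-1 : ℝ) ^ p.1 / phiN q p.1) * rhoN q p.2) -
      q * ∑ p ∈ antidiagonal m, ((-1 : ℝ) ^ p.1 / phiN q p.1) * rhoN q p.2 := by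
  set D : PowerSeries ℝ := PowerSeries.mk (fun s => (-1 : ℝ) ^ s / phiN q s) with hD
  set R : PowerSeries ℝ := PowerSeries.mk (fun s => rhoN q s) with hR
  have hc : ∀ m, ∑ p ∈ antidiagonal m, ((-1 : ℝ) ^ p.1 / phiN q p.1) * rhoN q p.2 =
      PowerSeries.coeff m (D * R) := by
    intro m
    simp [PowerSeries.coeff_mul, hD, hR]
  simp only [hc]
  have h1 : PowerSeries.rescale q D = (1 - PowerSeries.X) * D := by
    ext n
    rw [sub_mul, one_mul, map_sub, PowerSeries.coeff_rescale]
    cases n with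
    | zero => simp
    | succ n =>
      rw [PowerSeries.coeff_succ_X_mul]
      simp only [hD, PowerSeries.coeff_mk, phiN_succ]
      have h1 := (pow_sub_one_pos hq n).ne'
      have h0 := (phiN_pos hq n).ne'
      field_simp
      ring
  have h2 : R = (1 - PowerSeries.X) * PowerSeries.rescale (q ^ 2) R := by
    ext n
    rw [sub_mul, one_mul, map_sub]
    cases n with
    | zero => simp
    | succ n =>
      rw [PowerSeries.coeff_succ_X_mul]
      simp only [hR, PowerSeries.coeff_mk, PowerSeries.coeff_rescale, rhoN_succ]
      have h1 : q ^ (2 * n + 2) - 1 ≠ 0 := (pow_sub_one_pos hq (2 * n + 1)).ne'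
      field_simp
      ring
  have h3 : PowerSeries.rescale (q ^ 2) D =
      (1 - PowerSeries.C q * PowerSeries.X) * ((1 - PowerSeries.X) * D) := by
    rw [pow_two, PowerSeries.rescale_mul, RingHom.comp_apply, h1, map_mul, h1, map_sub, map_one,
      PowerSeries.rescale_X]
  have h4 : PowerSeries.rescale (q ^ 2) (D * R) =
      (1 - PowerSeries.C q * PowerSeries.X) * (D * R) := by
    rw [map_mul, h3]
    conv_rhs => rw [h2]
    ring
  have h5 := congrArg (PowerSeries.coeff (m + 1)) h4
  rw [PowerSeries.coeff_rescale, sub_mul, one_mul, map_sub, mul_assoc, PowerSeries.coeff_C_mul,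
    PowerSeries.coeff_succ_X_mul, ← pow_mul] at h5
  exact h5

theorem conv_closed {q : ℝ} (hq : 1 < q) (m : ℕ) :
    ∑ p ∈ antidiagonal m, ((-1 : ℝ) ^ p.1 / phiN q p.1) * rhoN q p.2 =
      (-1 : ℝ) ^ m * (q ^ m / phiN (q ^ 2) m) := by
  induction m with
  | zero => simp [phiN, rhoN]
  | succ m ih =>
    have h := conv_rec hq m
    rw [ih] at h
    have hq2 : 1 < q ^ 2 := by nlinarith
    have h1 : (q ^ 2) ^ (m + 1) - 1 ≠ 0 := (pow_sub_one_pos hq2 m).ne'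
    have h0 := (phiN_pos hq2 m).ne'
    rw [phiN_succ]
    have : (∑ p ∈ antidiagonal (m + 1), ((-1 : ℝ) ^ p.1 / phiN q p.1) * rhoN q p.2) *
      ((q ^ 2) ^ (m + 1) - 1) = - (q * ((-1 : ℝ) ^ m * (q ^ m / phiN (q ^ 2) m))) := by
      rw [← pow_mul]; linarith
    rw [eq_div_of_mul_eq h1 this]
    field_simp
    ring

end CM

section Euler

theorem euler_summable {q : ℝ} (hq : 1 < q) (z : ℝ) : Summable (fun k => z ^ k / phiN q k) := by
  by_cases hz : z = 0
  · subst hz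
    apply summable_of_ne_finset_zero (s := {0})
    intro b hb
    rw [zero_pow (by simpa using hb), zero_div]
  · apply summable_of_ratio_test_tendsto_lt_one (l := 0) one_pos
    · exact Filter.Eventually.of_forall
        (fun n => div_ne_zero (pow_ne_zero _ hz) (phiN_pos hq n).ne')
    · have h1 : ∀ n, ‖z ^ (n + 1) / phiN q (n + 1)‖ / ‖z ^ n / phiN q n‖ =
          |z| / (q ^ (n + 1) - 1) := by
        intro n
        rw [phiN_succ]
        have h1 := pow_sub_one_pos hq n
        have h0 := phiN_pos hq n
        simp only [norm_div, norm_mul, norm_pow, Real.norm_eq_abs, abs_of_pos h1, abs_of_pos h0]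
        have : |z| ≠ 0 := abs_ne_zero.2 hz
        field_simp
        ring
      simp_rw [h1]
      apply Tendsto.const_div_atTop
      exact tendsto_atTop_add_const_right _ (-1 : ℝ)
        ((tendsto_pow_atTop_atTop_of_one_lt hq).comp (tendsto_add_atTop_nat 1))

/-- Euler's series `∑ (-z)^k / ∏_{i ≤ k} (q^i - 1)`. -/
noncomputable def eulerF (q z : ℝ) : ℝ := ∑' k : ℕ, (-1 : ℝ) ^ k * (z ^ k / phiN q k)

theorem euler_summable_alt {q : ℝ} (hq : 1 < q) (z : ℝ) :
    Summable (fun k => (-1 : ℝ) ^ k * (z ^ k / phiN q k)) := by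
  have := euler_summable hq (-z)
  refine this.congr (fun k => ?_)
  rw [neg_pow, mul_div_assoc]

theorem eulerF_mul {q : ℝ} (hq : 1 < q) (z : ℝ) : eulerF q (q * z) = (1 - z) * eulerF q z := by
  have hs := euler_summable_alt hq
  have h : eulerF q (q * z) - eulerF q z = - z * eulerF q z := by
    unfold eulerF
    rw [← (hs (q * z)).tsum_sub (hs z), ← tsum_mul_left,
      ((hs (q * z)).sub (hs z)).tsum_eq_zero_add]
    simp only [pow_zero, sub_self, zero_add]
    apply tsum_congr
    intro k
    rw [phiN_succ]
    have h1 := (pow_sub_one_pos hq k).ne'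
    have h0 := (phiN_pos hq k).ne'
    field_simp
    ring
  linarith

theorem eulerF_prod {q : ℝ} (hq : 1 < q) (z : ℝ) (N : ℕ) :
    eulerF q z = (∏ j ∈ range N, (1 - z / q ^ (j + 1))) * eulerF q (z / q ^ N) := by
  induction N with
  | zero => simp
  | succ N ih =>
    rw [ih, Finset.prod_range_succ, mul_assoc, ← eulerF_mul hq]
    congr 2
    have : q ≠ 0 := by positivity
    field_simp
    ring

theorem eulerF_tendsto {q : ℝ} (hq : 1 < q) (z : ℝ) :
    Tendsto (fun N : ℕ => eulerF q (z / q ^ N)) atTop (nhds 1) := by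
  have h1 : (1 : ℝ) = ∑' k : ℕ, if k = 0 then 1 else 0 := by simp
  rw [h1]
  unfold eulerF
  apply tendsto_tsum_of_dominated_convergence (euler_summable hq |z|)
  · intro k
    have hz : Tendsto (fun N : ℕ => z / q ^ N) atTop (nhds 0) :=
      Tendsto.const_div_atTop (tendsto_pow_atTop_atTop_of_one_lt hq) _
    have := ((hz.pow k).div_const (phiN q k)).const_mul ((-1 : ℝ) ^ k)
    convert this using 2
    split_ifs with hk
    · subst hk
      simp [phiN]
    · rw [zero_pow hk]; simp
  · refine Filter.Eventually.of_forall (fun N k => ?_)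
    rw [norm_mul, norm_pow, norm_neg, norm_one, one_pow, one_mul, norm_div, norm_pow,
      Real.norm_of_nonneg (phiN_pos hq k).le]
    have h0 := phiN_pos hq k
    gcongr
    rw [norm_div, norm_pow, Real.norm_eq_abs, Real.norm_eq_abs]
    apply div_le_self (abs_nonneg _)
    apply one_le_pow₀
    rw [abs_of_pos (by linarith)]
    exact hq.le

theorem eulerF_eq {q : ℝ} (hq : 1 < q) (z : ℝ) :
    Tendsto (fun N : ℕ => ∏ j ∈ range N, (1 - z / q ^ (j + 1))) atTop (nhds (eulerF q z)) := by
  have h := eulerF_tendsto hq z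
  have h2 : Tendsto (fun N : ℕ => eulerF q z / eulerF q (z / q ^ N)) atTop
      (nhds (eulerF q z / 1)) := tendsto_const_nhds.div h one_ne_zero
  rw [div_one] at h2
  refine h2.congr' ?_
  filter_upwards [h.eventually_ne one_ne_zero] with N hN
  rw [div_eq_iff hN]
  exact eulerF_prod hq z N

theorem inv_summable {q : ℝ} (hq : 1 < q) : Summable (fun j : ℕ => (q ^ (j + 1))⁻¹) := by
  have h := summable_geometric_of_lt_one (r := q⁻¹) (by positivity) (inv_lt_one_of_one_lt₀ hq)
  have := (summable_nat_add_iff 1).2 h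
  refine this.congr (fun k => ?_)
  rw [inv_pow]

theorem inv_pow_lt_one' {q : ℝ} (hq : 1 < q) (j : ℕ) : (q ^ (j + 1))⁻¹ < 1 := by
  apply inv_lt_one_of_one_lt₀
  exact one_lt_pow₀ hq (by omega)

theorem prodA {q : ℝ} (hq : 1 < q) :
    Tendsto (fun N : ℕ => ∏ j ∈ range N, (1 - (q ^ (j + 1))⁻¹)) atTop
      (nhds (∏' j : ℕ, (1 - (q ^ (j + 1))⁻¹))) := by
  have := Real.multipliable_one_add_of_summable (inv_summable hq).neg
  simp only [← sub_eq_add_neg] at this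
  exact this.hasProd.tendsto_prod_nat

theorem prodA_ne {q : ℝ} (hq : 1 < q) : ∏' j : ℕ, (1 - (q ^ (j + 1))⁻¹) ≠ 0 := by
  have := tprod_one_add_ne_zero_of_summable (f := fun j : ℕ => - (q ^ (j + 1))⁻¹)
    (fun j => by have := inv_pow_lt_one' hq j; linarith) (inv_summable hq).neg.norm
  simpa only [← sub_eq_add_neg] using this

theorem prodC {q : ℝ} (hq : 1 < q) :
    Tendsto (fun N : ℕ => ∏ j ∈ range N, (1 + (q ^ (j + 1))⁻¹)⁻¹) atTop
      (nhds (∏' j : ℕ, (1 + (q ^ (j + 1))⁻¹)⁻¹)) := by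
  have hs : Summable (fun j : ℕ => - ((q ^ (j + 1))⁻¹ / (1 + (q ^ (j + 1))⁻¹))) := by
    apply Summable.neg
    apply Summable.of_nonneg_of_le _ _ (inv_summable hq)
    · intro j; positivity
    · intro j
      apply div_le_self (by positivity)
      have : 0 < (q ^ (j + 1))⁻¹ := by positivity
      linarith
  have := Real.multipliable_one_add_of_summable hs
  have h2 : ∀ j : ℕ, 1 + - ((q ^ (j + 1))⁻¹ / (1 + (q ^ (j + 1))⁻¹)) = (1 + (q ^ (j + 1))⁻¹)⁻¹ := by
    intro j
    have : 0 < 1 + (q ^ (j + 1))⁻¹ := by positivity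
    field_simp
    ring
  simp only [h2] at this
  exact this.hasProd.tendsto_prod_nat

theorem euler_fin {q : ℝ} (hq : 1 < q) (N : ℕ) :
    ∏ j ∈ range (2 * N), (1 - (q ^ (j + 1))⁻¹) =
      (∏ j ∈ range N, (1 - q / (q ^ 2) ^ (j + 1))) * (∏ j ∈ range N, (1 - (q ^ (j + 1))⁻¹)) *
      ∏ j ∈ range N, (1 + (q ^ (j + 1))⁻¹) := by
  induction N with
  | zero => simp
  | succ N ih =>
    rw [show 2 * (N + 1) = 2 * N + 1 + 1 by ring, Finset.prod_range_succ, Finset.prod_range_succ,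
      ih, Finset.prod_range_succ, Finset.prod_range_succ, Finset.prod_range_succ]
    have h1 : (q ^ (2 * N + 1))⁻¹ = q / (q ^ 2) ^ (N + 1) := by
      have : q ≠ 0 := by positivity
      field_simp
      ring
    have h2 : (q ^ (2 * N + 1 + 1))⁻¹ = (q ^ (N + 1))⁻¹ * (q ^ (N + 1))⁻¹ := by
      rw [← mul_inv, ← pow_add]
      congr 2
      ring
    rw [h1, h2]
    ring

theorem eulerF_one {q : ℝ} (hq : 1 < q) : eulerF q 1 = ∏' j : ℕ, (1 - (q ^ (j + 1))⁻¹) := by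
  have h := eulerF_eq hq 1
  simp only [one_div] at h
  exact tendsto_nhds_unique h (prodA hq)

theorem eulerF_two {q : ℝ} (hq : 1 < q) :
    eulerF (q ^ 2) q = ∏' j : ℕ, (1 + (q ^ (j + 1))⁻¹)⁻¹ := by
  have hq2 : 1 < q ^ 2 := one_lt_pow₀ hq (by norm_num)
  have hB := eulerF_eq hq2 q
  have hA := prodA hq
  have hA2 := hA.comp (tendsto_id.const_mul_atTop' (two_pos : (0 : ℕ) < 2))
  have hC := prodC hq
  have hm := (hA2.mul hC)
  have hm2 := hB.mul hA
  have he : eulerF (q ^ 2) q * ∏' j : ℕ, (1 - (q ^ (j + 1))⁻¹) =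
      (∏' j : ℕ, (1 - (q ^ (j + 1))⁻¹)) * ∏' j : ℕ, (1 + (q ^ (j + 1))⁻¹)⁻¹ := by
    refine tendsto_nhds_unique hm2 (hm.congr (fun N => ?_))
    simp only [Function.comp_apply, id]
    rw [euler_fin hq, Finset.prod_inv_distrib]
    have : ∏ j ∈ range N, (1 + (q ^ (j + 1))⁻¹) ≠ 0 := by
      apply ne_of_gt
      apply Finset.prod_pos
      intro j _
      positivity
    field_simp
  rw [mul_comm] at he
  exact mul_left_cancel₀ (prodA_ne hq) he

end Euler

section Alternating

theorem alt_strict {f : ℕ → ℝ} {L : ℝ} (hf : StrictAnti f)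
    (h : Tendsto (fun n => ∑ i ∈ range n, (-1 : ℝ) ^ i * f i) atTop (nhds L)) (g : ℕ) :
    0 < (-1 : ℝ) ^ g * ((∑ i ∈ range (g + 1), (-1 : ℝ) ^ i * f i) - L) := by
  have hlt : f (g + 2) < f (g + 1) := hf (by omega)
  rcases Nat.even_or_odd' g with ⟨k, rfl | rfl⟩
  · have h1 := Antitone.tendsto_le_alternating_series h hf.antitone (k + 1)
    rw [show 2 * (k + 1) + 1 = 2 * k + 1 + 1 + 1 by ring, Finset.sum_range_succ,
      Finset.sum_range_succ] at h1
    have e1 : (-1 : ℝ) ^ (2 * k) = 1 := by simp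
    have e2 : (-1 : ℝ) ^ (2 * k + 1) = -1 := by rw [pow_succ, e1]; ring
    have e3 : (-1 : ℝ) ^ (2 * k + 1 + 1) = 1 := by rw [pow_succ, e2]; ring
    rw [e2, e3] at h1
    rw [e1]
    linarith
  · have h1 := Antitone.alternating_series_le_tendsto h hf.antitone (k + 2)
    rw [show 2 * (k + 2) = 2 * k + 1 + 1 + 1 + 1 by ring, Finset.sum_range_succ,
      Finset.sum_range_succ] at h1
    have e1 : (-1 : ℝ) ^ (2 * k) = 1 := by simp
    have e2 : (-1 : ℝ) ^ (2 * k + 1) = -1 := by rw [pow_succ, e1]; ring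
    have e3 : (-1 : ℝ) ^ (2 * k + 1 + 1) = 1 := by rw [pow_succ, e2]; ring
    have e4 : (-1 : ℝ) ^ (2 * k + 1 + 1 + 1) = -1 := by rw [pow_succ, e3]; ring
    rw [e3, e4] at h1
    rw [e2]
    linarith

theorem euler_anti {q z : ℝ} (hz : 0 < z) (hzq : z < q - 1) :
    StrictAnti (fun k => z ^ k / phiN q k) := by
  have hq : 1 < q := by linarith
  apply strictAnti_nat_of_succ_lt
  intro k
  rw [phiN_succ]
  have h0 := phiN_pos hq k
  have h1 : z < q ^ (k + 1) - 1 := by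
    have : q ≤ q ^ (k + 1) := le_self_pow₀ hq.le (by omega)
    linarith
  have h2 := pow_sub_one_pos hq k
  rw [pow_succ, mul_div_mul_comm]
  have h3 : 0 < z ^ k / phiN q k := by positivity
  have h4 : z / (q ^ (k + 1) - 1) < 1 := (div_lt_one h2).2 h1
  nlinarith

theorem final_aux {Q : ℕ → ℝ} {q z : ℝ} (hz : 0 < z) (hzq : z < q - 1)
    (hQ : ∀ g, Q g = 1 - ∑ k ∈ range (g + 1), (-1 : ℝ) ^ k * (z ^ k / phiN q k)) :
    Tendsto Q atTop (nhds (1 - eulerF q z)) ∧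
    Tendsto (fun g => (1 - eulerF q z) - Q g) atTop (nhds 0) ∧
    ∀ g : ℕ, 0 < (-1 : ℝ) ^ g * ((1 - eulerF q z) - Q g) := by
  have hq : 1 < q := by linarith
  have hs := (euler_summable_alt hq z).hasSum.tendsto_sum_nat
  have h1 : Tendsto Q atTop (nhds (1 - eulerF q z)) := by
    have := (hs.comp (tendsto_add_atTop_nat 1)).const_sub 1
    refine this.congr (fun g => ?_)
    rw [hQ]
    rfl
  refine ⟨h1, ?_, ?_⟩
  · have := h1.const_sub (1 - eulerF q z)
    rwa [sub_self] at this
  · intro g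
    have := alt_strict (euler_anti hz hzq) hs g
    rw [hQ]
    convert this using 2
    rw [eulerF]
    ring

end Alternating

theorem stmt8 (q ℓ : ℕ) (hq : IsPrimePow q) (hℓ : ℓ.Prime) (hnd : ¬ ℓ ∣ q) :
    (ℓ ∣ q - 1 →
      Tendsto (fun g : ℕ => QGSp ℓ g (q : ZMod ℓ)) atTop
        (nhds (1 - ∏' j : ℕ, (1 + ((ℓ : ℝ) ^ (j + 1))⁻¹)⁻¹)) ∧
      Tendsto
        (fun g : ℕ => (1 - ∏' j : ℕ, (1 + ((ℓ : ℝ) ^ (j + 1))⁻¹)⁻¹) - QGSp ℓ g (q : ZMod ℓ))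
        atTop (nhds 0) ∧
      ∀ g : ℕ,
        0 < (-1 : ℝ) ^ g *
          ((1 - ∏' j : ℕ, (1 + ((ℓ : ℝ) ^ (j + 1))⁻¹)⁻¹) - QGSp ℓ g (q : ZMod ℓ))) ∧
    (¬ ℓ ∣ q - 1 →
      Tendsto (fun g : ℕ => QGSp ℓ g (q : ZMod ℓ)) atTop
        (nhds (1 - ∏' j : ℕ, (1 - ((ℓ : ℝ) ^ (j + 1))⁻¹))) ∧
      Tendsto
        (fun g : ℕ => (1 - ∏' j : ℕ, (1 - ((ℓ : ℝ) ^ (j + 1))⁻¹)) - QGSp ℓ g (q : ZMod ℓ))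
        atTop (nhds 0) ∧
      ∀ g : ℕ,
        0 < (-1 : ℝ) ^ g *
          ((1 - ∏' j : ℕ, (1 - ((ℓ : ℝ) ^ (j + 1))⁻¹)) - QGSp ℓ g (q : ZMod ℓ))) := by
  haveI : Fact ℓ.Prime := ⟨hℓ⟩
  have hℓ2 : (2 : ℝ) ≤ ℓ := by exact_mod_cast hℓ.two_le
  have hℓ1 : (1 : ℝ) < ℓ := by linarith
  have hq1 : 1 ≤ q := hq.pos
  have hd : (q : ZMod ℓ) ≠ 0 := by
    rwa [Ne, ZMod.natCast_eq_zero_iff]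
  have hone : (q : ZMod ℓ) = 1 ↔ ℓ ∣ q - 1 := by
    rw [← ZMod.natCast_eq_zero_iff, Nat.cast_sub hq1, Nat.cast_one, sub_eq_zero]
  constructor
  · intro h
    rw [← eulerF_two hℓ1, hone.2 h]
    apply final_aux (by linarith) (by nlinarith)
    intro g
    rw [QGSp_one_aux]
    simp_rw [conv_closed hℓ1]
  · intro h
    have hne : (q : ZMod ℓ) ≠ 1 := fun h1 => h (hone.1 h1)
    have hℓ3 : (3 : ℝ) ≤ ℓ := by
      have : ℓ ≠ 2 := by
        rintro rfl
        omega
      have := hℓ.two_le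
      have : 3 ≤ ℓ := by omega
      exact_mod_cast this
    rw [← eulerF_one hℓ1]
    apply final_aux one_pos (by linarith)
    intro g
    rw [QGSp_ne ℓ g hd hne]
    simp
end

section
/- Let $q$ be a prime power, $\ell$ a prime not dividing $q$ with $q \not\equiv 1 \bmod \ell$, let $r \ge 1$ and $d \in \{0,\dots,2r\}$. Let $S(q,\ell,r,d)$ be the set of matrices $M \in \mathrm{GSp}_{2r}^{(q \bmod \ell)}(\mathbb{F}_\ell)$ with characteristic polynomial $(x-1)^r(x-q)^r$ and $\dim \ker(M - I) = d$, and let $S_{\mathrm{GL}}(\ell,r,d)$ be the set of matrices $M \in \mathrm{GL}_r(\mathbb{F}_\ell)$ with characteristic polynomial $(x-1)^r$ and $\dim \ker(M - I) = d$. Then $\#S(q,\ell,r,d) \cdot \#\mathrm{GL}_r(\mathbb{F}_\ell) = \#\mathrm{Sp}_{2r}(\mathbb{F}_\ell) \cdot \#S_{\mathrm{GL}}(\ell,r,d)$. -/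
open Matrix Finset Filter

/-- `#GL_n(F_ℓ)`. -/
noncomputable def cardGL (ℓ n : ℕ) : ℕ :=
  Nat.card {M : Matrix (Fin n) (Fin n) (ZMod ℓ) // IsUnit M.det}

/-- `#Sp_{2r}(F_ℓ) = #GSp_{2r}^{(1)}(F_ℓ)`. -/
noncomputable def cardSp (ℓ r : ℕ) : ℕ :=
  Nat.card {M : Matrix (Fin r ⊕ Fin r) (Fin r ⊕ Fin r) (ZMod ℓ) // inGSp ℓ r 1 M}

theorem nil_iff_charpoly {K : Type} [Field K] {n : Type} [Fintype n] [DecidableEq n]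
    (A : Matrix n n K) (c : K) :
    IsNilpotent (A - Matrix.scalar n c) ↔
      A.charpoly = (Polynomial.X - Polynomial.C c) ^ Fintype.card n := by
  have h1 : IsNilpotent (A - Matrix.scalar n c) ↔
      (A - Matrix.scalar n c).charpoly = Polynomial.X ^ Fintype.card n := by
    have := LinearMap.isNilpotent_iff_charpoly (Matrix.toLin' (A - Matrix.scalar n c))
    rw [Matrix.charpoly_toLin', Module.finrank_fintype_fun_eq_card] at this
    rw [← this]
    exact (IsNilpotent.map_iff (f := Matrix.toLinAlgEquiv' (R := K) (n := n))
      (Matrix.toLinAlgEquiv' (R := K) (n := n)).injective).symm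
  rw [h1, Matrix.charpoly_sub_scalar]
  constructor
  · intro h
    have := congrArg (fun p => p.comp (Polynomial.X - Polynomial.C c)) h
    simpa [Polynomial.comp_assoc] using this
  · intro h
    rw [h]; simp

/-- If `A b B = q b` with `A, B` unipotent and `q ≠ 1`, then `b = 0`. -/
theorem sylv_zero {K : Type} [Field K] {n : Type} [Fintype n] [DecidableEq n]
    (A B b : Matrix n n K) (q : K) (hq : q ≠ 1) (hA : IsNilpotent (A - 1))
    (hB : IsNilpotent (B - 1)) (h : A * b * B = q • b) : b = 0 := by
  have hL : IsNilpotent (LinearMap.mulLeft K (A - 1)) := by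
    rwa [LinearMap.isNilpotent_mulLeft_iff]
  have hR : IsNilpotent (LinearMap.mulRight K (B - 1)) := by
    rwa [LinearMap.isNilpotent_mulRight_iff]
  have hc1 := LinearMap.commute_mulLeft_right (R := K) (A - 1) B
  have h1 : IsNilpotent (LinearMap.mulLeft K (A - 1) * LinearMap.mulRight K B) :=
    hc1.isNilpotent_mul_right hL
  have hc2 : Commute (LinearMap.mulLeft K (A - 1) * LinearMap.mulRight K B)
      (LinearMap.mulRight K (B - 1)) := by
    apply Commute.mul_left
    · exact LinearMap.commute_mulLeft_right _ _
    · ext1 x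
      simp [mul_sub, sub_mul, mul_assoc]
  obtain ⟨k, hk⟩ := hc2.isNilpotent_add h1 hR
  set N := LinearMap.mulLeft K (A - 1) * LinearMap.mulRight K B + LinearMap.mulRight K (B - 1)
  have hN : N b = (q - 1) • b := by
    simp only [N, LinearMap.add_apply, Module.End.mul_apply, LinearMap.mulLeft_apply,
      LinearMap.mulRight_apply]
    rw [sub_smul, one_smul, ← h]; noncomm_ring
  have hNk : ∀ k : ℕ, (N ^ k) b = (q - 1) ^ k • b := by
    intro k
    induction k with
    | zero => simp
    | succ k ih => rw [pow_succ, Module.End.mul_apply, hN, map_smul, ih, smul_smul, ← pow_succ']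
  have := hNk k
  rw [hk] at this
  have h0 := this.symm
  simpa [sub_eq_zero, hq] using h0

theorem isUnit_det_of_unip {K : Type} [Field K] {n : Type} [Fintype n] [DecidableEq n]
    (A : Matrix n n K) (hA : IsNilpotent (A - 1)) : IsUnit A.det := by
  rw [← Matrix.isUnit_iff_isUnit_det]
  have := hA.isUnit_add_one
  simpa using this

theorem isUnit_det_sub {K : Type} [Field K] {n : Type} [Fintype n] [DecidableEq n]
    (A : Matrix n n K) (hA : IsNilpotent (A - 1)) (q : K) (hq : q ≠ 1) :
    IsUnit (A - Matrix.scalar n q).det := by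
  rw [← Matrix.isUnit_iff_isUnit_det]
  have hu : IsUnit (Matrix.scalar n (1 - q)) := by
    apply IsUnit.map
    exact (sub_ne_zero.mpr hq.symm).isUnit
  have := hA.isUnit_add_left_of_commute hu (Matrix.scalar_commute _ (fun _ => Commute.all _ _) _).symm
  convert this using 1
  rw [map_sub, map_one]; abel

theorem unip_inv {K : Type} [Field K] {n : Type} [Fintype n] [DecidableEq n]
    (A : Matrix n n K) (hA : IsNilpotent (A - 1)) : IsNilpotent (A⁻¹ - 1) := by
  have hu := isUnit_det_of_unip A hA
  have : A⁻¹ - 1 = A⁻¹ * (-(A - 1)) := by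
    rw [mul_neg, mul_sub, Matrix.nonsing_inv_mul _ hu]; simp
  rw [this]
  apply Commute.isNilpotent_mul_left
  · show _ * _ = _ * _
    rw [mul_neg, mul_sub, Matrix.nonsing_inv_mul _ hu, neg_mul, sub_mul,
      Matrix.mul_nonsing_inv _ hu]; simp
  · exact hA.neg

theorem unip_transpose {K : Type} [Field K] {n : Type} [Fintype n] [DecidableEq n]
    (A : Matrix n n K) (hA : IsNilpotent (A - 1)) : IsNilpotent (Aᵀ - 1) := by
  obtain ⟨k, hk⟩ := hA
  refine ⟨k, ?_⟩
  have := congrArg Matrix.transpose hk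
  simpa [Matrix.transpose_pow] using this

theorem exists_gen_basis {K : Type} [Field K] {n : Type} [Fintype n] [DecidableEq n]
    (M : Matrix n n K) (μ : K) (r : ℕ) (hr : M.charpoly.rootMultiplicity μ = r) :
    ∃ (P : Matrix n (Fin r) K) (A : Matrix (Fin r) (Fin r) K),
      M * P = P * A ∧ (∀ x, P *ᵥ x = 0 → x = 0) ∧
      (∀ x, P *ᵥ x ∈ Module.End.maxGenEigenspace (Matrix.toLin' M) μ) ∧
      IsNilpotent (A - Matrix.scalar _ μ) := by
  set f : Module.End K (n → K) := Matrix.toLin' M with hf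
  set W := f.maxGenEigenspace μ with hWdef
  have hW : Module.finrank K W = r := by
    rw [hWdef, LinearMap.finrank_maxGenEigenspace_eq, hf, Matrix.charpoly_toLin', hr]
  let b : Module.Basis (Fin r) K W := Module.finBasisOfFinrankEq K W hW
  have hmaps : Set.MapsTo f W W := Module.End.mapsTo_maxGenEigenspace_of_comm rfl μ
  let g : Module.End K W := f.restrict hmaps
  let P : Matrix n (Fin r) K := Matrix.of fun i j => (b j : n → K) i
  have hP : ∀ x, P *ᵥ x = ((b.equivFun.symm x : W) : n → K) := by
    intro x
    rw [Module.Basis.equivFun_symm_apply]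
    ext i
    simp [P, Matrix.mulVec, dotProduct, mul_comm]
  refine ⟨P, LinearMap.toMatrix b b g, ?_, ?_, ?_, ?_⟩
  · apply Matrix.toLin'.injective
    apply LinearMap.ext
    intro x
    rw [Matrix.toLin'_mul, Matrix.toLin'_mul, LinearMap.comp_apply, LinearMap.comp_apply,
      Matrix.toLin'_apply P, Matrix.toLin'_apply P, hP, hP, Matrix.toLin'_apply, Matrix.toLin'_apply]
    have h1 : b.equivFun.symm (LinearMap.toMatrix b b g *ᵥ x) = g (b.equivFun.symm x) := by
      rw [LinearEquiv.symm_apply_eq]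
      have := LinearMap.toMatrix_mulVec_repr b b g (b.equivFun.symm x)
      rw [Module.Basis.equivFun_apply, ← this]
      congr 1
      exact (b.equivFun.apply_symm_apply x).symm
    rw [h1]
    rfl
  · intro x hx
    rw [hP] at hx
    have h0 : b.equivFun.symm x = 0 := Subtype.ext hx
    exact (LinearEquiv.map_eq_zero_iff _).1 h0
  · intro x
    rw [hP]; exact (b.equivFun.symm x).2
  · have h1 := Module.End.isNilpotent_restrict_maxGenEigenspace_sub_algebraMap f μ
    have h2 := h1.map (LinearMap.toMatrixAlgEquiv b)
    have h3 : ((f - algebraMap K (Module.End K (n → K)) μ).restrict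
        (Module.End.mapsTo_maxGenEigenspace_of_comm (Algebra.mul_sub_algebraMap_commutes f μ) μ) :
          Module.End K W) = g - algebraMap K (Module.End K W) μ := by
      ext x
      rfl
    have h4 : LinearMap.toMatrix b b g - Matrix.scalar (Fin r) μ =
        LinearMap.toMatrixAlgEquiv b (g - algebraMap K (Module.End K W) μ) := by
      have h5 := map_sub (LinearMap.toMatrixAlgEquiv b) g (algebraMap K (Module.End K W) μ)
      rw [AlgEquiv.commutes] at h5
      exact h5.symm
    rw [h4, ← h3]
    exact h2

theorem fixdim_conj {K : Type} [Field K] {n : Type} [Fintype n] [DecidableEq n]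
    (M g D : Matrix n n K) (hg : IsUnit g.det) (h : M * g = g * D) : fixdim M = fixdim D := by
  have h1 := LinearMap.finrank_range_add_finrank_ker (M - 1).mulVecLin
  have h2 := LinearMap.finrank_range_add_finrank_ker (D - 1).mulVecLin
  have e : (M - 1) * g = g * (D - 1) := by rw [sub_mul, mul_sub, h]; simp
  have h3 := Matrix.rank_mul_eq_left_of_isUnit_det g (M - 1) hg
  have h4 := Matrix.rank_mul_eq_right_of_isUnit_det g (D - 1) hg
  rw [e, h4] at h3
  unfold Matrix.rank at h3
  unfold fixdim
  omega

theorem fixdim_block {K : Type} [Field K] {m n : Type} [Fintype n] [DecidableEq n]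
    [Fintype m] [DecidableEq m]
    (A : Matrix m m K) (T : Matrix n n K) (hT : IsUnit (T - 1).det) :
    fixdim (Matrix.fromBlocks A 0 0 T) = fixdim A := by
  have e : Matrix.fromBlocks A 0 0 T - 1 = Matrix.fromBlocks (A - 1) 0 0 (T - 1) := by
    rw [← Matrix.fromBlocks_one, sub_eq_add_neg, Matrix.fromBlocks_neg, Matrix.fromBlocks_add]
    simp [sub_eq_add_neg]
  have hinj : ∀ y, (T - 1) *ᵥ y = 0 → y = 0 := by
    intro y hy
    have := congrArg (fun v => (T - 1)⁻¹ *ᵥ v) hy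
    simpa [Matrix.nonsing_inv_mul _ hT] using this
  have key : ∀ v, (Matrix.fromBlocks A 0 0 T - 1) *ᵥ v = 0 ↔
      (A - 1) *ᵥ (v ∘ Sum.inl) = 0 ∧ v ∘ Sum.inr = 0 := by
    intro v
    rw [e, Matrix.fromBlocks_mulVec]
    constructor
    · intro h
      have h1 := congrArg (fun v => v ∘ Sum.inl) h
      have h2 := congrArg (fun v => v ∘ Sum.inr) h
      simp at h1 h2
      exact ⟨h1, hinj _ h2⟩
    · rintro ⟨h1, h2⟩
      rw [h1, h2]; simp
  unfold fixdim
  apply LinearEquiv.finrank_eq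
  refine LinearEquiv.ofBijective
    ((LinearMap.funLeft K K Sum.inl).restrict
      (p := LinearMap.ker (Matrix.fromBlocks A 0 0 T - 1).mulVecLin)
      (q := LinearMap.ker (A - 1).mulVecLin) ?_) ⟨?_, ?_⟩
  · intro v hv
    exact ((key v).1 hv).1
  · rw [← LinearMap.ker_eq_bot, LinearMap.ker_eq_bot']
    rintro ⟨v, hv⟩ h
    have h1 : v ∘ Sum.inl = 0 := congrArg Subtype.val h
    have h2 := ((key v).1 hv).2
    ext i
    rcases i with i | i
    · exact congrFun h1 i
    · exact congrFun h2 i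
  · rintro ⟨w, hw⟩
    refine ⟨⟨Sum.elim w 0, (key _).2 ⟨?_, ?_⟩⟩, ?_⟩
    · exact hw
    · simp
    · apply Subtype.ext
      ext i
      rfl

theorem Om_sq (ℓ r : ℕ) : Om ℓ r * Om ℓ r = -1 := by
  unfold Om
  rw [Matrix.fromBlocks_multiply, ← Matrix.fromBlocks_one, Matrix.fromBlocks_neg]
  simp

theorem Om_transpose (ℓ r : ℕ) : (Om ℓ r)ᵀ = -Om ℓ r := by
  unfold Om
  rw [Matrix.fromBlocks_transpose, Matrix.fromBlocks_neg]
  simp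

theorem isUnit_det_of_sim {ℓ r : ℕ} [Fact ℓ.Prime] {c : ZMod ℓ} (hc : c ≠ 0)
    {g : Matrix (Fin r ⊕ Fin r) (Fin r ⊕ Fin r) (ZMod ℓ)}
    (h : gᵀ * Om ℓ r * g = c • Om ℓ r) : IsUnit g.det := by
  apply Matrix.isUnit_det_of_left_inverse (B := -(c⁻¹ • (Om ℓ r * (gᵀ * Om ℓ r))))
  rw [neg_mul, Matrix.smul_mul, Matrix.mul_assoc (Om ℓ r), h, Matrix.mul_smul, Om_sq, smul_smul,
    inv_mul_cancel₀ hc]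
  simp

/-- The block-diagonal matrix `diag(A, q A^{-T})`. -/
noncomputable def Dm {ℓ r : ℕ} (q : ZMod ℓ) (A : Matrix (Fin r) (Fin r) (ZMod ℓ)) :
    Matrix (Fin r ⊕ Fin r) (Fin r ⊕ Fin r) (ZMod ℓ) :=
  Matrix.fromBlocks A 0 0 (q • (A⁻¹)ᵀ)

theorem Dm_sim {ℓ r : ℕ} [Fact ℓ.Prime] (q : ZMod ℓ) (A : Matrix (Fin r) (Fin r) (ZMod ℓ))
    (hA : IsUnit A.det) : (Dm q A)ᵀ * Om ℓ r * Dm q A = q • Om ℓ r := by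
  have h1 : Aᵀ * (A⁻¹)ᵀ = 1 := by
    rw [← Matrix.transpose_mul, Matrix.nonsing_inv_mul _ hA, Matrix.transpose_one]
  unfold Dm Om
  rw [Matrix.fromBlocks_transpose, Matrix.fromBlocks_multiply, Matrix.fromBlocks_multiply,
    Matrix.fromBlocks_smul]
  simp [h1, Matrix.nonsing_inv_mul _ hA]

theorem Dm_mul_inv {ℓ r : ℕ} [Fact ℓ.Prime] (q : ZMod ℓ)
    (A B : Matrix (Fin r) (Fin r) (ZMod ℓ))
    (hB : IsUnit B.det) : Dm q A * Dm 1 B = Dm 1 B * Dm q (B⁻¹ * A * B) := by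
  have h1 : (B⁻¹ * A * B)⁻¹ = B⁻¹ * A⁻¹ * B := by
    rw [Matrix.mul_inv_rev, Matrix.mul_inv_rev, Matrix.nonsing_inv_nonsing_inv _ hB,
      Matrix.mul_assoc]
  have h2 : (B⁻¹)ᵀ * Bᵀ = 1 := by
    rw [← Matrix.transpose_mul, Matrix.mul_nonsing_inv _ hB, Matrix.transpose_one]
  unfold Dm
  rw [Matrix.fromBlocks_multiply, Matrix.fromBlocks_multiply, h1]
  simp [Matrix.transpose_mul]
  constructor
  · rw [← Matrix.mul_assoc, ← Matrix.mul_assoc, Matrix.mul_nonsing_inv _ hB, one_mul]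
  · rw [← Matrix.mul_assoc, h2, one_mul]

theorem unip_smul_inv {K : Type} [Field K] {n : Type} [Fintype n] [DecidableEq n]
    (A : Matrix n n K) (hA : IsNilpotent (A - 1)) (q : K) :
    IsNilpotent (q • (A⁻¹)ᵀ - Matrix.scalar n q) := by
  have h := (unip_transpose _ (unip_inv A hA)).smul q
  rw [smul_sub, Matrix.smul_one_eq_diagonal] at h
  exact h

theorem Dm_charpoly {ℓ r : ℕ} [Fact ℓ.Prime] (q : ZMod ℓ)
    (A : Matrix (Fin r) (Fin r) (ZMod ℓ)) (hA : IsNilpotent (A - 1)) :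
    (Dm q A).charpoly = (Polynomial.X - 1) ^ r * (Polynomial.X - Polynomial.C q) ^ r := by
  unfold Dm
  rw [Matrix.charpoly_fromBlocks_zero₁₂, (nil_iff_charpoly _ _).1 (unip_smul_inv A hA q),
    (nil_iff_charpoly A 1).1 (by simpa using hA)]
  simp

theorem Dm_fixdim {ℓ r : ℕ} [Fact ℓ.Prime] (q : ZMod ℓ) (hq : q ≠ 1)
    (A : Matrix (Fin r) (Fin r) (ZMod ℓ)) (hA : IsNilpotent (A - 1)) :
    fixdim (Dm q A) = fixdim A := by
  apply fixdim_block
  rw [← Matrix.isUnit_iff_isUnit_det]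
  have hu : IsUnit (Matrix.scalar (Fin r) (q - 1)) := by
    apply IsUnit.map
    exact (sub_ne_zero.mpr hq).isUnit
  have := (unip_smul_inv A hA q).isUnit_add_left_of_commute hu
    (Matrix.scalar_commute _ (fun _ => Commute.all _ _) _).symm
  convert this using 1
  rw [map_sub, map_one]; abel

theorem centr {ℓ r : ℕ} [Fact ℓ.Prime] (q : ZMod ℓ) (hq : q ≠ 1)
    (A A0 : Matrix (Fin r) (Fin r) (ZMod ℓ)) (hA : IsNilpotent (A - 1))
    (hA0 : IsNilpotent (A0 - 1)) (h : Matrix (Fin r ⊕ Fin r) (Fin r ⊕ Fin r) (ZMod ℓ))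
    (hs : hᵀ * Om ℓ r * h = Om ℓ r) (hc : h * Dm q A = Dm q A0 * h) :
    ∃ B : Matrix (Fin r) (Fin r) (ZMod ℓ), IsUnit B.det ∧ h = Dm 1 B ∧ A = B⁻¹ * A0 * B := by
  have hAu := isUnit_det_of_unip A hA
  have hA0u := isUnit_det_of_unip A0 hA0
  have hAt : (A⁻¹)ᵀ * Aᵀ = 1 := by
    rw [← Matrix.transpose_mul, Matrix.mul_nonsing_inv _ hAu, Matrix.transpose_one]
  have hA0t : A0ᵀ * (A0⁻¹)ᵀ = 1 := by
    rw [← Matrix.transpose_mul, Matrix.nonsing_inv_mul _ hA0u, Matrix.transpose_one]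
  obtain ⟨a, b, c, e, rfl⟩ : ∃ a b c e, h = Matrix.fromBlocks a b c e :=
    ⟨_, _, _, _, (Matrix.fromBlocks_toBlocks h).symm⟩
  unfold Dm at hc
  rw [Matrix.fromBlocks_multiply, Matrix.fromBlocks_multiply, Matrix.fromBlocks_inj] at hc
  obtain ⟨h11, h12, h21, h22⟩ := hc
  simp only [Matrix.mul_zero, Matrix.zero_mul, add_zero, zero_add] at h11 h12 h21 h22
  have hb : b = 0 := by
    apply sylv_zero A0 Aᵀ b q hq hA0 (unip_transpose _ hA)
    rw [← h12, Matrix.mul_smul, Matrix.smul_mul, Matrix.mul_assoc, hAt, mul_one]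
  have hc : c = 0 := by
    apply sylv_zero A0ᵀ A c q hq (unip_transpose _ hA0) hA
    rw [Matrix.mul_assoc, h21, Matrix.smul_mul, Matrix.mul_smul, ← Matrix.mul_assoc, hA0t, one_mul]
  subst hb hc
  unfold Om at hs
  rw [Matrix.fromBlocks_transpose, Matrix.fromBlocks_multiply, Matrix.fromBlocks_multiply,
    Matrix.fromBlocks_inj] at hs
  have he : aᵀ * e = 1 := by simpa using hs.2.1
  have hau : IsUnit a.det := by
    have := Matrix.isUnit_det_of_right_inverse he
    rwa [Matrix.det_transpose] at this
  refine ⟨a, hau, ?_, ?_⟩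
  · unfold Dm
    rw [one_smul, Matrix.transpose_nonsing_inv, Matrix.inv_eq_right_inv he]
  · rw [Matrix.mul_assoc, ← h11, ← Matrix.mul_assoc, Matrix.nonsing_inv_mul _ hau, one_mul]

theorem exists_normal {ℓ r : ℕ} [Fact ℓ.Prime] (q : ZMod ℓ) (hq0 : q ≠ 0) (hq : q ≠ 1)
    (M : Matrix (Fin r ⊕ Fin r) (Fin r ⊕ Fin r) (ZMod ℓ))
    (hM : Mᵀ * Om ℓ r * M = q • Om ℓ r)
    (hch : M.charpoly = (Polynomial.X - 1) ^ r * (Polynomial.X - Polynomial.C q) ^ r) :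
    ∃ (g : Matrix (Fin r ⊕ Fin r) (Fin r ⊕ Fin r) (ZMod ℓ))
      (A : Matrix (Fin r) (Fin r) (ZMod ℓ)), gᵀ * Om ℓ r * g = Om ℓ r ∧
      IsNilpotent (A - 1) ∧ M * g = g * Dm q A := by
  have hne : M.charpoly ≠ 0 := M.charpoly_monic.ne_zero
  have hmul : ∀ x y : ZMod ℓ, x ≠ y → Polynomial.rootMultiplicity x
      ((Polynomial.X - Polynomial.C x) ^ r * (Polynomial.X - Polynomial.C y) ^ r) = r := by
    intro x y hxy
    rw [Polynomial.rootMultiplicity_mul (mul_ne_zero (pow_ne_zero _ (Polynomial.X_sub_C_ne_zero _))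
      (pow_ne_zero _ (Polynomial.X_sub_C_ne_zero _))), Polynomial.rootMultiplicity_X_sub_C_pow,
      Polynomial.rootMultiplicity_eq_zero]
    · simp
    · simp [Polynomial.IsRoot, sub_eq_zero, hxy]
  have m1 : M.charpoly.rootMultiplicity 1 = r := by
    rw [hch]; simpa using hmul 1 q hq.symm
  have m2 : M.charpoly.rootMultiplicity q = r := by
    rw [hch, mul_comm]; simpa using hmul q 1 hq
  obtain ⟨P1, A, hP1, inj1, mem1, nil1⟩ := exists_gen_basis M 1 r m1
  obtain ⟨P2, C, hP2, inj2, mem2, nil2⟩ := exists_gen_basis M q r m2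
  rw [map_one] at nil1
  have hdisj : ∀ x y, P1 *ᵥ x + P2 *ᵥ y = 0 → x = 0 ∧ y = 0 := by
    intro x y hxy
    have hd := Module.End.disjoint_genEigenspace (Matrix.toLin' M) hq.symm ⊤ ⊤
    have h2 : P1 *ᵥ x = -(P2 *ᵥ y) := eq_neg_of_add_eq_zero_left hxy
    have h0 : P1 *ᵥ x = 0 := by
      apply (Submodule.disjoint_def.1 hd) _ (mem1 x)
      rw [h2]; exact Submodule.neg_mem _ (mem2 y)
    rw [h0, zero_add] at hxy
    exact ⟨inj1 _ h0, inj2 _ hxy⟩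
  have gram : ∀ (P Q : Matrix (Fin r ⊕ Fin r) (Fin r) (ZMod ℓ))
      (U V : Matrix (Fin r) (Fin r) (ZMod ℓ)), M * P = P * U → M * Q = Q * V →
      Uᵀ * (Pᵀ * Om ℓ r * Q) * V = q • (Pᵀ * Om ℓ r * Q) := by
    intro P Q U V h1 h2
    calc Uᵀ * (Pᵀ * Om ℓ r * Q) * V = (P * U)ᵀ * Om ℓ r * (Q * V) := by
          simp only [Matrix.transpose_mul, Matrix.mul_assoc]
      _ = Pᵀ * (Mᵀ * Om ℓ r * M) * Q := by
          rw [← h1, ← h2]; simp only [Matrix.transpose_mul, Matrix.mul_assoc]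
      _ = _ := by rw [hM, Matrix.mul_smul, Matrix.smul_mul]
  have G11 : P1ᵀ * Om ℓ r * P1 = 0 :=
    sylv_zero _ _ _ q hq (unip_transpose _ nil1) nil1 (gram P1 P1 A A hP1 hP1)
  have nil2' : IsNilpotent (q⁻¹ • C - 1) := by
    have := nil2.smul q⁻¹
    rwa [smul_sub, Matrix.scalar_apply, ← Matrix.smul_one_eq_diagonal, smul_smul,
      inv_mul_cancel₀ hq0, one_smul] at this
  have G22 : P2ᵀ * Om ℓ r * P2 = 0 := by
    apply sylv_zero _ _ _ q⁻¹ (by simpa using hq) (unip_transpose _ nil2') nil2'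
    rw [Matrix.transpose_smul, Matrix.smul_mul, Matrix.smul_mul, Matrix.mul_smul,
      gram P2 P2 C C hP2 hP2, smul_smul, smul_smul]
    congr 1
    field_simp
  obtain ⟨E, hE⟩ : ∃ E, E = P1ᵀ * Om ℓ r * P2 := ⟨_, rfl⟩
  have G12 : P1ᵀ * Om ℓ r * P2 = E := hE.symm
  have G21 : P2ᵀ * Om ℓ r * P1 = -Eᵀ := by
    rw [hE, Matrix.transpose_mul, Matrix.transpose_mul, Om_transpose, Matrix.transpose_transpose,
      Matrix.neg_mul, Matrix.mul_neg, neg_neg, Matrix.mul_assoc]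
  have hAEC : Aᵀ * E * C = q • E := by rw [hE]; exact gram P1 P2 A C hP1 hP2
  have hAu := isUnit_det_of_unip A nil1
  -- the combined basis is invertible
  have hPu : IsUnit (Matrix.fromCols P1 P2) := by
    rw [← Matrix.mulVec_injective_iff_isUnit]
    rw [← Matrix.coe_mulVecLin, ← LinearMap.ker_eq_bot, LinearMap.ker_eq_bot']
    intro v hv
    rw [Matrix.mulVecLin_apply, Matrix.fromCols_mulVec] at hv
    obtain ⟨hx, hy⟩ := hdisj _ _ hv
    ext i
    rcases i with i | i
    · exact congrFun hx i
    · exact congrFun hy i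
  have hOmu : IsUnit (Om ℓ r) := by
    rw [Matrix.isUnit_iff_isUnit_det]
    apply Matrix.isUnit_det_of_left_inverse (B := -Om ℓ r)
    rw [neg_mul, Om_sq, neg_neg]
  have hgram : ∀ P Q : Matrix (Fin r ⊕ Fin r) (Fin r) (ZMod ℓ),
      (Matrix.fromCols P Q)ᵀ * Om ℓ r * Matrix.fromCols P Q =
      Matrix.fromBlocks (Pᵀ * Om ℓ r * P) (Pᵀ * Om ℓ r * Q) (Qᵀ * Om ℓ r * P)
        (Qᵀ * Om ℓ r * Q) := by
    intro P Q
    rw [Matrix.transpose_fromCols, Matrix.fromRows_mul, Matrix.fromRows_mul_fromCols]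
  have hEu : IsUnit E.det := by
    have h1 : IsUnit ((Matrix.fromCols P1 P2)ᵀ * Om ℓ r * Matrix.fromCols P1 P2) := by
      refine (IsUnit.mul ?_ hOmu).mul hPu
      rw [Matrix.isUnit_iff_isUnit_det] at hPu ⊢
      rwa [Matrix.det_transpose]
    rw [hgram, G11, G12, G21, G22] at h1
    obtain ⟨Y, hY⟩ := h1.exists_right_inv
    rw [← Matrix.fromBlocks_toBlocks Y, Matrix.fromBlocks_multiply, ← Matrix.fromBlocks_one,
      Matrix.fromBlocks_inj] at hY
    have h2 : E * Y.toBlocks₂₁ = 1 := by simpa using hY.1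
    exact Matrix.isUnit_det_of_right_inverse h2
  refine ⟨Matrix.fromCols P1 (P2 * E⁻¹), A, ?_, nil1, ?_⟩
  · rw [hgram, G11, ← Matrix.mul_assoc, G12, Matrix.mul_nonsing_inv _ hEu, Matrix.transpose_mul]
    have e1 : (E⁻¹)ᵀ * P2ᵀ * Om ℓ r * P1 = -1 := by
      rw [Matrix.mul_assoc, Matrix.mul_assoc, ← Matrix.mul_assoc P2ᵀ, G21, Matrix.mul_neg,
        ← Matrix.transpose_mul, Matrix.mul_nonsing_inv _ hEu, Matrix.transpose_one]
    have e2 : (E⁻¹)ᵀ * P2ᵀ * Om ℓ r * P2 = 0 := by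
      rw [Matrix.mul_assoc, Matrix.mul_assoc, ← Matrix.mul_assoc P2ᵀ, G22, Matrix.mul_zero]
    rw [e1, ← Matrix.mul_assoc, e2, Matrix.zero_mul]
    rfl
  · have hAt : (A⁻¹)ᵀ * Aᵀ = 1 := by
      rw [← Matrix.transpose_mul, Matrix.mul_nonsing_inv _ hAu, Matrix.transpose_one]
    have hEC : E * C = (q • (A⁻¹)ᵀ) * E := by
      have := congrArg (fun Z => (A⁻¹)ᵀ * Z) hAEC
      simp only [← Matrix.mul_assoc, hAt, one_mul, Matrix.mul_smul] at this
      rw [this, Matrix.smul_mul]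
    have hCE : C * E⁻¹ = E⁻¹ * (q • (A⁻¹)ᵀ) := by
      calc C * E⁻¹ = E⁻¹ * (E * C) * E⁻¹ := by
            rw [← Matrix.mul_assoc, Matrix.nonsing_inv_mul _ hEu, one_mul]
        _ = _ := by
            rw [hEC, Matrix.mul_assoc, Matrix.mul_assoc, Matrix.mul_nonsing_inv _ hEu, mul_one]
    unfold Dm
    rw [Matrix.mul_fromCols, Matrix.fromCols_mul_fromBlocks, hP1, ← Matrix.mul_assoc, hP2,
      Matrix.mul_assoc, hCE]
    simp [Matrix.mul_assoc]

theorem conj_props {ℓ r : ℕ} [Fact ℓ.Prime] (q : ZMod ℓ) (hq0 : q ≠ 0) (hq : q ≠ 1)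
    (g M : Matrix (Fin r ⊕ Fin r) (Fin r ⊕ Fin r) (ZMod ℓ))
    (A : Matrix (Fin r) (Fin r) (ZMod ℓ)) (hg : gᵀ * Om ℓ r * g = Om ℓ r)
    (hA : IsNilpotent (A - 1)) (h : M * g = g * Dm q A) :
    inGSp ℓ r q M ∧
      M.charpoly = (Polynomial.X - 1) ^ r * (Polynomial.X - Polynomial.C q) ^ r ∧
      fixdim M = fixdim A := by
  have hgu : IsUnit g.det := isUnit_det_of_sim one_ne_zero (by rw [hg, one_smul])
  have hM : M = g * Dm q A * g⁻¹ := by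
    rw [← h, Matrix.mul_assoc, Matrix.mul_nonsing_inv _ hgu, mul_one]
  have hgt : (g⁻¹)ᵀ * gᵀ = 1 := by
    rw [← Matrix.transpose_mul, Matrix.mul_nonsing_inv _ hgu, Matrix.transpose_one]
  have hg' : (g⁻¹)ᵀ * Om ℓ r * g⁻¹ = Om ℓ r := by
    calc (g⁻¹)ᵀ * Om ℓ r * g⁻¹ = (g⁻¹)ᵀ * (gᵀ * Om ℓ r * g) * g⁻¹ := by rw [hg]
      _ = ((g⁻¹)ᵀ * gᵀ) * Om ℓ r * (g * g⁻¹) := by simp only [Matrix.mul_assoc]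
      _ = _ := by rw [hgt, Matrix.mul_nonsing_inv _ hgu, one_mul, mul_one]
  have hsim : Mᵀ * Om ℓ r * M = q • Om ℓ r := by
    calc Mᵀ * Om ℓ r * M
        = (g⁻¹)ᵀ * ((Dm q A)ᵀ * (gᵀ * Om ℓ r * g) * Dm q A) * g⁻¹ := by
          rw [hM]; simp only [Matrix.transpose_mul, Matrix.mul_assoc]
      _ = _ := by
          rw [hg, Dm_sim q A (isUnit_det_of_unip A hA), Matrix.mul_smul, Matrix.smul_mul, hg']
  refine ⟨⟨isUnit_det_of_sim hq0 hsim, hsim⟩, ?_, ?_⟩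
  · rw [hM, Matrix.charpoly_mul_comm, ← Matrix.mul_assoc, Matrix.nonsing_inv_mul _ hgu, one_mul,
      Dm_charpoly q A hA]
  · rw [fixdim_conj M g _ hgu h, Dm_fixdim q hq A hA]

theorem sp_mul {ℓ r : ℕ} {g h : Matrix (Fin r ⊕ Fin r) (Fin r ⊕ Fin r) (ZMod ℓ)}
    (hg : gᵀ * Om ℓ r * g = Om ℓ r) (hh : hᵀ * Om ℓ r * h = Om ℓ r) :
    (g * h)ᵀ * Om ℓ r * (g * h) = Om ℓ r := by
  calc (g * h)ᵀ * Om ℓ r * (g * h) = hᵀ * (gᵀ * Om ℓ r * g) * h := by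
        simp only [Matrix.transpose_mul, Matrix.mul_assoc]
    _ = _ := by rw [hg, hh]

theorem unip_conj {K : Type} [Field K] {n : Type} [Fintype n] [DecidableEq n]
    (A B : Matrix n n K) (hA : IsNilpotent (A - 1)) (hB : IsUnit B.det) :
    IsNilpotent (B⁻¹ * A * B - 1) := by
  have h := (nil_iff_charpoly A 1).1 (by simpa using hA)
  have := (nil_iff_charpoly (B⁻¹ * A * B) 1).2 (by
    rw [Matrix.charpoly_mul_comm, ← Matrix.mul_assoc, Matrix.mul_nonsing_inv _ hB, one_mul, h])
  simpa using this

open Polynomial in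
theorem stmt9 (q ℓ : ℕ) (hq : IsPrimePow q) (hℓ : ℓ.Prime) (hnd : ¬ ℓ ∣ q)
    (hq1 : (q : ZMod ℓ) ≠ 1) (r : ℕ) (hr : 1 ≤ r) (d : ℕ) (hd : d ≤ 2 * r) :
    Nat.card {M : Matrix (Fin r ⊕ Fin r) (Fin r ⊕ Fin r) (ZMod ℓ) //
        inGSp ℓ r (q : ZMod ℓ) M ∧
          M.charpoly = (X - 1) ^ r * (X - C (q : ZMod ℓ)) ^ r ∧ fixdim M = d} *
      cardGL ℓ r =
    cardSp ℓ r *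
      Nat.card {M : Matrix (Fin r) (Fin r) (ZMod ℓ) //
        IsUnit M.det ∧ M.charpoly = (X - 1) ^ r ∧ fixdim M = d} := by
  have : Fact ℓ.Prime := ⟨hℓ⟩
  have hq0 : (q : ZMod ℓ) ≠ 0 := by
    rwa [Ne, ZMod.natCast_eq_zero_iff]
  have hnil : ∀ A : Matrix (Fin r) (Fin r) (ZMod ℓ),
      IsNilpotent (A - 1) ↔ A.charpoly = (X - 1) ^ r := by
    intro A
    simpa using nil_iff_charpoly A 1
  unfold cardGL cardSp
  rw [← Nat.card_prod, ← Nat.card_prod]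
  set S := {M : Matrix (Fin r ⊕ Fin r) (Fin r ⊕ Fin r) (ZMod ℓ) //
        inGSp ℓ r (q : ZMod ℓ) M ∧
          M.charpoly = (X - 1) ^ r * (X - C (q : ZMod ℓ)) ^ r ∧ fixdim M = d}
  have hex : ∀ M : S, ∃ (g : Matrix (Fin r ⊕ Fin r) (Fin r ⊕ Fin r) (ZMod ℓ))
      (A : Matrix (Fin r) (Fin r) (ZMod ℓ)), gᵀ * Om ℓ r * g = Om ℓ r ∧
      IsNilpotent (A - 1) ∧ M.1 * g = g * Dm (q : ZMod ℓ) A := fun M =>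
    exists_normal (q : ZMod ℓ) hq0 hq1 M.1 M.2.1.2 M.2.2.1
  choose G A hG hA hGA using hex
  have hGu : ∀ M, IsUnit (G M).det := fun M =>
    isUnit_det_of_sim one_ne_zero (by rw [hG, one_smul])
  have hD : ∀ B : Matrix (Fin r) (Fin r) (ZMod ℓ), IsUnit B.det →
      (Dm 1 B)ᵀ * Om ℓ r * Dm 1 B = Om ℓ r := by
    intro B hB
    rw [Dm_sim 1 B hB, one_smul]
  have hrel : ∀ (M : S) (B : Matrix (Fin r) (Fin r) (ZMod ℓ)), IsUnit B.det →
      M.1 * (G M * Dm 1 B) = (G M * Dm 1 B) * Dm (q : ZMod ℓ) (B⁻¹ * A M * B) := by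
    intro M B hB
    rw [← Matrix.mul_assoc, hGA, Matrix.mul_assoc, Dm_mul_inv _ _ _ hB,
      Matrix.mul_assoc (G M)]
  have hsp : ∀ (M : S) (B : Matrix (Fin r) (Fin r) (ZMod ℓ)), IsUnit B.det →
      inGSp ℓ r 1 (G M * Dm 1 B) := by
    intro M B hB
    have h := sp_mul (hG M) (hD B hB)
    have h' : (G M * Dm 1 B)ᵀ * Om ℓ r * (G M * Dm 1 B) = (1 : ZMod ℓ) • Om ℓ r := by
      rw [h, one_smul]
    exact ⟨isUnit_det_of_sim one_ne_zero h', h'⟩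
  have hfix : ∀ (M : S) (B : Matrix (Fin r) (Fin r) (ZMod ℓ)), IsUnit B.det →
      IsUnit (B⁻¹ * A M * B).det ∧ (B⁻¹ * A M * B).charpoly = (X - 1) ^ r ∧
        fixdim (B⁻¹ * A M * B) = d := by
    intro M B hB
    have hn := unip_conj (A M) B (hA M) hB
    refine ⟨isUnit_det_of_unip _ hn, (hnil _).1 hn, ?_⟩
    rw [← (conj_props (q : ZMod ℓ) hq0 hq1 _ M.1 _ (sp_mul (hG M) (hD B hB)) hn
      (hrel M B hB)).2.2]
    exact M.2.2.2
  refine Nat.card_congr (Equiv.ofBijective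
    (fun x => (⟨G x.1 * Dm 1 x.2.1, hsp x.1 x.2.1 x.2.2⟩,
      ⟨x.2.1⁻¹ * A x.1 * x.2.1, hfix x.1 x.2.1 x.2.2⟩)) ⟨?_, ?_⟩)
  · rintro ⟨M, B, hB⟩ ⟨M', B', hB'⟩ h
    rw [Prod.mk.injEq, Subtype.mk.injEq, Subtype.mk.injEq] at h
    obtain ⟨h1, h2⟩ := h
    dsimp only at h1 h2
    have hMM : M = M' := by
      apply Subtype.ext
      have e1 := hrel M B hB
      have e2 := hrel M' B' hB'
      rw [h1, h2, ← e2] at e1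
      have hu : IsUnit (G M' * Dm 1 B') :=
        (Matrix.isUnit_iff_isUnit_det _).2 (hsp M' B' hB').1
      exact hu.mul_right_cancel e1
    subst hMM
    have hu : IsUnit (G M) := (Matrix.isUnit_iff_isUnit_det _).2 (hGu M)
    have h3 := hu.mul_left_cancel h1
    unfold Dm at h3
    rw [Matrix.fromBlocks_inj] at h3
    have h4 := h3.1
    subst h4
    rfl
  · rintro ⟨⟨g, hgu, hg⟩, ⟨A', hA'u, hA'c, hA'd⟩⟩
    rw [one_smul] at hg
    have hn := (hnil A').2 hA'c
    have hMg : (g * Dm (q : ZMod ℓ) A' * g⁻¹) * g = g * Dm (q : ZMod ℓ) A' := by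
      rw [Matrix.mul_assoc, Matrix.nonsing_inv_mul _ hgu, mul_one]
    have hp := conj_props (q : ZMod ℓ) hq0 hq1 g _ A' hg hn hMg
    obtain ⟨M, hM⟩ : ∃ M : S, M.1 = g * Dm (q : ZMod ℓ) A' * g⁻¹ :=
      ⟨⟨_, hp.1, hp.2.1, hp.2.2.trans hA'd⟩, rfl⟩
    rw [← hM] at hMg
    have hinv : ((G M)⁻¹)ᵀ * Om ℓ r * (G M)⁻¹ = Om ℓ r := by
      have hgt : ((G M)⁻¹)ᵀ * (G M)ᵀ = 1 := by
        rw [← Matrix.transpose_mul, Matrix.mul_nonsing_inv _ (hGu M), Matrix.transpose_one]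
      calc ((G M)⁻¹)ᵀ * Om ℓ r * (G M)⁻¹
          = ((G M)⁻¹)ᵀ * ((G M)ᵀ * Om ℓ r * G M) * (G M)⁻¹ := by rw [hG]
        _ = (((G M)⁻¹)ᵀ * (G M)ᵀ) * Om ℓ r * (G M * (G M)⁻¹) := by
            simp only [Matrix.mul_assoc]
        _ = _ := by rw [hgt, Matrix.mul_nonsing_inv _ (hGu M), one_mul, mul_one]
    have hcomm : ((G M)⁻¹ * g) * Dm (q : ZMod ℓ) A' =
        Dm (q : ZMod ℓ) (A M) * ((G M)⁻¹ * g) := by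
      calc ((G M)⁻¹ * g) * Dm (q : ZMod ℓ) A' = (G M)⁻¹ * (M.1 * g) := by
            rw [hMg, Matrix.mul_assoc]
        _ = (G M)⁻¹ * (M.1 * G M) * ((G M)⁻¹ * g) := by
            rw [Matrix.mul_assoc, Matrix.mul_assoc, ← Matrix.mul_assoc (G M),
              Matrix.mul_nonsing_inv _ (hGu M), one_mul]
        _ = _ := by
            rw [hGA, ← Matrix.mul_assoc (G M)⁻¹, Matrix.nonsing_inv_mul _ (hGu M), one_mul]
    obtain ⟨B, hB, hB1, hB2⟩ := centr (q : ZMod ℓ) hq1 A' (A M) hn (hA M) _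
      (sp_mul hinv hg) hcomm
    refine ⟨(M, ⟨B, hB⟩), ?_⟩
    apply Prod.ext
    · apply Subtype.ext
      show G M * Dm 1 B = g
      rw [← hB1, ← Matrix.mul_assoc, Matrix.mul_nonsing_inv _ (hGu M), one_mul]
    · apply Subtype.ext
      exact hB2.symm
end

section
/- Let $p > 2$ and $\ell \ne p$ be primes and let $t \in \mathbb{F}_\ell$. Define $a_{\ell,t,p} := \#\{(x,y) \in \mathbb{F}_\ell^\times \times (\mathbb{F}_\ell^\times \setminus \{-p\}) : (x + y/x)(1 + p/y) = t\}$, $A_{\ell,t,p} := \ell^4((\ell-1)(\ell-2) + a_{\ell,t,p}) + (\ell^6 - \ell^4 \text{ if } t = 0, \text{ else } 0)$, $B_\ell := \ell^4(\ell^2-1)^2$, and $C_{\ell,t} := \ell^5(\ell-1)(\ell^3 - \ell - 1) + (\ell^7 - \ell^6 \text{ if } t = 0, \text{ else } 0)$. Then the number of matrices $M \in \mathrm{GSp}_4^{(p \bmod \ell)}(\mathbb{F}_\ell)$ with trace $t$ equals $A_{\ell,t,p} + B_\ell + C_{\ell,t}$. -/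
open Matrix Finset Filter

/-- `a_{ℓ,t,p} = #{(x,y) ∈ F_ℓ^× × (F_ℓ^× \ {-p}) : (x + y/x)(1 + p/y) = t}`. -/
noncomputable def aCount (ℓ p : ℕ) [Fact ℓ.Prime] (t : ZMod ℓ) : ℕ :=
  Nat.card {v : ZMod ℓ × ZMod ℓ //
    v.1 ≠ 0 ∧ v.2 ≠ 0 ∧ v.2 ≠ -(p : ZMod ℓ) ∧
      (v.1 + v.2 / v.1) * (1 + (p : ZMod ℓ) / v.2) = t}


abbrev M2 (F : Type) := Matrix (Fin 2) (Fin 2) F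

/-- Block form of the similitude condition. -/
def Cond {F : Type} [Field F] (d : F) (A B C D : M2 F) : Prop :=
  Aᵀ * C = Cᵀ * A ∧ Bᵀ * D = Dᵀ * B ∧ Aᵀ * D - Cᵀ * B = d • 1

/-- Twisted count with prescribed lower-left block. -/
noncomputable def NK {F : Type} [Field F] (d t : F) (K L C : M2 F) : ℕ :=
  Nat.card {x : M2 F × M2 F × M2 F //
    Cond d x.1 x.2.1 C x.2.2 ∧ (K * x.1).trace + (L * x.2.2).trace = t}

lemma card_lin {F V : Type} [Field F] [Finite F] [AddCommGroup V] [Module F V] [Finite V]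
    (φ : V →ₗ[F] F) (h : ∃ v, φ v ≠ 0) (s : F) :
    Nat.card {v // φ v = s} * Nat.card F = Nat.card V := by
  obtain ⟨v0, h0⟩ := h
  have key : ∀ s', Nat.card {v // φ v = s'} = Nat.card {v // φ v = s} := by
    intro s'
    refine Nat.card_congr ((Equiv.addRight (((s - s') / φ v0) • v0)).subtypeEquiv ?_)
    intro a
    simp only [Equiv.coe_addRight, map_add, map_smul, smul_eq_mul]
    rw [div_mul_cancel₀ _ h0]
    constructor
    · rintro rfl; ring
    · intro h; linear_combination h
  have := Fintype.ofFinite F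
  have e := Nat.card_congr (Equiv.sigmaFiberEquiv φ)
  rw [Nat.card_sigma] at e
  rw [← e, Finset.sum_congr rfl (fun x _ => key x)]
  simp [mul_comm]

lemma cond_twist {F : Type} [Field F] (d : F) (P P' Q Q' A B C D C' : M2 F)
    (hP : P' * P = 1) (hQ : Q * Q' = 1) (hC : C' = P * C * Q)
    (h : Cond d A B C D) :
    Cond d (P'ᵀ * A * Q) (P'ᵀ * B * Q'ᵀ) C' (P * D * Q'ᵀ) := by
  obtain ⟨h1, h2, h3⟩ := h
  have hPt : Pᵀ * P'ᵀ = 1 := by rw [← transpose_mul, hP, transpose_one]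
  have hQt : Q'ᵀ * Qᵀ = 1 := by rw [← transpose_mul, hQ, transpose_one]
  have hQt' : Qᵀ * Q'ᵀ = 1 := mul_eq_one_comm.mp hQt
  subst hC
  refine ⟨?_, ?_, ?_⟩
  · simp only [transpose_mul, transpose_transpose, Matrix.mul_assoc]
    rw [← Matrix.mul_assoc P' P, hP, ← Matrix.mul_assoc Pᵀ, hPt, Matrix.one_mul, Matrix.one_mul,
      ← Matrix.mul_assoc Aᵀ, h1, Matrix.mul_assoc]
  · simp only [transpose_mul, transpose_transpose, Matrix.mul_assoc]
    rw [← Matrix.mul_assoc P' P, hP, ← Matrix.mul_assoc Pᵀ, hPt, Matrix.one_mul, Matrix.one_mul,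
      ← Matrix.mul_assoc Bᵀ, h2, Matrix.mul_assoc]
  · simp only [transpose_mul, transpose_transpose, Matrix.mul_assoc]
    rw [← Matrix.mul_assoc P' P, hP, ← Matrix.mul_assoc Pᵀ, hPt, Matrix.one_mul, Matrix.one_mul,
      ← Matrix.mul_assoc Aᵀ, ← Matrix.mul_assoc Cᵀ, ← Matrix.mul_sub, ← Matrix.sub_mul, h3]
    simp [hQt']

lemma NK_twist {F : Type} [Field F] (d t : F) (P P' Q Q' C C' : M2 F)
    (hP : P' * P = 1) (hQ : Q * Q' = 1) (hC : C' = P * C * Q) :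
    NK d t 1 1 C' = NK d t (Q * P'ᵀ) (Q'ᵀ * P) C := by
  have hP' : P * P' = 1 := mul_eq_one_comm.mp hP
  have hQ' : Q' * Q = 1 := mul_eq_one_comm.mp hQ
  have hPt : Pᵀ * P'ᵀ = 1 := by rw [← transpose_mul, hP, transpose_one]
  have hPt' : P'ᵀ * Pᵀ = 1 := mul_eq_one_comm.mp hPt
  have hQt : Q'ᵀ * Qᵀ = 1 := by rw [← transpose_mul, hQ, transpose_one]
  have hQt' : Qᵀ * Q'ᵀ = 1 := mul_eq_one_comm.mp hQt
  have c1 : ∀ X Y Z W A : M2 F, X * Y = 1 → Z * W = 1 → X * (Y * A * Z) * W = A := by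
    intro X Y Z W A h1 h2
    calc X * (Y * A * Z) * W = (X * Y) * A * (Z * W) := by simp only [Matrix.mul_assoc]
      _ = A := by rw [h1, h2]; simp
  have hC2 : C = P' * C' * Q' := by
    rw [hC]; exact (c1 _ _ _ _ _ hP hQ).symm
  have key : ∀ x : M2 F × M2 F × M2 F, 
      (Q * P'ᵀ * x.1).trace + (Q'ᵀ * P * x.2.2).trace = 
      (1 * (P'ᵀ * x.1 * Q)).trace + (1 * (P * x.2.2 * Q'ᵀ)).trace := by
    intro x
    rw [Matrix.one_mul, Matrix.one_mul, Matrix.trace_mul_cycle P'ᵀ, Matrix.trace_mul_cycle P]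
  symm
  unfold NK
  refine Nat.card_congr ⟨fun x => ⟨(P'ᵀ * x.1.1 * Q, P'ᵀ * x.1.2.1 * Q'ᵀ, P * x.1.2.2 * Q'ᵀ), 
    cond_twist d P P' Q Q' _ _ C _ C' hP hQ hC x.2.1, ?_⟩, 
    fun x => ⟨(Pᵀ * x.1.1 * Q', Pᵀ * x.1.2.1 * Qᵀ, P' * x.1.2.2 * Qᵀ), 
    cond_twist d P' P Q' Q _ _ C' _ C hP' hQ' hC2 x.2.1, ?_⟩, ?_, ?_⟩
  · exact (key x.1).symm.trans x.2.2
  · refine (key _).trans (Eq.trans ?_ x.2.2)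
    simp only
    rw [c1 _ _ _ _ _ hPt' hQ', c1 _ _ _ _ _ hP' hQt', Matrix.one_mul, Matrix.one_mul]
  · rintro ⟨⟨A, B, D⟩, h⟩
    simp only [Subtype.mk.injEq, Prod.mk.injEq]
    exact ⟨c1 _ _ _ _ _ hPt hQ, c1 _ _ _ _ _ hPt hQt, c1 _ _ _ _ _ hP hQt⟩
  · rintro ⟨⟨A, B, D⟩, h⟩
    simp only [Subtype.mk.injEq, Prod.mk.injEq]
    exact ⟨c1 _ _ _ _ _ hPt' hQ', c1 _ _ _ _ _ hPt' hQt', c1 _ _ _ _ _ hP' hQt'⟩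

/-- Symmetric matrix from its three entries. -/
def sy {F : Type} (v : F × F × F) : M2 F := !![v.1, v.2.1; v.2.1, v.2.2]

lemma sy_tr {F : Type} (v : F × F × F) : (sy v)ᵀ = sy v := by
  ext i j; fin_cases i <;> fin_cases j <;> rfl

lemma sy_of {F : Type} (A : M2 F) (h : Aᵀ = A) : sy (A 0 0, A 0 1, A 1 1) = A := by
  have := congrFun (congrFun h 1) 0
  ext i j; fin_cases i <;> fin_cases j <;> simp_all [sy]

lemma NK_one {F : Type} [Field F] (d t : F) (hd : d ≠ 0) (K L : M2 F) :
    NK d t K L 1 = Nat.card {x : (F × F × F) × (F × F × F) //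
      (K * sy x.1).trace + (L * sy x.2).trace = t} := by
  symm
  unfold NK
  have aux : ∀ A B D : M2 F, Cond d A B 1 D → Aᵀ = A ∧ Dᵀ = D ∧ B = A * D - d • 1 := by
    rintro A B D ⟨h1, h2, h3⟩
    simp only [Matrix.mul_one, transpose_one, Matrix.one_mul] at h1 h3
    rw [h1] at h3
    have hB : B = A * D - d • 1 := by rw [← h3]; abel
    refine ⟨h1, ?_, hB⟩
    rw [hB] at h2
    simp only [transpose_sub, transpose_mul, h1, transpose_smul, transpose_one, Matrix.sub_mul,
      Matrix.mul_sub, Matrix.smul_mul, Matrix.mul_smul, Matrix.one_mul, Matrix.mul_one,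
      Matrix.mul_assoc] at h2
    exact (smul_right_injective _ hd (sub_right_injective h2)).symm
  refine Nat.card_congr ⟨fun x => ⟨(sy x.1.1, sy x.1.1 * sy x.1.2 - d • 1, sy x.1.2), 
    ⟨?_, ?_, ?_⟩, x.2⟩, 
    fun x => ⟨((x.1.1 0 0, x.1.1 0 1, x.1.1 1 1), (x.1.2.2 0 0, x.1.2.2 0 1, x.1.2.2 1 1)), ?_⟩, 
    ?_, ?_⟩
  · simp [sy_tr]
  · simp [sy_tr, Matrix.sub_mul, Matrix.mul_sub, Matrix.mul_assoc]
  · simp [sy_tr]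
  · obtain ⟨h1, h2, h3⟩ := aux _ _ _ x.2.1
    rw [sy_of _ h1, sy_of _ h2]
    exact x.2.2
  · rintro ⟨⟨⟨a, b, c⟩, ⟨e, f, g⟩⟩, h⟩
    simp [sy]
  · rintro ⟨⟨A, B, D⟩, h⟩
    obtain ⟨h1, h2, h3⟩ := aux _ _ _ h.1
    simp only [Subtype.mk.injEq, Prod.mk.injEq]
    rw [sy_of _ h1, sy_of _ h2]
    exact ⟨rfl, h3.symm, rfl⟩

lemma NK_one_asymm {F : Type} [Field F] [DecidableEq F] [Finite F] (d t : F) (hd : d ≠ 0) (c e : F) :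
    NK d t !![0, c; -c, 0] !![0, e; -e, 0] 1 =
      if t = 0 then Nat.card F ^ 6 else 0 := by
  rw [NK_one d t hd]
  have : ∀ x : (F × F × F) × (F × F × F),
    ((!![0, c; -c, 0] * sy x.1).trace + (!![0, e; -e, 0] * sy x.2).trace = t) ↔ t = 0 := by
    intro x
    have : ((!![0, c; -c, 0] * sy x.1).trace + (!![0, e; -e, 0] * sy x.2).trace) = 0 := by
      simp [sy, Matrix.trace_fin_two]
    rw [this, eq_comm]
  simp_rw [this]
  split_ifs with h
  · simp only [h]
    rw [Nat.card_congr (Equiv.subtypeUnivEquiv (fun _ => trivial))]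
    simp only [Nat.card_prod]; ring
  · simp [h]

lemma NK_one_gen {F : Type} [Field F] [Finite F] (d t : F) (hd : d ≠ 0) (K L : M2 F)
    (hK : ¬ (K 0 0 = 0 ∧ K 1 1 = 0 ∧ K 0 1 = - K 1 0)) :
    NK d t K L 1 = Nat.card F ^ 5 := by
  rw [NK_one d t hd]
  let φ : ((F × F × F) × (F × F × F)) →ₗ[F] F :=
    { toFun := fun x => (K * sy x.1).trace + (L * sy x.2).trace
      map_add' := by
        intro x y; simp [sy, Matrix.trace_fin_two, Matrix.mul_apply, Fin.sum_univ_two]; ring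
      map_smul' := by
        intro x y; simp [sy, Matrix.trace_fin_two, Matrix.mul_apply, Fin.sum_univ_two]; ring }
  have h := card_lin φ (by
    by_contra hc
    push Not at hc
    apply hK
    have h1 := hc ((1, 0, 0), 0)
    have h2 := hc ((0, 1, 0), 0)
    have h3 := hc ((0, 0, 1), 0)
    simp [φ, sy, Matrix.trace_fin_two, Matrix.mul_apply, Fin.sum_univ_two] at h1 h2 h3
    exact ⟨h1, h3, by linear_combination h2⟩) t
  have hq : 0 < Nat.card F := Nat.card_pos
  apply Nat.eq_of_mul_eq_mul_right hq
  change Nat.card {v // φ v = t} * _ = _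
  rw [h]
  simp only [Nat.card_prod]; ring

lemma card_fibP {α β : Type} [Fintype α] [Finite β] (p : α → β → Prop) :
    Nat.card {x : α × β // p x.1 x.2} = ∑ a, Nat.card {b // p a b} := by
  rw [Nat.card_congr (Equiv.subtypeProdEquivSigmaSubtype p), Nat.card_sigma]

lemma card_fib {α β : Type} [Finite α] [Fintype β] (p : α → Prop) (f : α → β) :
    Nat.card {a // p a} = ∑ b, Nat.card {a // f a = b ∧ p a} := by
  rw [← Nat.card_sigma]
  refine Nat.card_congr ⟨fun a => ⟨f a.1, a.1, rfl, a.2⟩, fun x => ⟨x.2.1, x.2.2.2⟩, ?_, ?_⟩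
  · intro a; rfl
  · rintro ⟨b, a, rfl, h⟩; rfl

set_option maxHeartbeats 1600000 in
lemma NK_E {F : Type} [Field F] [Finite F] (d t : F) (hd : d ≠ 0) (K L : M2 F)
    (hK : K 0 0 ≠ 0 ∨ K 0 1 ≠ 0) :
    NK d t K L !![1, 0; 0, 0] = Nat.card F ^ 4 * (Nat.card F - 1) := by
  have := Fintype.ofFinite F
  have := Fintype.ofFinite Fˣ
  let φ : (F × F × F × F) →ₗ[F] F :=
    { toFun := fun x => K 0 0 * x.1 + K 0 1 * x.2.1 + L 0 0 * x.2.2.1 + L 1 0 * x.2.2.2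
      map_add' := by intro x y; simp; ring
      map_smul' := by intro x y; simp; ring }
  have hφ : ∀ s, Nat.card {v // φ v = s} = Nat.card F ^ 3 := by
    intro s
    have h := card_lin φ (by
      by_contra hc
      push Not at hc
      have h1 := hc (1, 0, 0, 0)
      have h2 := hc (0, 1, 0, 0)
      simp [φ] at h1 h2
      tauto) s
    have hq : 0 < Nat.card F := Nat.card_pos
    apply Nat.eq_of_mul_eq_mul_right hq
    rw [h]
    simp only [Nat.card_prod]; ring
  have e : NK d t K L !![1, 0; 0, 0] = Nat.card {x : (Fˣ × F) × (F × F × F × F) //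
      φ x.2 = t - K 1 1 * x.1.1 - L 1 1 * (d / x.1.1)} := by
    symm
    unfold NK
    have aux : ∀ A B D : M2 F, Cond d A B !![1, 0; 0, 0] D →
        A 0 1 = 0 ∧ D 1 0 = 0 ∧ A 1 1 * D 1 1 = d ∧ B 0 0 = A 0 0 * D 0 0 - d ∧
        B 0 1 = A 0 0 * D 0 1 + A 1 0 * D 1 1 ∧
        B 1 0 * D 1 1 = B 0 1 * D 0 0 - B 0 0 * D 0 1 := by
      rintro A B D ⟨h1, h2, h3⟩
      have a1 := congrFun (congrFun h1 0) 1
      have b1 := congrFun (congrFun h2 0) 1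
      have c1 := congrFun (congrFun h3 0) 0
      have c2 := congrFun (congrFun h3 0) 1
      have c3 := congrFun (congrFun h3 1) 0
      have c4 := congrFun (congrFun h3 1) 1
      simp [Matrix.mul_apply, Fin.sum_univ_two] at a1 b1 c1 c2 c3 c4
      rw [← a1] at c3 c4
      have hA : A 1 1 ≠ 0 := by
        rintro h; rw [h] at c4; apply hd; rw [← c4]; ring
      have hD : D 1 0 = 0 := by
        have : A 1 1 * D 1 0 = 0 := by linear_combination c3
        exact (mul_eq_zero.mp this).resolve_left hA
      rw [hD] at b1 c1
      refine ⟨a1.symm, hD, by linear_combination c4, by linear_combination - c1,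
        by linear_combination -c2, by linear_combination b1⟩
    refine Nat.card_congr ⟨fun x => ⟨(!![x.1.2.1, 0; x.1.2.2.1, x.1.1.1],
      !![x.1.2.1 * x.1.2.2.2.1 - d, x.1.2.1 * x.1.2.2.2.2 + x.1.2.2.1 * (d / x.1.1.1);
        ((x.1.2.1 * x.1.2.2.2.2 + x.1.2.2.1 * (d / x.1.1.1)) * x.1.2.2.2.1 -
          (x.1.2.1 * x.1.2.2.2.1 - d) * x.1.2.2.2.2) / (d / x.1.1.1), x.1.1.2],
      !![x.1.2.2.2.1, x.1.2.2.2.2; 0, d / x.1.1.1]), ⟨?_, ?_, ?_⟩, ?_⟩,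
      fun x => ⟨((Units.mk0 (x.1.1 1 1) ?_, x.1.2.1 1 1),
        (x.1.1 0 0, x.1.1 1 0, x.1.2.2 0 0, x.1.2.2 0 1)), ?_⟩, ?_, ?_⟩
    · ext i j; fin_cases i <;> fin_cases j <;> simp [Matrix.mul_apply, Fin.sum_univ_two]
    · obtain ⟨⟨⟨u, b⟩, x, y, z, w⟩, h⟩ := x
      have hu : (u : F) ≠ 0 := u.ne_zero
      ext i j; fin_cases i <;> fin_cases j <;> simp [Matrix.mul_apply, Fin.sum_univ_two] <;>
        field_simp <;> ring
    · obtain ⟨⟨⟨u, b⟩, x, y, z, w⟩, h⟩ := x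
      have hu : (u : F) ≠ 0 := u.ne_zero
      ext i j; fin_cases i <;> fin_cases j <;> simp [Matrix.mul_apply, Fin.sum_univ_two]
      field_simp
    · obtain ⟨⟨⟨u, b⟩, x, y, z, w⟩, h⟩ := x
      simp [φ] at h
      simp [Matrix.mul_apply, Fin.sum_univ_two, Matrix.trace_fin_two]
      linear_combination h
    · obtain ⟨h1, h2, h3, h4, h5, h6⟩ := aux _ _ _ x.2.1
      rintro h; rw [h] at h3; apply hd; rw [← h3]; ring
    · obtain ⟨⟨A, B, D⟩, h, h'⟩ := x
      obtain ⟨h1, h2, h3, h4, h5, h6⟩ := aux A B D h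
      have hA : A 1 1 ≠ 0 := by
        rintro h; rw [h] at h3; apply hd; rw [← h3]; ring
      have : d / A 1 1 = D 1 1 := by field_simp; linear_combination -h3
      simp [Matrix.mul_apply, Fin.sum_univ_two, Matrix.trace_fin_two] at h'
      simp [φ, this]
      rw [h1, h2] at h'
      linear_combination h'
    · rintro ⟨⟨⟨u, b⟩, x, y, z, w⟩, h⟩
      simp
    · rintro ⟨⟨A, B, D⟩, h, h'⟩
      obtain ⟨h1, h2, h3, h4, h5, h6⟩ := aux A B D h
      have hA : A 1 1 ≠ 0 := by
        rintro h; rw [h] at h3; apply hd; rw [← h3]; ring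
      have hD : D 1 1 ≠ 0 := by
        rintro h; rw [h] at h3; apply hd; rw [← h3]; ring
      have hdd : d / A 1 1 = D 1 1 := by field_simp; linear_combination -h3
      simp only [Subtype.mk.injEq, Prod.mk.injEq, Units.val_mk0, hdd, ← h4, ← h5, ← h6]
      rw [mul_div_assoc, div_self hD, mul_one]
      refine ⟨?_, ?_, ?_⟩ <;>
      · ext i j; fin_cases i <;> fin_cases j <;> simp [*]
  rw [e, card_fibP (fun (a : Fˣ × F) b => φ b = t - K 1 1 * a.1 - L 1 1 * (d / a.1))]
  simp only [hφ]
  have hu : Fintype.card Fˣ = Nat.card F - 1 := by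
    rw [← Nat.card_eq_fintype_card, Nat.card_units]
  simp [hu]
  ring

lemma NK_zero {F : Type} [Field F] [Finite F] (d t : F) (hd : d ≠ 0) :
    NK d t 1 1 0 = Nat.card F ^ 3 *
      Nat.card {A : M2 F // A.det ≠ 0 ∧ A.trace * (1 + d / A.det) = t} := by
  have : Nat.card F ^ 3 = Nat.card (F × F × F) := by simp only [Nat.card_prod]; ring
  rw [this, mul_comm, ← Nat.card_prod]
  symm
  unfold NK
  have aux : ∀ A B D : M2 F, Cond d A B 0 D → A.det ≠ 0 ∧ D = d • (A⁻¹)ᵀ ∧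
      (A⁻¹ * B)ᵀ = A⁻¹ * B := by
    rintro A B D ⟨h1, h2, h3⟩
    simp only [transpose_zero, Matrix.zero_mul, sub_zero] at h3
    have hA : A.det ≠ 0 := by
      intro h
      have := congrArg Matrix.det h3
      simp [Matrix.det_mul, h] at this
      exact pow_ne_zero 2 hd this.symm
    have hu : IsUnit A.det := isUnit_iff_ne_zero.mpr hA
    have hD : D = d • (A⁻¹)ᵀ := by
      have h := congrArg (fun X => (A⁻¹)ᵀ * X) h3
      simp only [← Matrix.mul_assoc, ← transpose_mul, Matrix.mul_nonsing_inv _ hu] at h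
      simpa using h
    refine ⟨hA, hD, ?_⟩
    rw [hD] at h2
    simp only [Matrix.mul_smul, transpose_smul, Matrix.smul_mul, transpose_transpose] at h2
    have := smul_right_injective _ hd h2
    rw [transpose_mul]; exact this
  have htr : ∀ A : M2 F, A.trace + (d • (A⁻¹)ᵀ).trace = A.trace * (1 + d / A.det) := by
    intro A
    rw [Matrix.inv_def, Matrix.adjugate_fin_two]
    simp [Matrix.trace_fin_two]
    ring
  refine Nat.card_congr ⟨fun x => ⟨(x.1.1, x.1.1 * sy x.2, d • (x.1.1⁻¹)ᵀ), ⟨?_, ?_, ?_⟩, ?_⟩,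
    fun x => (⟨x.1.1, ?_, ?_⟩, ((x.1.1⁻¹ * x.1.2.1) 0 0, (x.1.1⁻¹ * x.1.2.1) 0 1,
      (x.1.1⁻¹ * x.1.2.1) 1 1)), ?_, ?_⟩
  · simp
  · have hu : IsUnit x.1.1.det := isUnit_iff_ne_zero.mpr x.1.2.1
    have h2 : (x.1.1)ᵀ * (x.1.1⁻¹)ᵀ = 1 := by
      rw [← transpose_mul, Matrix.nonsing_inv_mul _ hu, transpose_one]
    simp only [transpose_mul, sy_tr, Matrix.mul_smul, Matrix.mul_assoc, h2, transpose_smul,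
      transpose_transpose, Matrix.smul_mul, Matrix.mul_one]
    rw [← Matrix.mul_assoc, Matrix.nonsing_inv_mul _ hu, Matrix.one_mul]
  · have hu : IsUnit x.1.1.det := isUnit_iff_ne_zero.mpr x.1.2.1
    have h2 : (x.1.1)ᵀ * (x.1.1⁻¹)ᵀ = 1 := by
      rw [← transpose_mul, Matrix.nonsing_inv_mul _ hu, transpose_one]
    simp [h2]
  · simp only [Matrix.one_mul]
    exact (htr _).trans x.1.2.2
  · exact (aux _ _ _ x.2.1).1
  · have h := x.2.2
    simp only [Matrix.one_mul] at h
    rw [(aux _ _ _ x.2.1).2.1] at h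
    rw [← htr]; exact h
  · rintro ⟨⟨A, h⟩, a, b, c⟩
    have hu : IsUnit A.det := isUnit_iff_ne_zero.mpr h.1
    simp only [← Matrix.mul_assoc, Matrix.nonsing_inv_mul _ hu, Matrix.one_mul]
    rfl
  · rintro ⟨⟨A, B, D⟩, h⟩
    obtain ⟨h1, h2, h3⟩ := aux A B D h.1
    have hu : IsUnit A.det := isUnit_iff_ne_zero.mpr h1
    simp only [Subtype.mk.injEq, Prod.mk.injEq]
    refine ⟨trivial, ?_, h2.symm⟩
    rw [sy_of _ h3, ← Matrix.mul_assoc, Matrix.mul_nonsing_inv _ hu, Matrix.one_mul]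

lemma rank_one {F : Type} [Field F] (C : M2 F) (h0 : C ≠ 0) (hd : C.det = 0) :
    ∃ P P' Q Q' : M2 F, P' * P = 1 ∧ Q * Q' = 1 ∧ C = P * !![1, 0; 0, 0] * Q := by
  suffices ∃ P Q : M2 F, P.det ≠ 0 ∧ Q.det ≠ 0 ∧ C = P * !![1, 0; 0, 0] * Q by
    obtain ⟨P, Q, hP, hQ, h⟩ := this
    exact ⟨P, P⁻¹, Q, Q⁻¹, Matrix.nonsing_inv_mul _ (isUnit_iff_ne_zero.mpr hP),
      Matrix.mul_nonsing_inv _ (isUnit_iff_ne_zero.mpr hQ), h⟩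
  rw [Matrix.det_fin_two] at hd
  by_cases h1 : C 0 0 = 0
  · by_cases h2 : C 0 1 = 0
    · by_cases h3 : C 1 0 = 0
      · have h4 : C 1 1 ≠ 0 := by
          intro h4; apply h0; ext i j; fin_cases i <;> fin_cases j <;> simp [*]
        refine ⟨!![0, 1; C 1 1, 0], !![0, 1; 1, 0], by simp [Matrix.det_fin_two, h4], 
          by simp [Matrix.det_fin_two], ?_⟩
        ext i j; fin_cases i <;> fin_cases j <;> simp [*]
      · refine ⟨!![0, 1; C 1 0, 0], !![1, C 1 1 / C 1 0; 0, 1],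
          by simp [Matrix.det_fin_two, h3], by simp [Matrix.det_fin_two], ?_⟩
        ext i j; fin_cases i <;> fin_cases j <;> simp [*]
        field_simp
    · refine ⟨!![C 0 1, 0; C 1 1, 1], !![0, 1; 1, 0], by simp [Matrix.det_fin_two, h2], 
        by simp [Matrix.det_fin_two], ?_⟩
      have : C 1 0 = 0 := by simpa [h1, h2] using hd
      ext i j; fin_cases i <;> fin_cases j <;> simp [*]
  · refine ⟨!![C 0 0, 0; C 1 0, 1], !![1, C 0 1 / C 0 0; 0, 1], by simp [Matrix.det_fin_two, h1],
      by simp [Matrix.det_fin_two], ?_⟩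
    ext i j; fin_cases i <;> fin_cases j <;> simp [*]
    · field_simp
    · field_simp; linear_combination hd

lemma NK_rank_one {F : Type} [Field F] [Finite F] (d t : F) (hd : d ≠ 0) (C : M2 F) (h0 : C ≠ 0)
    (hC : C.det = 0) : NK d t 1 1 C = Nat.card F ^ 4 * (Nat.card F - 1) := by
  obtain ⟨P, P', Q, Q', hP, hQ, h⟩ := rank_one C h0 hC
  rw [NK_twist d t P P' Q Q' _ C hP hQ h]
  apply NK_E d t hd
  by_contra hc
  push Not at hc
  have h1 : (Q * P'ᵀ).det = 0 := by rw [Matrix.det_fin_two, hc.1, hc.2]; ring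
  have h2 := congrArg Matrix.det hP
  have h3 := congrArg Matrix.det hQ
  simp only [Matrix.det_mul, Matrix.det_transpose, Matrix.det_one] at h1 h2 h3
  rcases mul_eq_zero.mp h1 with h | h <;> simp [h] at h2 h3

lemma NK_asymm {F : Type} [Field F] [DecidableEq F] [Finite F] (d t : F) (hd : d ≠ 0) (c : F)
    (hc : c ≠ 0) : NK d t 1 1 !![0, c; -c, 0] = if t = 0 then Nat.card F ^ 6 else 0 := by
  rw [NK_twist d t 1 1 !![0, c; -c, 0] !![0, -c⁻¹; c⁻¹, 0] 1 _ (by simp) ?_ (by simp)]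
  · rw [← NK_one_asymm d t hd c c⁻¹]
    congr 1
    · simp
    · ext i j; fin_cases i <;> fin_cases j <;> simp
  · ext i j; fin_cases i <;> fin_cases j <;> simp [hc]

lemma NK_gen {F : Type} [Field F] [Finite F] (d t : F) (hd : d ≠ 0) (C : M2 F)
    (hC : C.det ≠ 0) (h : ¬ ∃ c, c ≠ 0 ∧ C = !![0, c; -c, 0]) :
    NK d t 1 1 C = Nat.card F ^ 5 := by
  rw [NK_twist d t 1 1 C C⁻¹ 1 _ (by simp)
    (Matrix.mul_nonsing_inv _ (isUnit_iff_ne_zero.mpr hC)) (by simp)]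
  apply NK_one_gen d t hd
  simp only [transpose_one, Matrix.mul_one]
  rintro ⟨h1, h2, h3⟩
  apply h
  refine ⟨C 0 1, ?_, ?_⟩
  · intro h'; apply hC; rw [Matrix.det_fin_two, h1, h']; ring
  · ext i j; fin_cases i <;> fin_cases j <;> simp [*]

lemma sum_ite_card {α : Type} [Fintype α] (P : α → Prop) [DecidablePred P] (u v : ℕ) :
    ∑ a, (u + if P a then v else 0) = Fintype.card α * u + v * Nat.card {a // P a} := by
  rw [Finset.sum_add_distrib, ← Finset.sum_filter, Nat.card_eq_fintype_card, Fintype.card_subtype]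
  simp [mul_comm]

lemma card_mul {F : Type} [Field F] [Fintype F] [DecidableEq F] (z : F) :
    Nat.card {x : F × F // x.1 * x.2 = z} =
      (Fintype.card F - 1) + if z = 0 then Fintype.card F else 0 := by
  rw [card_fibP (fun a b : F => a * b = z)]
  have : ∀ a : F, Nat.card {b // a * b = z} =
      if a = 0 then (if z = 0 then Fintype.card F else 0) else 1 := by
    intro a
    split_ifs with h h'
    · subst h; subst h'
      simp
    · subst h
      simp [Ne.symm h']
    · rw [Nat.card_eq_one_iff_unique]
      refine ⟨⟨fun x y => Subtype.ext (mul_left_cancel₀ h (x.2.trans y.2.symm))⟩,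
        ⟨⟨z / a, mul_div_cancel₀ _ h⟩⟩⟩
  simp only [this]
  rw [← Finset.add_sum_erase _ _ (Finset.mem_univ (0 : F))]
  rw [Finset.sum_congr rfl (g := fun _ => 1)]
  · simp [Finset.card_erase_of_mem, add_comm]
  · intro x hx
    simp [Finset.ne_of_mem_erase hx]

lemma card_det {F : Type} [Field F] [Fintype F] [DecidableEq F] (y : F) :
    Nat.card {A : M2 F // A.det = y} =
      Fintype.card F ^ 2 * (Fintype.card F - 1) +
      Fintype.card F * ((Fintype.card F - 1) + if y = 0 then Fintype.card F else 0) := by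
  have e : Nat.card {A : M2 F // A.det = y} =
      Nat.card {x : (F × F) × (F × F) // x.2.1 * x.2.2 = y + x.1.1 * x.1.2} := by
    refine Nat.card_congr ⟨fun A => ⟨((A.1 0 1, A.1 1 0), (A.1 0 0, A.1 1 1)), ?_⟩,
      fun x => ⟨!![x.1.2.1, x.1.1.1; x.1.1.2, x.1.2.2], ?_⟩, ?_, ?_⟩
    · have := A.2
      rw [Matrix.det_fin_two] at this
      linear_combination this
    · have := x.2
      simp [Matrix.det_fin_two, this]
    · rintro ⟨A, h⟩
      simp only [Subtype.mk.injEq]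
      exact (Matrix.eta_fin_two A).symm
    · rintro ⟨⟨⟨a, b⟩, c, d⟩, h⟩
      simp
  rw [e, card_fibP (fun a b : F × F => b.1 * b.2 = y + a.1 * a.2)]
  simp only [card_mul]
  rw [sum_ite_card (fun a : F × F => y + a.1 * a.2 = 0)]
  have : ∀ a : F × F, y + a.1 * a.2 = 0 ↔ a.1 * a.2 = -y := by
    intro a
    rw [add_comm, add_eq_zero_iff_eq_neg]
  simp only [this, card_mul, neg_eq_zero, Fintype.card_prod]
  ring

lemma card_det_trace {F : Type} [Field F] [Fintype F] [DecidableEq F] (y s : F) :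
    Nat.card {A : M2 F // A.det = y ∧ A.trace = s} =
      Fintype.card F * (Fintype.card F - 1) +
      Fintype.card F * Nat.card {x : F // x * (s - x) - y = 0} := by
  have e : Nat.card {A : M2 F // A.det = y ∧ A.trace = s} =
      Nat.card {x : F × (F × F) // x.2.1 * x.2.2 = x.1 * (s - x.1) - y} := by
    refine Nat.card_congr ⟨fun A => ⟨(A.1 0 0, (A.1 0 1, A.1 1 0)), ?_⟩,
      fun x => ⟨!![x.1.1, x.1.2.1; x.1.2.2, s - x.1.1], ?_⟩, ?_, ?_⟩
    · obtain ⟨h1, h2⟩ := A.2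
      rw [Matrix.det_fin_two] at h1
      rw [Matrix.trace_fin_two] at h2
      linear_combination - h1 + A.1 0 0 * h2
    · have := x.2
      simp [Matrix.det_fin_two, this, Matrix.trace_fin_two]
    · rintro ⟨A, h1, h2⟩
      simp only [Subtype.mk.injEq]
      rw [Matrix.trace_fin_two] at h2
      rw [← h2, add_sub_cancel_left]
      exact (Matrix.eta_fin_two A).symm
    · rintro ⟨⟨a, b, c⟩, h⟩
      simp
  rw [e, card_fibP (fun (a : F) (b : F × F) => b.1 * b.2 = a * (s - a) - y)]
  simp only [card_mul]
  rw [sum_ite_card (fun a : F => a * (s - a) - y = 0)]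

lemma card_G {F : Type} [Field F] [Fintype F] [DecidableEq F] (d t : F) (hd : d ≠ 0) :
    Nat.card {A : M2 F // A.det ≠ 0 ∧ A.trace * (1 + d / A.det) = t} =
      Fintype.card F * ((Fintype.card F - 1) * (Fintype.card F - 2) +
        Nat.card {v : F × F // v.1 ≠ 0 ∧ v.2 ≠ 0 ∧ v.2 ≠ -d ∧
          (v.1 + v.2 / v.1) * (1 + d / v.2) = t}) +
      if t = 0 then Fintype.card F ^ 2 * (Fintype.card F - 1) +
        Fintype.card F * (Fintype.card F - 1) else 0 := by
  rw [card_fib (fun A : M2 F => A.det ≠ 0 ∧ A.trace * (1 + d / A.det) = t) Matrix.det,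
    card_fib (fun v : F × F => v.1 ≠ 0 ∧ v.2 ≠ 0 ∧ v.2 ≠ -d ∧
          (v.1 + v.2 / v.1) * (1 + d / v.2) = t) Prod.snd]
  have key : ∀ y : F, Nat.card {A : M2 F // A.det = y ∧ A.det ≠ 0 ∧
      A.trace * (1 + d / A.det) = t} =
      (if y ∈ ({0, -d} : Finset F) then 0 else Fintype.card F * (Fintype.card F - 1)) +
      Fintype.card F * Nat.card {v : F × F // v.2 = y ∧ v.1 ≠ 0 ∧ v.2 ≠ 0 ∧ v.2 ≠ -d ∧
          (v.1 + v.2 / v.1) * (1 + d / v.2) = t} +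
      if y = -d then (if t = 0 then Fintype.card F ^ 2 * (Fintype.card F - 1) +
        Fintype.card F * (Fintype.card F - 1) else 0) else 0 := by
    intro y
    by_cases h0 : y = 0
    · subst h0
      have h1 : IsEmpty {A : M2 F // A.det = 0 ∧ A.det ≠ 0 ∧ A.trace * (1 + d / A.det) = t} :=
        ⟨fun x => x.2.2.1 x.2.1⟩
      have h2 : IsEmpty {v : F × F // v.2 = 0 ∧ v.1 ≠ 0 ∧ v.2 ≠ 0 ∧ v.2 ≠ -d ∧
          (v.1 + v.2 / v.1) * (1 + d / v.2) = t} := ⟨fun x => x.2.2.2.1 x.2.1⟩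
      rw [Nat.card_of_isEmpty, Nat.card_of_isEmpty]
      simp [eq_comm, hd]
    by_cases h1 : y = -d
    · subst h1
      have h2 : IsEmpty {v : F × F // v.2 = -d ∧ v.1 ≠ 0 ∧ v.2 ≠ 0 ∧ v.2 ≠ -d ∧
          (v.1 + v.2 / v.1) * (1 + d / v.2) = t} := ⟨fun x => x.2.2.2.2.1 x.2.1⟩
      rw [Nat.card_of_isEmpty (α := {v : F × F // _})]
      have h3 : ∀ A : M2 F, (A.det = -d ∧ A.det ≠ 0 ∧ A.trace * (1 + d / A.det) = t) ↔
          (A.det = -d ∧ t = 0) := by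
        intro A
        refine and_congr_right fun h => ?_
        rw [h]
        have : 1 + d / -d = 0 := by field_simp; ring
        rw [this, mul_zero, eq_comm]
        simp [hd]
      simp only [h3]
      split_ifs with h4 h5 h5
      · simp only [h5, and_true, card_det]
        simp [hd]
      · simp [h5]
      · simp at h4
      · simp at h4
    · have hs : 1 + d / y ≠ 0 := by
        intro h
        field_simp at h
        apply h1
        linear_combination h
      have e1 : ∀ A : M2 F, (A.det = y ∧ A.det ≠ 0 ∧ A.trace * (1 + d / A.det) = t) ↔
          (A.det = y ∧ A.trace = t / (1 + d / y)) := by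
        intro A
        refine and_congr_right fun h => ?_
        rw [h, eq_div_iff hs]
        simp [h0]
      simp only [e1, card_det_trace]
      have e2 : Nat.card {v : F × F // v.2 = y ∧ v.1 ≠ 0 ∧ v.2 ≠ 0 ∧ v.2 ≠ -d ∧
          (v.1 + v.2 / v.1) * (1 + d / v.2) = t} =
          Nat.card {x : F // x * (t / (1 + d / y) - x) - y = 0} := by
        refine Nat.card_congr ⟨fun v => ⟨v.1.1, ?_⟩, fun x => ⟨(x.1, y), rfl, ?_, h0, h1, ?_⟩, 
          ?_, ?_⟩
        · obtain ⟨⟨x, y'⟩, h, hx, h2, h3, h4⟩ := v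
          dsimp only at h hx h4 ⊢
          subst h
          rw [← h4, mul_div_assoc, div_self hs]
          field_simp
          ring
        · intro h
          have := x.2
          have hx : x.1 = 0 := h
          rw [hx] at this
          apply h0
          linear_combination -this
        · obtain ⟨x, hx⟩ := x
          have hx0 : x ≠ 0 := by
            rintro rfl
            apply h0
            linear_combination -hx
          dsimp only
          rw [← eq_div_iff hs]
          have : x * (x + y / x) = x * (t / (1 + d / y)) := by
            rw [mul_add, mul_div_cancel₀ _ hx0]
            linear_combination -hx
          exact mul_left_cancel₀ hx0 this
        · rintro ⟨⟨x, y'⟩, h, hx, h2, h3, h4⟩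
          dsimp only at h
          subst h
          rfl
        · rintro ⟨x, hx⟩
          rfl
      rw [e2]
      simp [h0, h1]
  simp only [key]
  rw [Finset.sum_add_distrib, Finset.sum_add_distrib, ← Finset.mul_sum, Finset.sum_ite_eq']
  have : ∑ y : F, (if y ∈ ({0, -d} : Finset F) then 0 else Fintype.card F * (Fintype.card F - 1))
      = (Fintype.card F - 2) * (Fintype.card F * (Fintype.card F - 1)) := by
    simp_rw [← ite_not (_ ∈ _)]
    rw [← Finset.sum_filter, Finset.sum_const, smul_eq_mul]
    congr 1
    have : (univ.filter fun y : F => y ∉ ({0, -d} : Finset F)) = ({0, -d} : Finset F)ᶜ := by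
      ext y; simp
    rw [this, Finset.card_compl, Finset.card_pair (by simpa [eq_comm] using hd)]
  rw [this]
  simp only [Finset.mem_univ, if_true]
  ring

lemma sum_NK {F : Type} [Field F] [Fintype F] [DecidableEq F] (d t : F) (hd : d ≠ 0) :
    ((∑ C : M2 F, NK d t 1 1 C : ℕ) : ℤ) =
      NK d t 1 1 0 + (Fintype.card F : ℤ) ^ 4 * ((Fintype.card F : ℤ) ^ 2 - 1) ^ 2 +
      ((Fintype.card F : ℤ) ^ 5 * (Fintype.card F - 1) *
        ((Fintype.card F : ℤ) ^ 3 - Fintype.card F - 1) +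
      if t = 0 then (Fintype.card F : ℤ) ^ 7 - (Fintype.card F : ℤ) ^ 6 else 0) := by
  classical
  have hq : 1 ≤ Fintype.card F := Fintype.card_pos
  have hqc : Nat.card F = Fintype.card F := Nat.card_eq_fintype_card
  set q : ℤ := (Fintype.card F : ℤ) with hqdef
  have key : ∀ C : M2 F, (NK d t 1 1 C : ℤ) = q ^ 5 +
      (if C.det = 0 then q ^ 4 * (q - 1) - q ^ 5 else 0) +
      (if C = 0 then (NK d t 1 1 0 : ℤ) - q ^ 4 * (q - 1) else 0) +
      (if (∃ c, c ≠ 0 ∧ C = !![0, c; -c, 0]) then (if t = 0 then q ^ 6 else 0) - q ^ 5 else 0) := by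
    intro C
    by_cases h0 : C = 0
    · subst h0
      have : ¬ ∃ c : F, c ≠ 0 ∧ (0 : M2 F) = !![0, c; -c, 0] := by
        rintro ⟨c, hc, h⟩
        have := congrFun (congrFun h 0) 1
        simp at this
        exact hc this.symm
      rw [if_neg this, if_pos rfl, if_pos (by simp)]
      ring
    by_cases h1 : C.det = 0
    · have : ¬ ∃ c : F, c ≠ 0 ∧ C = !![0, c; -c, 0] := by
        rintro ⟨c, hc, h⟩
        rw [h] at h1
        simp [Matrix.det_fin_two] at h1
        exact hc h1
      rw [if_neg this, if_neg h0, if_pos h1, NK_rank_one d t hd C h0 h1, hqc]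
      push_cast [hq]
      ring
    by_cases h2 : ∃ c : F, c ≠ 0 ∧ C = !![0, c; -c, 0]
    · rw [if_pos h2, if_neg h0, if_neg h1]
      obtain ⟨c, hc, rfl⟩ := h2
      rw [NK_asymm d t hd c hc, hqc]
      push_cast
      ring
    · rw [if_neg h2, if_neg h0, if_neg h1, NK_gen d t hd C h1 h2, hqc]
      push_cast
      ring
  push_cast
  rw [Finset.sum_congr rfl (fun C _ => key C)]
  rw [Finset.sum_add_distrib, Finset.sum_add_distrib, Finset.sum_add_distrib, Finset.sum_ite_eq',
    ← Finset.sum_filter, ← Finset.sum_filter, Finset.sum_const, Finset.sum_const, Finset.sum_const]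
  have c1 : #{C : M2 F | C.det = 0} = Fintype.card F ^ 2 * (Fintype.card F - 1) +
      Fintype.card F * ((Fintype.card F - 1) + Fintype.card F) := by
    rw [← Fintype.card_subtype, ← Nat.card_eq_fintype_card, card_det]
    simp
  have c2 : #{C : M2 F | ∃ c, c ≠ 0 ∧ C = !![0, c; -c, 0]} = Fintype.card F - 1 := by
    have : (univ.filter fun C : M2 F => ∃ c, c ≠ 0 ∧ C = !![0, c; -c, 0]) =
        (univ.erase (0 : F)).image (fun c => !![0, c; -c, 0]) := by
      ext C; simp [eq_comm]
    rw [this, Finset.card_image_of_injective, Finset.card_erase_of_mem (Finset.mem_univ _),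
      Finset.card_univ]
    intro a b h
    have := congrFun (congrFun h 0) 1
    simpa using this
  have c3 : #(univ : Finset (M2 F)) = Fintype.card F ^ 4 := by
    rw [Finset.card_univ, ← Nat.card_eq_fintype_card]
    simp [Matrix, Nat.card_eq_fintype_card]
    ring
  rw [c1, c2, c3]
  simp only [nsmul_eq_mul, Finset.mem_univ, if_true]
  push_cast [hq]
  simp only [← hqdef]
  split_ifs <;> ring

lemma trace_blocks {F : Type} [Field F] (A B C D : M2 F) :
    (fromBlocks A B C D).trace = A.trace + D.trace := by
  simp [Matrix.trace, Fintype.sum_sum_type]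

lemma total {ℓ : ℕ} [Fact ℓ.Prime] (d t : ZMod ℓ) (hd : d ≠ 0) :
    Nat.card {M : Matrix (Fin 2 ⊕ Fin 2) (Fin 2 ⊕ Fin 2) (ZMod ℓ) //
        inGSp ℓ 2 d M ∧ M.trace = t} = ∑ C : M2 (ZMod ℓ), NK d t 1 1 C := by
  unfold NK
  rw [← Nat.card_sigma]
  have aux : ∀ A B C D : M2 (ZMod ℓ), inGSp ℓ 2 d (fromBlocks A B C D) ↔ Cond d A B C D := by
    intro A B C D
    have e : (fromBlocks A B C D)ᵀ * Om ℓ 2 * fromBlocks A B C D = d • Om ℓ 2 ↔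
        Cond d A B C D := by
      unfold Om Cond
      rw [Matrix.fromBlocks_transpose, Matrix.fromBlocks_multiply, Matrix.fromBlocks_multiply,
        Matrix.fromBlocks_smul, Matrix.fromBlocks_inj]
      simp only [Matrix.mul_zero, Matrix.mul_neg, Matrix.mul_one, zero_add, add_zero,
        Matrix.neg_mul, smul_zero, smul_neg]
      constructor
      · rintro ⟨h1, h2, h3, h4⟩
        refine ⟨?_, ?_, ?_⟩
        · rw [neg_add_eq_zero] at h1; exact h1.symm
        · rw [neg_add_eq_zero] at h4; exact h4.symm
        · rw [← h2]; abel
      · rintro ⟨h1, h2, h3⟩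
        refine ⟨?_, ?_, ?_, ?_⟩
        · rw [h1]; abel
        · rw [← h3]; abel
        · have := congrArg Matrix.transpose h3
          simp only [transpose_sub, transpose_mul, transpose_transpose, transpose_smul,
            transpose_one] at this
          rw [← this]; abel
        · rw [h2]; abel
    unfold inGSp
    rw [e, and_iff_right_iff_imp]
    intro h
    rw [← e] at h
    have hO : (Om ℓ 2).det ≠ 0 := by
      have : Om ℓ 2 * (- Om ℓ 2) = 1 := by
        unfold Om
        rw [Matrix.fromBlocks_neg, Matrix.fromBlocks_multiply]
        simp
      have := congrArg Matrix.det this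
      rw [Matrix.det_mul, Matrix.det_one] at this
      intro h
      simp [h] at this
    have h := congrArg Matrix.det h
    rw [Matrix.det_mul, Matrix.det_mul, Matrix.det_smul] at h
    rw [isUnit_iff_ne_zero]
    intro h'
    rw [h'] at h
    simp only [mul_zero] at h
    exact mul_ne_zero (pow_ne_zero _ hd) hO h.symm
  refine Nat.card_congr ⟨fun M => ⟨M.1.toBlocks₂₁, (M.1.toBlocks₁₁, M.1.toBlocks₁₂, M.1.toBlocks₂₂),
    ?_, ?_⟩, fun x => ⟨fromBlocks x.2.1.1 x.2.1.2.1 x.1 x.2.1.2.2, ?_, ?_⟩, ?_, ?_⟩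
  · rw [← aux, Matrix.fromBlocks_toBlocks]; exact M.2.1
  · have := M.2.2
    rw [← Matrix.fromBlocks_toBlocks M.1, trace_blocks] at this
    simpa using this
  · rw [aux]; exact x.2.2.1
  · rw [trace_blocks]; simpa using x.2.2.2
  · rintro ⟨M, h⟩
    simp [Matrix.fromBlocks_toBlocks]
  · rintro ⟨C, ⟨A, B, D⟩, h⟩
    rfl

theorem stmt14 (p ℓ : ℕ) [hp : Fact p.Prime] [hl : Fact ℓ.Prime] (hp2 : 2 < p) (hne : ℓ ≠ p)
    (t : ZMod ℓ) :
    Nat.card {M : Matrix (Fin 2 ⊕ Fin 2) (Fin 2 ⊕ Fin 2) (ZMod ℓ) //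
        inGSp ℓ 2 (p : ZMod ℓ) M ∧ M.trace = t} =
      (ℓ ^ 4 * ((ℓ - 1) * (ℓ - 2) + aCount ℓ p t) + if t = 0 then ℓ ^ 6 - ℓ ^ 4 else 0) +
      ℓ ^ 4 * (ℓ ^ 2 - 1) ^ 2 +
      (ℓ ^ 5 * (ℓ - 1) * (ℓ ^ 3 - ℓ - 1) + if t = 0 then ℓ ^ 7 - ℓ ^ 6 else 0) := by
  have hd : (p : ZMod ℓ) ≠ 0 := by
    intro h
    rw [ZMod.natCast_eq_zero_iff] at h
    exact hne ((Nat.prime_dvd_prime_iff_eq hl.out hp.out).mp h)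
  have h2 : 2 ≤ ℓ := hl.out.two_le
  rw [total _ t hd]
  have h := sum_NK (p : ZMod ℓ) t hd
  rw [NK_zero _ t hd, card_G _ t hd, Nat.card_eq_fintype_card, ZMod.card] at h
  change _ = (((ℓ ^ 3 * (ℓ * ((ℓ - 1) * (ℓ - 2) + aCount ℓ p t) + _) : ℕ) : ℤ) + _ + _) at h
  have i1 : 1 ≤ ℓ := by omega
  have i2 : ℓ ^ 4 ≤ ℓ ^ 6 := Nat.pow_le_pow_right i1 (by norm_num)
  have i3 : ℓ ^ 6 ≤ ℓ ^ 7 := Nat.pow_le_pow_right i1 (by norm_num)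
  have i4 : 1 ≤ ℓ ^ 2 := Nat.one_le_pow _ _ i1
  have i5 : ℓ ≤ ℓ ^ 3 := Nat.le_self_pow (by norm_num) _
  have i6 : 1 ≤ ℓ ^ 3 - ℓ := by
    have : 2 * ℓ ≤ ℓ ^ 3 := by nlinarith
    omega
  zify
  push_cast at h
  rw [h]
  split_ifs <;> push_cast [i1, i2, i3, i4, i5, i6, h2] <;> ring
end
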